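/- arXiv:1601.03332 — 2 statements merged into one kernel-verified Lean document; each statement's English description precedes it below -/
import Mathlib

section
/- Let p, q ∈ (2, ∞) with q < p. Then: (i) there exist D ∈ [1, ∞) and a map f : L_q → L_p such that ‖x − y‖_{L_q}^{q/p} ≤ ‖f(x) − f(y)‖_{L_p} ≤ D · ‖x − y‖_{L_q}^{q/p} for all x, y ∈ L_q; and (ii) if θ ∈ (0, 1] is such that there exist D ∈ [1, ∞) and f : L_q → L_p with ‖x − y‖_{L_q}^{θ} ≤ ‖f(x) − f(y)‖_{L_p} ≤ D · ‖x − y‖_{L_q}^{θ} for all x, y ∈ L_q, then θ ≤ q/p. In other words, the maximal θ ∈ (0,1] for which the metric space (L_q, ‖x − y‖_{L_q}^θ) admits a bi-Lipschitz embedding into L_p equals q/p. -/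
/-- The Lebesgue space `L_p(ℝ)` (with `p ∈ [1,∞)` given as a real number). -/
noncomputable abbrev LpSpace (p : ℝ) :=
  MeasureTheory.Lp ℝ (ENNReal.ofReal p) (MeasureTheory.volume : MeasureTheory.Measure ℝ)

section

open Finset
open scoped BigOperators

/-! ### Averages over finite types -/

theorem expect_fin_cons {α : Type*} [Fintype α] {n : ℕ} (F : (Fin (n + 1) → α) → ℝ) :
    𝔼 v, F v = 𝔼 a, 𝔼 v : Fin n → α, F (Fin.cons a v) := by
  rw [← Finset.expect_product' univ univ (fun a (v : Fin n → α) => F (Fin.cons a v)),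
    univ_product_univ]
  exact (Fintype.expect_equiv (Fin.consEquiv fun _ : Fin (n + 1) => α) _ _
    fun x => rfl).symm

theorem expect_bool (f : Bool → ℝ) : 𝔼 b, f b = (f true + f false) / 2 := by
  rw [Fintype.expect_eq_sum_div_card]
  simp

theorem expect_unique {α : Type*} [Fintype α] [Unique α] (f : α → ℝ) : 𝔼 a, f a = f default := by
  rw [Fintype.expect_eq_sum_div_card]
  simp

theorem expect_nonneg_real {ι : Type*} [Fintype ι] {f : ι → ℝ} (h : ∀ i, 0 ≤ f i) :
    0 ≤ 𝔼 i, f i :=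
  Finset.expect_nonneg fun i _ => h i

theorem expect_mono_real {ι : Type*} [Fintype ι] {f g : ι → ℝ} (h : ∀ i, f i ≤ g i) :
    𝔼 i, f i ≤ 𝔼 i, g i :=
  Finset.expect_le_expect fun i _ => h i

theorem expect_pow_le_of_even {ι : Type*} [Fintype ι] [Nonempty ι] (f : ι → ℝ) {n : ℕ}
    (hn : Even n) : (𝔼 i, f i) ^ n ≤ 𝔼 i, f i ^ n := by
  have h := Real.pow_arith_mean_le_arith_mean_pow_of_even univ
    (fun _ : ι => (1 / Fintype.card ι : ℝ)) f (fun _ _ => by positivity) (by simp) hn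
  simpa [Fintype.expect_eq_sum_div_card, ← mul_sum, div_eq_inv_mul] using h

theorem expect_pow_le_of_nonneg {ι : Type*} [Fintype ι] [Nonempty ι] (f : ι → ℝ)
    (hf : ∀ i, 0 ≤ f i) (n : ℕ) : (𝔼 i, f i) ^ n ≤ 𝔼 i, f i ^ n := by
  have h := Real.pow_arith_mean_le_arith_mean_pow univ
    (fun _ : ι => (1 / Fintype.card ι : ℝ)) f (fun _ _ => by positivity) (by simp)
    (fun i _ => hf i) n
  simpa [Fintype.expect_eq_sum_div_card, ← mul_sum, div_eq_inv_mul] using h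

theorem expect_rpow_le_of_nonneg {ι : Type*} [Fintype ι] [Nonempty ι] (f : ι → ℝ)
    (hf : ∀ i, 0 ≤ f i) {s : ℝ} (hs : 1 ≤ s) : (𝔼 i, f i) ^ s ≤ 𝔼 i, f i ^ s := by
  have h := Real.rpow_arith_mean_le_arith_mean_rpow univ
    (fun _ : ι => (1 / Fintype.card ι : ℝ)) f (fun _ _ => by positivity) (by simp)
    (fun i _ => hf i) hs
  simpa [Fintype.expect_eq_sum_div_card, ← mul_sum, div_eq_inv_mul] using h

/-! ### Elementary inequalities -/

theorem mul_pow_mul_le_half_add {K X a : ℝ} (hK : 0 ≤ K) (hX : 0 ≤ X) (ha : 0 ≤ a) (r : ℕ) :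
    K * X ^ r * a ≤ X ^ (r + 1) / 2 + K * (2 * K) ^ r * a ^ (r + 1) := by
  rcases le_total (2 * K * a) X with h | h
  · have h1 : K * X ^ r * a ≤ X ^ (r + 1) / 2 := by
      have := mul_le_mul_of_nonneg_left h (pow_nonneg hX r)
      rw [pow_succ]
      linarith
    have : 0 ≤ K * (2 * K) ^ r * a ^ (r + 1) := by positivity
    linarith
  · have h1 : X ^ r ≤ (2 * K * a) ^ r := pow_le_pow_left₀ hX h r
    have h2 : K * X ^ r * a ≤ K * (2 * K * a) ^ r * a := by gcongr
    have h3 : K * (2 * K * a) ^ r * a = K * (2 * K) ^ r * a ^ (r + 1) := by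
      rw [mul_pow (2 * K) a, pow_succ]
      ring
    have : 0 ≤ X ^ (r + 1) / 2 := by positivity
    linarith

theorem add_pow_succ_le {s a : ℝ} (hs : 0 ≤ s) (ha : 0 ≤ a) (r : ℕ) :
    (s + a) ^ (r + 1) ≤
      s ^ (r + 1) + (r + 1) * 2 ^ r * (s ^ r * a + a ^ (r + 1)) := by
  have h1 : (s + a) ^ (r + 1) ≤ s ^ (r + 1) + (r + 1) * (s + a) ^ r * a := by
    induction r with
    | zero => simp
    | succ r ih =>
      have h2 : (s + a) ^ (r + 1) * (s + a) ≤
          (s ^ (r + 1) + (r + 1) * (s + a) ^ r * a) * (s + a) := by gcongr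
      have h3 : s ^ (r + 1) * a ≤ (s + a) ^ (r + 1) * a := by
        gcongr
        linarith
      calc (s + a) ^ (r + 1 + 1) = (s + a) ^ (r + 1) * (s + a) := pow_succ _ _
        _ ≤ _ := h2
        _ = s ^ (r + 1 + 1) + s ^ (r + 1) * a + (r + 1) * (s + a) ^ (r + 1) * a := by ring
        _ ≤ _ := by push_cast; linarith
  have h4 : (s + a) ^ r ≤ 2 ^ r * (s ^ r + a ^ r) := by
    calc (s + a) ^ r ≤ 2 ^ (r - 1) * (s ^ r + a ^ r) := add_pow_le hs ha r
      _ ≤ _ := by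
        gcongr
        · norm_num
        · omega
  calc (s + a) ^ (r + 1) ≤ s ^ (r + 1) + (r + 1) * (s + a) ^ r * a := h1
    _ ≤ s ^ (r + 1) + (r + 1) * (2 ^ r * (s ^ r + a ^ r)) * a := by gcongr
    _ = _ := by ring

theorem exists_taylor_pow_bound (n : ℕ) : ∃ K : ℝ, 0 ≤ K ∧ ∀ x d : ℝ,
    |(x + d) ^ (n + 2) - x ^ (n + 2) - (n + 2) * x ^ (n + 1) * d| ≤
      K * (|x| ^ n * |d| ^ 2 + |d| ^ (n + 2)) := by
  induction n with
  | zero =>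
    refine ⟨1, zero_le_one, fun x d => ?_⟩
    have h : (x + d) ^ (0 + 2) - x ^ (0 + 2) - ((0 : ℕ) + 2) * x ^ (0 + 1) * d = d ^ 2 := by
      push_cast
      ring
    rw [h, abs_of_nonneg (sq_nonneg d)]
    have := sq_nonneg d
    simp only [pow_zero, sq_abs, zero_add]
    linarith
  | succ n ih =>
    obtain ⟨K, hK, h⟩ := ih
    refine ⟨4 * K + (n + 2), by positivity, fun x d => ?_⟩
    have e : (x + d) ^ (n + 1 + 2) - x ^ (n + 1 + 2) - ((n + 1 : ℕ) + 2) * x ^ (n + 1 + 1) * d =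
        (x + d) * ((x + d) ^ (n + 2) - x ^ (n + 2) - (n + 2) * x ^ (n + 1) * d)
          + (n + 2) * x ^ (n + 1) * d ^ 2 := by
      push_cast
      ring
    rw [e]
    refine (abs_add_le _ _).trans ?_
    rw [abs_mul, abs_mul, abs_mul, abs_pow, abs_pow, abs_of_nonneg (by positivity : (0:ℝ) ≤ n + 2)]
    set X := |x|
    set Y := |d|
    have hX : 0 ≤ X := abs_nonneg x
    have hY : 0 ≤ Y := abs_nonneg d
    have h1 : X * Y ^ (n + 2) ≤ X ^ (n + 1) * Y ^ 2 + Y ^ (n + 1 + 2) := by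
      rcases le_total X Y with hxy | hxy
      · have : X * Y ^ (n + 2) ≤ Y * Y ^ (n + 2) := by gcongr
        have h0 : 0 ≤ X ^ (n + 1) * Y ^ 2 := by positivity
        calc _ ≤ _ := this
          _ = Y ^ (n + 1 + 2) := by ring
          _ ≤ _ := by linarith
      · have : X * Y ^ (n + 2) ≤ X ^ (n + 1) * Y ^ 2 := by
          calc X * Y ^ (n + 2) = X * Y ^ n * Y ^ 2 := by ring
            _ ≤ X * X ^ n * Y ^ 2 := by gcongr
            _ = _ := by ring
        have h0 : 0 ≤ Y ^ (n + 1 + 2) := by positivity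
        linarith
    have h2 : Y * (X ^ n * Y ^ 2) ≤ X ^ (n + 1) * Y ^ 2 + Y ^ (n + 1 + 2) := by
      rcases le_total X Y with hxy | hxy
      · have : Y * (X ^ n * Y ^ 2) ≤ Y * (Y ^ n * Y ^ 2) := by gcongr
        have h0 : 0 ≤ X ^ (n + 1) * Y ^ 2 := by positivity
        calc _ ≤ _ := this
          _ = Y ^ (n + 1 + 2) := by ring
          _ ≤ _ := by linarith
      · have : Y * (X ^ n * Y ^ 2) ≤ X * (X ^ n * Y ^ 2) := by gcongr
        have h0 : 0 ≤ Y ^ (n + 1 + 2) := by positivity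
        calc _ ≤ _ := this
          _ = X ^ (n + 1) * Y ^ 2 := by ring
          _ ≤ _ := by linarith
    have h3 : |x + d| * |(x + d) ^ (n + 2) - x ^ (n + 2) - (n + 2) * x ^ (n + 1) * d| ≤
        (X + Y) * (K * (X ^ n * Y ^ 2 + Y ^ (n + 2))) := by
      gcongr
      · exact abs_add_le x d
      · exact h x d
    have h5 : X ^ (n + 1) * Y ^ 2 = X * (X ^ n * Y ^ 2) := by ring
    have h6 : Y ^ (n + 1 + 2) = Y * Y ^ (n + 2) := by ring
    have h7 : (X + Y) * (K * (X ^ n * Y ^ 2 + Y ^ (n + 2))) ≤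
        4 * K * (X ^ (n + 1) * Y ^ 2 + Y ^ (n + 1 + 2)) := by
      have : (X + Y) * (X ^ n * Y ^ 2 + Y ^ (n + 2)) ≤
          4 * (X ^ (n + 1) * Y ^ 2 + Y ^ (n + 1 + 2)) := by
        have e1 : 0 ≤ X ^ (n + 1) * Y ^ 2 := by positivity
        have e2 : 0 ≤ Y ^ (n + 1 + 2) := by positivity
        have e3 : (X + Y) * (X ^ n * Y ^ 2 + Y ^ (n + 2)) = X ^ (n + 1) * Y ^ 2 +
          X * Y ^ (n + 2) + Y * (X ^ n * Y ^ 2) + Y ^ (n + 1 + 2) := by ring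
        linarith
      nlinarith
    have h8 : (n + 2 : ℝ) * X ^ (n + 1) * Y ^ 2 ≤
        (n + 2) * (X ^ (n + 1) * Y ^ 2 + Y ^ (n + 1 + 2)) := by
      have e2 : 0 ≤ (n + 2 : ℝ) * Y ^ (n + 1 + 2) := by positivity
      linarith
    linarith

theorem exists_even_pow_avg_bound (r : ℕ) : ∃ K : ℝ, 0 ≤ K ∧ ∀ x d : ℝ,
    ((x + d) ^ (2 * (r + 1)) + (x - d) ^ (2 * (r + 1))) / 2 ≤
      x ^ (2 * (r + 1)) + K * (x ^ (2 * r) * d ^ 2 + d ^ (2 * (r + 1))) := by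
  obtain ⟨K, hK, h⟩ := exists_taylor_pow_bound (2 * r)
  refine ⟨K, hK, fun x d => ?_⟩
  have h1 := (abs_le.1 (h x d)).2
  have h2 := (abs_le.1 (h x (-d))).2
  have e : |d| ^ (2 * r + 2) = d ^ (2 * r + 2) := by
    rw [← abs_pow, abs_of_nonneg (Even.pow_nonneg ⟨r + 1, by ring⟩ d)]
  have e' : |x| ^ (2 * r) = x ^ (2 * r) := by
    rw [← abs_pow, abs_of_nonneg (Even.pow_nonneg ⟨r, by ring⟩ x)]
  rw [abs_neg] at h2
  rw [sq_abs, e, e'] at h1 h2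
  rw [← sub_eq_add_neg] at h2
  have e2 : 2 * (r + 1) = 2 * r + 2 := by ring
  rw [e2]
  linarith

theorem pow_le_even_pow_avg (r : ℕ) (x d : ℝ) :
    x ^ (2 * r) ≤ ((x + d) ^ (2 * r) + (x - d) ^ (2 * r)) / 2 := by
  have h := expect_pow_le_of_even (fun b : Bool => if b then x + d else x - d)
    (⟨r, by ring⟩ : Even (2 * r))
  simp only [expect_bool] at h
  simpa using h

/-! ### Random restrictions of sums of nonnegative numbers -/

theorem expect_coloring_sum_pow_le (r L : ℕ) [NeZero L] (n : ℕ) (a : Fin n → ℝ)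
    (ha : ∀ j, 0 ≤ a j) (t : ℝ) (ht : 0 ≤ t) :
    𝔼 c : Fin n → Fin L, (t + ∑ j, if c j = 0 then a j else 0) ^ (r + 1) ≤
      (t + (r + 1) * 2 ^ r * ((1 / L) * ∑ j, a j)) ^ (r + 1) +
        (r + 1) * 2 ^ r * ((1 / L) * ∑ j, a j ^ (r + 1)) := by
  induction n generalizing t with
  | zero => simp
  | succ n ih =>
    set K : ℝ := (r + 1) * 2 ^ r with hK
    have hK0 : 1 ≤ K := by
      have h1 : (1 : ℝ) ≤ 2 ^ r := one_le_pow₀ (by norm_num)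
      have h2 : (1 : ℝ) ≤ r + 1 := by
        have : (0 : ℝ) ≤ r := r.cast_nonneg
        linarith
      rw [hK]
      nlinarith
    have hL : (0 : ℝ) < L := by exact_mod_cast Nat.pos_of_ne_zero (NeZero.ne L)
    set μ : ℝ := (1 / L) * ∑ j : Fin n, a j.succ with hμ
    have hμ0 : 0 ≤ μ := mul_nonneg (by positivity) (sum_nonneg fun j _ => ha _)
    set σ : ℝ := (1 / L) * ∑ j : Fin n, a j.succ ^ (r + 1)
    have step : ∀ i : Fin L, 𝔼 c : Fin n → Fin L,
        (t + ∑ j, if (Fin.cons i c : Fin (n + 1) → Fin L) j = 0 then a j else 0) ^ (r + 1) ≤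
        (t + K * μ) ^ (r + 1) + K * σ +
          if i = 0 then K * ((t + K * μ) ^ r * a 0 + a 0 ^ (r + 1)) else 0 := by
      intro i
      have h := ih (fun j => a j.succ) (fun j => ha _) (t + if i = 0 then a 0 else 0)
        (by split_ifs <;> [linarith [ha 0]; linarith])
      simp only [Fin.sum_univ_succ, Fin.cons_zero, Fin.cons_succ, ← add_assoc]
      refine h.trans ?_
      split_ifs with hi
      · have h2 := add_pow_succ_le (add_nonneg ht (mul_nonneg (by linarith) hμ0) : 0 ≤ t + K * μ)
          (ha 0) r
        have e : t + a 0 + K * μ = t + K * μ + a 0 := by ring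
        rw [e]
        linarith
      · simp only [add_zero]
        exact le_rfl
    rw [expect_fin_cons]
    refine (expect_mono_real step).trans ?_
    rw [Finset.expect_add_distrib, Fintype.expect_const, Fintype.expect_eq_sum_div_card]
    simp only [sum_ite_eq', mem_univ, if_true, Fintype.card_fin, Fin.sum_univ_succ]
    have h3 : (t + K * μ) ^ (r + 1) + K * (1 / L) * ((t + K * μ) ^ r * a 0) ≤
        (t + K * (1 / L * (a 0 + ∑ j : Fin n, a j.succ))) ^ (r + 1) := by
      have hb : 0 ≤ K * (1 / L) * a 0 := mul_nonneg (by positivity) (ha 0)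
      have hs : 0 ≤ t + K * μ := by positivity
      have e : t + K * (1 / L * (a 0 + ∑ j : Fin n, a j.succ)) =
          (t + K * μ) + K * (1 / L) * a 0 := by
        rw [hμ]
        ring
      rw [e]
      calc _ = (t + K * μ) ^ r * ((t + K * μ) + K * (1 / L) * a 0) := by ring
        _ ≤ (t + K * μ + K * (1 / L) * a 0) ^ r * ((t + K * μ) + K * (1 / L) * a 0) := by
          have : t + K * μ ≤ t + K * μ + K * (1 / L) * a 0 := by linarith
          exact mul_le_mul_of_nonneg_right (pow_le_pow_left₀ hs this r) (by linarith)
        _ = _ := by ring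
    have e2 : K * ((t + K * μ) ^ r * a 0 + a 0 ^ (r + 1)) / L =
        K * (1 / L) * ((t + K * μ) ^ r * a 0) + K * (1 / L * a 0 ^ (r + 1)) := by
      field_simp
    rw [e2]
    have e3 : K * (1 / L * (a 0 ^ (r + 1) + ∑ j : Fin n, a j.succ ^ (r + 1))) =
      K * (1 / L * a 0 ^ (r + 1)) + K * σ := by ring
    rw [e3]
    linarith

/-! ### Martingale differences on the discrete cube -/

/-- The martingale differences of a function on the discrete cube, where the coordinates are
revealed in increasing order. -/
noncomputable def martDiff : {n : ℕ} → ((Fin n → Bool) → ℝ) → Fin n → (Fin n → Bool) → ℝ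
  | 0, _, _, _ => 0
  | _ + 1, h, j, v => Fin.cases (motive := fun _ => ℝ)
      ((𝔼 u, h (Fin.cons (v 0) u)) - 𝔼 u, h u)
      (fun i => martDiff (fun u => h (Fin.cons (v 0) u)) i (Fin.tail v)) j

/-- The part of the martingale square function coming from the coordinates in `S`. -/
noncomputable def sqFun {n : ℕ} (S : Fin n → Bool) (h : (Fin n → Bool) → ℝ) (v : Fin n → Bool) :
    ℝ :=
  ∑ j, if S j then martDiff h j v ^ 2 else 0

/-- The configuration equal to `v` on `S` and to `u` off `S`. -/
def mix {n : ℕ} (S v u : Fin n → Bool) : Fin n → Bool := fun j => if S j then v j else u j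

/-- The average of `h` over the coordinates outside `S`. -/
noncomputable def avgOff {n : ℕ} (S : Fin n → Bool) (h : (Fin n → Bool) → ℝ) (v : Fin n → Bool) :
    ℝ :=
  𝔼 u, h (mix S v u)

theorem martDiff_zero_cons {n : ℕ} (h : (Fin (n + 1) → Bool) → ℝ) (e : Bool) (v : Fin n → Bool) :
    martDiff h 0 (Fin.cons e v) = (𝔼 u, h (Fin.cons e u)) - 𝔼 u, h u := rfl

theorem martDiff_succ_cons {n : ℕ} (h : (Fin (n + 1) → Bool) → ℝ) (i : Fin n) (e : Bool)
    (v : Fin n → Bool) :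
    martDiff h i.succ (Fin.cons e v) = martDiff (fun u => h (Fin.cons e u)) i v := rfl

theorem sqFun_cons {n : ℕ} (S : Fin (n + 1) → Bool) (h : (Fin (n + 1) → Bool) → ℝ) (e : Bool)
    (v : Fin n → Bool) :
    sqFun S h (Fin.cons e v) =
      (if S 0 then ((𝔼 u, h (Fin.cons e u)) - 𝔼 u, h u) ^ 2 else 0) +
        sqFun (Fin.tail S) (fun u => h (Fin.cons e u)) v := by
  simp only [sqFun, Fin.sum_univ_succ, martDiff_zero_cons, martDiff_succ_cons]
  rfl

theorem sqFun_nonneg {n : ℕ} (S : Fin n → Bool) (h : (Fin n → Bool) → ℝ) (v : Fin n → Bool) :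
    0 ≤ sqFun S h v :=
  sum_nonneg fun j _ => by split_ifs <;> positivity

theorem mix_cons {n : ℕ} (S : Fin (n + 1) → Bool) (e b : Bool) (v u : Fin n → Bool) :
    mix S (Fin.cons e v) (Fin.cons b u) =
      Fin.cons (if S 0 then e else b) (mix (Fin.tail S) v u) := by
  funext j
  refine Fin.cases ?_ (fun i => ?_) j
  · simp [mix]
  · rfl

theorem avgOff_cons_of_mem {n : ℕ} {S : Fin (n + 1) → Bool} (hS : S 0 = true)
    (h : (Fin (n + 1) → Bool) → ℝ) (e : Bool) (v : Fin n → Bool) :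
    avgOff S h (Fin.cons e v) = avgOff (Fin.tail S) (fun u => h (Fin.cons e u)) v := by
  simp only [avgOff]
  rw [expect_fin_cons]
  simp [mix_cons, hS]

theorem avgOff_cons_of_notMem {n : ℕ} {S : Fin (n + 1) → Bool} (hS : S 0 = false)
    (h : (Fin (n + 1) → Bool) → ℝ) (e : Bool) (v : Fin n → Bool) :
    avgOff S h (Fin.cons e v) = avgOff (Fin.tail S) (fun u => 𝔼 b, h (Fin.cons b u)) v := by
  simp only [avgOff]
  rw [expect_fin_cons, Finset.expect_comm]
  simp [mix_cons, hS]

theorem expect_avgOff {n : ℕ} (S : Fin n → Bool) (h : (Fin n → Bool) → ℝ) :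
    𝔼 v, avgOff S h v = 𝔼 v, h v := by
  induction n with
  | zero =>
    rw [expect_unique, expect_unique, avgOff, expect_unique]
    congr 1
    exact Subsingleton.elim _ _
  | succ n ih =>
    rw [expect_fin_cons, expect_fin_cons]
    rcases hS : S 0
    · simp only [avgOff_cons_of_notMem hS, ih, Fintype.expect_const]
      rw [Finset.expect_comm]
    · simp only [avgOff_cons_of_mem hS, ih]

theorem martDiff_expect {n : ℕ} {ι : Type*} [Fintype ι] (k : ι → (Fin n → Bool) → ℝ) (j : Fin n)
    (v : Fin n → Bool) :
    martDiff (fun u => 𝔼 b, k b u) j v = 𝔼 b, martDiff (k b) j v := by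
  induction n with
  | zero => exact j.elim0
  | succ n ih =>
    obtain ⟨e, v, rfl⟩ : ∃ e w, v = Fin.cons e w := ⟨v 0, Fin.tail v, (Fin.cons_self_tail v).symm⟩
    refine Fin.cases ?_ (fun i => ?_) j
    · simp only [martDiff_zero_cons]
      rw [Finset.expect_sub_distrib, Finset.expect_comm univ univ,
        Finset.expect_comm univ univ (fun u b => k b u)]
    · simp only [martDiff_succ_cons]
      exact ih (fun b u => k b (Fin.cons e u)) i v

theorem sqFun_expect_le {n : ℕ} {ι : Type*} [Fintype ι] [Nonempty ι] (S : Fin n → Bool)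
    (k : ι → (Fin n → Bool) → ℝ) (v : Fin n → Bool) :
    sqFun S (fun u => 𝔼 b, k b u) v ≤ 𝔼 b, sqFun S (k b) v := by
  simp only [sqFun]
  rw [Finset.expect_sum_comm]
  refine sum_le_sum fun j _ => ?_
  split_ifs
  · rw [martDiff_expect]
    exact expect_pow_le_of_even _ even_two
  · simp

/-- The square function of a conditional expectation is controlled by the restricted square
function. -/
theorem sqFun_avgOff_le {n : ℕ} (S : Fin n → Bool) (h : (Fin n → Bool) → ℝ) (v : Fin n → Bool) :
    sqFun (fun _ => true) (avgOff S h) v ≤ 𝔼 u, sqFun S h (mix S v u) := by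
  induction n with
  | zero => simp [sqFun]
  | succ n ih =>
    obtain ⟨e, v, rfl⟩ : ∃ e w, v = Fin.cons e w := ⟨v 0, Fin.tail v, (Fin.cons_self_tail v).symm⟩
    rw [expect_fin_cons]
    simp only [mix_cons, sqFun_cons, if_true, expect_avgOff]
    rcases hS : S 0
    · simp only [avgOff_cons_of_notMem hS, expect_avgOff, Bool.false_eq_true, if_false, zero_add]
      have e1 : (𝔼 u : Fin n → Bool, 𝔼 b, h (Fin.cons b u)) = 𝔼 u, h u := by
        rw [expect_fin_cons, Finset.expect_comm]
      rw [e1, sub_self, zero_pow two_ne_zero, zero_add]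
      refine (ih _ _ _).trans ?_
      rw [Finset.expect_comm]
      exact expect_mono_real fun u => sqFun_expect_le _ (fun b u => h (Fin.cons b u)) _
    · simp only [avgOff_cons_of_mem hS, expect_avgOff, if_true, Fintype.expect_const,
        Finset.expect_add_distrib]
      gcongr
      exact ih _ _ _

/-- A Bellman function that decreases along symmetric steps is a supersolution for the whole
martingale. -/
theorem expect_bellman_le (U : ℝ → ℝ → ℝ)
    (hU : ∀ x d a, 0 ≤ a → (U (x + d) (a + d ^ 2) + U (x - d) (a + d ^ 2)) / 2 ≤ U x a)
    {n : ℕ} (h : (Fin n → Bool) → ℝ) (a : ℝ) (ha : 0 ≤ a) :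
    𝔼 v, U (h v) (a + sqFun (fun _ => true) h v) ≤ U (𝔼 v, h v) a := by
  induction n generalizing a with
  | zero => simp [sqFun]
  | succ n ih =>
    rw [expect_fin_cons]
    simp only [sqFun_cons, if_true, ← add_assoc]
    have h1 := expect_mono_real fun e : Bool => ih (fun u => h (Fin.cons e u))
      (a + ((𝔼 u, h (Fin.cons e u)) - 𝔼 u, h u) ^ 2) (by positivity)
    refine h1.trans ?_
    rw [expect_bool]
    have e1 : 𝔼 u, h u = ((𝔼 u, h (Fin.cons true u)) + 𝔼 u, h (Fin.cons false u)) / 2 := by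
      rw [expect_fin_cons, expect_bool]
    set A := 𝔼 u, h (Fin.cons true u)
    set B := 𝔼 u, h (Fin.cons false u)
    rw [e1]
    have h2 := hU ((A + B) / 2) ((A - B) / 2) a ha
    have e2 : (A + B) / 2 + (A - B) / 2 = A := by ring
    have e3 : (A + B) / 2 - (A - B) / 2 = B := by ring
    have e4 : A - (A + B) / 2 = (A - B) / 2 := by ring
    have e5 : (B - (A + B) / 2) ^ 2 = ((A - B) / 2) ^ 2 := by ring
    rw [e2, e3] at h2
    rw [e4, e5]
    exact h2

theorem exists_expect_sqFun_pow_le (r : ℕ) : ∃ C : ℝ, 0 ≤ C ∧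
    ∀ {n : ℕ} (h : (Fin n → Bool) → ℝ),
      𝔼 v, sqFun (fun _ => true) h v ^ (r + 2) ≤ C * 𝔼 v, h v ^ (2 * (r + 2)) := by
  set K : ℝ := r + 2 with hK
  have hK0 : 0 ≤ K := by positivity
  refine ⟨2 * (K * (2 * K) ^ (r + 1)), by positivity, fun {n} h => ?_⟩
  have hb := expect_bellman_le (fun x a => a ^ (r + 2) - K * a ^ (r + 1) * x ^ 2)
    (fun x d a ha => by
      have hc : (a + d ^ 2) ^ (r + 2) - K * (a + d ^ 2) ^ (r + 1) * d ^ 2 ≤ a ^ (r + 2) := by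
        have h1 := one_add_mul_le_pow (a := -(d ^ 2 / (a + d ^ 2))) ?_ (r + 2)
        · rcases (add_nonneg ha (sq_nonneg d)).eq_or_lt with h0 | h0
          · have hd : d ^ 2 = 0 := by nlinarith [sq_nonneg d]
            simp [hd]
          · have h2 := mul_le_mul_of_nonneg_left h1 (pow_nonneg h0.le (r + 2))
            have e1 : (a + d ^ 2) ^ (r + 2) * (1 + -(d ^ 2 / (a + d ^ 2))) ^ (r + 2) =
                a ^ (r + 2) := by
              rw [← mul_pow]
              congr 1
              field_simp
              ring
            have e2 : (a + d ^ 2) ^ (r + 2) * (1 + ((r + 2 : ℕ) : ℝ) * -(d ^ 2 / (a + d ^ 2))) =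
                (a + d ^ 2) ^ (r + 2) - K * (a + d ^ 2) ^ (r + 1) * d ^ 2 := by
              rw [hK]
              push_cast
              field_simp
              ring
            rw [e1, e2] at h2
            exact h2
        · have : d ^ 2 / (a + d ^ 2) ≤ 1 :=
            div_le_one_of_le₀ (by linarith) (by positivity)
          linarith
      have hm : a ^ (r + 1) ≤ (a + d ^ 2) ^ (r + 1) :=
        pow_le_pow_left₀ ha (by linarith [sq_nonneg d]) _
      have hx : K * a ^ (r + 1) * x ^ 2 ≤ K * (a + d ^ 2) ^ (r + 1) * x ^ 2 := by gcongr
      have e : ((a + d ^ 2) ^ (r + 2) - K * (a + d ^ 2) ^ (r + 1) * (x + d) ^ 2 +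
          ((a + d ^ 2) ^ (r + 2) - K * (a + d ^ 2) ^ (r + 1) * (x - d) ^ 2)) / 2 =
          ((a + d ^ 2) ^ (r + 2) - K * (a + d ^ 2) ^ (r + 1) * d ^ 2) -
            K * (a + d ^ 2) ^ (r + 1) * x ^ 2 := by ring
      rw [e]
      linarith) h 0 le_rfl
  simp only [zero_add, ne_eq, Nat.add_eq_zero_iff, OfNat.ofNat_ne_zero, and_false,
    not_false_eq_true, zero_pow, one_ne_zero, mul_zero, zero_mul, sub_zero] at hb
  have hy : ∀ v, sqFun (fun _ => true) h v ^ (r + 2) / 2 -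
      K * (2 * K) ^ (r + 1) * h v ^ (2 * (r + 2)) ≤
      sqFun (fun _ => true) h v ^ (r + 2) - K * sqFun (fun _ => true) h v ^ (r + 1) * h v ^ 2 := by
    intro v
    have := mul_pow_mul_le_half_add hK0 (sqFun_nonneg (fun _ => true) h v) (sq_nonneg (h v)) (r + 1)
    rw [← pow_mul] at this
    linarith
  have h1 := (expect_mono_real hy).trans hb
  rw [Finset.expect_sub_distrib, ← Finset.expect_div, ← Finset.mul_expect] at h1
  linarith

theorem exists_expect_pow_le_sqFun (r : ℕ) : ∃ C : ℝ, 0 ≤ C ∧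
    ∀ {n : ℕ} (h : (Fin n → Bool) → ℝ), 𝔼 v, h v = 0 →
      𝔼 v, h v ^ (2 * (r + 2)) ≤ C * 𝔼 v, sqFun (fun _ => true) h v ^ (r + 2) := by
  obtain ⟨K, hK0, hK⟩ := exists_even_pow_avg_bound (r + 1)
  refine ⟨2 * (K * (2 * K) ^ (r + 1) + K), by positivity, fun {n} h hh => ?_⟩
  have hb := expect_bellman_le
    (fun x a => x ^ (2 * (r + 2)) - K * (x ^ (2 * (r + 1)) * a) - K * a ^ (r + 2))
    (fun x d a ha => by
      have h1 := hK x d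
      have h2 := pow_le_even_pow_avg (r + 1) x d
      have h3 : a ^ (r + 2) + d ^ (2 * (r + 2)) ≤ (a + d ^ 2) ^ (r + 2) := by
        rw [pow_mul]
        exact pow_add_pow_le ha (sq_nonneg d) (by omega)
      have h4 := mul_le_mul_of_nonneg_left h3 hK0
      have h5 := mul_le_mul_of_nonneg_left
        (mul_le_mul_of_nonneg_right h2 (add_nonneg ha (sq_nonneg d))) hK0
      linarith) h 0 le_rfl
  have hz : ∀ k : ℕ, (0 : ℝ) ^ (2 * (k + 2)) = 0 := fun k => zero_pow (by omega)
  have hz' : (0 : ℝ) ^ (r + 2) = 0 := zero_pow (by omega)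
  simp only [zero_add, hh, hz, hz', mul_zero, sub_zero] at hb
  have hy : ∀ v, h v ^ (2 * (r + 2)) / 2 -
      (K * (2 * K) ^ (r + 1) + K) * sqFun (fun _ => true) h v ^ (r + 2) ≤
      h v ^ (2 * (r + 2)) - K * (h v ^ (2 * (r + 1)) * sqFun (fun _ => true) h v) -
        K * sqFun (fun _ => true) h v ^ (r + 2) := by
    intro v
    have := mul_pow_mul_le_half_add hK0 (sq_nonneg (h v)) (sqFun_nonneg (fun _ => true) h v) (r + 1)
    rw [← pow_mul, ← pow_mul] at this
    linarith
  have h1 := (expect_mono_real hy).trans hb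
  rw [Finset.expect_sub_distrib, ← Finset.expect_div, ← Finset.mul_expect] at h1
  linarith

/-- The configuration `v` with its `j`-th coordinate flipped. -/
def flipAt {n : ℕ} (j : Fin n) (v : Fin n → Bool) : Fin n → Bool := Function.update v j (!v j)

theorem expect_martDiff_pow_le (r : ℕ) {n : ℕ} (h : (Fin n → Bool) → ℝ) (j : Fin n) :
    𝔼 v, martDiff h j v ^ (2 * r) ≤ 𝔼 v, ((h v - h (flipAt j v)) / 2) ^ (2 * r) := by
  induction n with
  | zero => exact j.elim0
  | succ n ih =>
    rw [expect_fin_cons, expect_fin_cons]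
    refine Fin.cases ?_ (fun i => ?_) j
    · simp only [martDiff_zero_cons, Fintype.expect_const]
      refine expect_mono_real fun e => ?_
      have e1 : (𝔼 u, h (Fin.cons e u)) - 𝔼 u, h u =
          𝔼 u : Fin n → Bool, (h (Fin.cons e u) - h (flipAt 0 (Fin.cons e u))) / 2 := by
        have e2 : ∀ u : Fin n → Bool, flipAt 0 (Fin.cons e u : Fin (n + 1) → Bool) =
            Fin.cons (!e) u := fun u => by simp [flipAt]
        simp only [e2]
        rw [← Finset.expect_div, Finset.expect_sub_distrib, expect_fin_cons h, expect_bool]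
        cases e
        · rw [Bool.not_false]
          ring
        · rw [Bool.not_true]
          ring
      rw [e1]
      exact expect_pow_le_of_even _ (even_two_mul r)
    · simp only [martDiff_succ_cons]
      refine expect_mono_real fun e => (ih (fun u => h (Fin.cons e u)) i).trans_eq ?_
      refine Finset.expect_congr rfl fun u _ => ?_
      have e2 : flipAt i.succ (Fin.cons e u : Fin (n + 1) → Bool) = Fin.cons e (flipAt i u) := by
        simp [flipAt, Fin.cons_update]
      rw [e2]

/-- An inequality for averages over random coordinates: the `L_p` norm of the
conditional expectation of a mean-zero function on the cube, with respect to a random set of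
coordinates of density `1 / L`. -/
theorem exists_expect_avgOff_pow_le (r : ℕ) : ∃ C : ℝ, 0 ≤ C ∧
    ∀ (n L : ℕ) [NeZero L] (h : (Fin n → Bool) → ℝ), 𝔼 v, h v = 0 →
      𝔼 c : Fin n → Fin L, 𝔼 v, avgOff (fun j => decide (c j = 0)) h v ^ (2 * (r + 2)) ≤
        C * ((1 / L) * ∑ j, 𝔼 v, (h v - h (flipAt j v)) ^ (2 * (r + 2)) +
          (1 / L) ^ (r + 2) * 𝔼 v, h v ^ (2 * (r + 2))) := by
  obtain ⟨C₁, hC₁, H₁⟩ := exists_expect_sqFun_pow_le r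
  obtain ⟨C₂, hC₂, H₂⟩ := exists_expect_pow_le_sqFun r
  set K : ℝ := ((r + 1 : ℕ) + 1) * 2 ^ (r + 1) with hK
  have hK0 : 0 ≤ K := by positivity
  refine ⟨C₂ * (K + K ^ (r + 2) * C₁), by positivity, fun n L _ h hh => ?_⟩
  set S : (Fin n → Fin L) → Fin n → Bool := fun c j => decide (c j = 0)
  set ρ : ℝ := 1 / L
  have hρ : 0 ≤ ρ := by positivity
  have h1 : ∀ c, 𝔼 v, avgOff (S c) h v ^ (2 * (r + 2)) ≤
      C₂ * 𝔼 v, 𝔼 u, sqFun (S c) h (mix (S c) v u) ^ (r + 2) := by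
    intro c
    refine (H₂ (avgOff (S c) h) (by rw [expect_avgOff, hh])).trans ?_
    refine mul_le_mul_of_nonneg_left (expect_mono_real fun v => ?_) hC₂
    refine (pow_le_pow_left₀ (sqFun_nonneg _ _ _) (sqFun_avgOff_le _ _ _) _).trans ?_
    exact expect_pow_le_of_nonneg _ (fun u => sqFun_nonneg _ _ _) _
  have h2 : ∀ c, 𝔼 v, 𝔼 u, sqFun (S c) h (mix (S c) v u) ^ (r + 2) =
      𝔼 v, sqFun (S c) h v ^ (r + 2) := fun c =>
    expect_avgOff (S c) (fun v => sqFun (S c) h v ^ (r + 2))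
  have h3 : ∀ v, 𝔼 c, sqFun (S c) h v ^ (r + 2) ≤
      K * (ρ * ∑ j, martDiff h j v ^ (2 * (r + 2))) +
        K ^ (r + 2) * ρ ^ (r + 2) * sqFun (fun _ => true) h v ^ (r + 2) := by
    intro v
    have := expect_coloring_sum_pow_le (r + 1) L n (fun j => martDiff h j v ^ 2)
      (fun j => sq_nonneg _) 0 le_rfl
    simp only [zero_add, ← pow_mul] at this
    have e : ∑ j, martDiff h j v ^ 2 = sqFun (fun _ => true) h v := by simp [sqFun]
    rw [← hK, e, mul_pow K, mul_pow (1 / (L : ℝ))] at this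
    have e' : ∀ c, sqFun (S c) h v = ∑ j, if c j = 0 then martDiff h j v ^ 2 else 0 :=
      fun c => by simp only [sqFun, S, decide_eq_true_eq]
    simp only [e']
    refine this.trans (le_of_eq ?_)
    ring
  calc 𝔼 c, 𝔼 v, avgOff (S c) h v ^ (2 * (r + 2))
      ≤ 𝔼 c, C₂ * 𝔼 v, sqFun (S c) h v ^ (r + 2) :=
        expect_mono_real fun c => (h1 c).trans_eq (by rw [h2])
    _ = C₂ * 𝔼 v, 𝔼 c, sqFun (S c) h v ^ (r + 2) := by
        rw [← Finset.mul_expect, Finset.expect_comm]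
    _ ≤ C₂ * 𝔼 v, (K * (ρ * ∑ j, martDiff h j v ^ (2 * (r + 2))) +
        K ^ (r + 2) * ρ ^ (r + 2) * sqFun (fun _ => true) h v ^ (r + 2)) :=
        mul_le_mul_of_nonneg_left (expect_mono_real h3) hC₂
    _ = C₂ * (K * (ρ * ∑ j, 𝔼 v, martDiff h j v ^ (2 * (r + 2))) +
        K ^ (r + 2) * ρ ^ (r + 2) * 𝔼 v, sqFun (fun _ => true) h v ^ (r + 2)) := by
        rw [Finset.expect_add_distrib, ← Finset.mul_expect, ← Finset.mul_expect,
          ← Finset.mul_expect, Finset.expect_sum_comm]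
    _ ≤ C₂ * (K * (ρ * ∑ j, 𝔼 v, (h v - h (flipAt j v)) ^ (2 * (r + 2))) +
        K ^ (r + 2) * ρ ^ (r + 2) * (C₁ * 𝔼 v, h v ^ (2 * (r + 2)))) := by
        refine mul_le_mul_of_nonneg_left (add_le_add (mul_le_mul_of_nonneg_left
          (mul_le_mul_of_nonneg_left (sum_le_sum fun j _ => ?_) hρ) hK0)
          (mul_le_mul_of_nonneg_left (H₁ h) (by positivity))) hC₂
        refine (expect_martDiff_pow_le (r + 2) h j).trans (expect_mono_real fun v => ?_)
        rw [div_pow]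
        exact div_le_self (Even.pow_nonneg (even_two_mul _) _) (one_le_pow₀ (by norm_num))
    _ ≤ _ := by
        have p1 : 0 ≤ ρ * ∑ j, 𝔼 v, (h v - h (flipAt j v)) ^ (2 * (r + 2)) :=
          mul_nonneg hρ (sum_nonneg fun j _ => expect_nonneg_real fun v =>
            Even.pow_nonneg (even_two_mul _) _)
        have p2 : 0 ≤ ρ ^ (r + 2) * 𝔼 v, h v ^ (2 * (r + 2)) :=
          mul_nonneg (by positivity) (expect_nonneg_real fun v =>
            Even.pow_nonneg (even_two_mul _) _)
        rw [mul_assoc C₂]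
        refine mul_le_mul_of_nonneg_left ?_ hC₂
        have p3 := mul_nonneg hK0 p2
        have p4 : 0 ≤ K ^ (r + 2) * C₁ *
          (ρ * ∑ j, 𝔼 v, (h v - h (flipAt j v)) ^ (2 * (r + 2))) := by positivity
        linarith

/-! ### A metric inequality on finite tori -/

/-- The vector of signs encoded by a point of the discrete cube. -/
def signVec (A : Type*) [CommRing A] {n : ℕ} (v : Fin n → Bool) : Fin n → A :=
  fun j => if v j then 1 else -1

/-- The restriction of the sign vector of `v` to the coordinates in `S`. -/
def signOn (A : Type*) [CommRing A] {n : ℕ} (S v : Fin n → Bool) : Fin n → A :=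
  fun j => if S j then signVec A v j else 0

/-- The restriction of the sign vector of `v` to the coordinates outside `S`. -/
def signOff (A : Type*) [CommRing A] {n : ℕ} (S v : Fin n → Bool) : Fin n → A :=
  fun j => if S j then 0 else signVec A v j

section

variable {A : Type*} [CommRing A] {n : ℕ}

theorem signVec_mix (S v u : Fin n → Bool) :
    signVec A (mix S v u) = signOn A S v + signOff A S u := by
  funext j
  by_cases h : S j <;> simp [signVec, signOn, signOff, mix, h]

theorem signVec_not (v : Fin n → Bool) : signVec A (fun j => !v j) = -signVec A v := by
  funext j
  by_cases h : v j <;> simp [signVec, h]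

theorem signOff_not (S v : Fin n → Bool) : signOff A S (fun j => !v j) = -signOff A S v := by
  funext j
  by_cases h : v j <;> by_cases h' : S j <;> simp [signOff, signVec, h, h']

theorem flipAt_not (j : Fin n) (v : Fin n → Bool) :
    flipAt j (fun i => !v i) = fun i => !flipAt j v i := by
  funext i
  by_cases h : i = j
  · subst h
    simp [flipAt]
  · simp [flipAt, Function.update_of_ne h]

theorem expect_not (f : (Fin n → Bool) → ℝ) : 𝔼 v : Fin n → Bool, f (fun j => !v j) = 𝔼 v, f v :=
  Fintype.expect_equiv (Equiv.piCongrRight fun _ : Fin n => Equiv.boolNot) _ _ fun _ => rfl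

theorem expect_add_right {G : Type*} [AddGroup G] [Fintype G] (f : G → ℝ) (w : G) :
    𝔼 x, f (x + w) = 𝔼 x, f x :=
  Fintype.expect_equiv (Equiv.addRight w) _ _ fun _ => rfl

theorem sum_fin_pow_le (m : ℕ) [NeZero m] (z : Fin m → ℝ) {p : ℕ} (hp : Even p) :
    (∑ t, z t) ^ p ≤ m ^ p * 𝔼 t, z t ^ p := by
  have h := mul_le_mul_of_nonneg_left (expect_pow_le_of_even z hp)
    (by positivity : (0 : ℝ) ≤ (m : ℝ) ^ p)
  have hm : (m : ℝ) ≠ 0 := Nat.cast_ne_zero.2 (NeZero.ne m)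
  rw [← mul_pow, Fintype.expect_eq_sum_div_card, Fintype.card_fin, mul_div_cancel₀ _ hm] at h
  exact h

theorem sub_pow_le_of_even (a b : ℝ) {p : ℕ} (hp : Even p) :
    (a - b) ^ p ≤ 2 ^ p * (a ^ p + b ^ p) := by
  have h := sum_fin_pow_le 2 ![a, -b] hp
  rw [Fintype.expect_eq_sum_div_card] at h
  simp only [Fin.sum_univ_two, Matrix.cons_val_zero, Matrix.cons_val_one, hp.neg_pow,
    Fintype.card_fin, Nat.cast_ofNat, ← sub_eq_add_neg] at h
  have : 0 ≤ a ^ p + b ^ p := add_nonneg (hp.pow_nonneg _) (hp.pow_nonneg _)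
  refine h.trans (mul_le_mul_of_nonneg_left ?_ (by positivity))
  linarith

theorem add_add_pow_le_of_even (a b c : ℝ) {p : ℕ} (hp : Even p) :
    (a + b + c) ^ p ≤ 3 ^ p * (a ^ p + b ^ p + c ^ p) := by
  have h := sum_fin_pow_le 3 ![a, b, c] hp
  rw [Fintype.expect_eq_sum_div_card] at h
  simp only [Fin.sum_univ_three, Matrix.cons_val_zero, Matrix.cons_val_one, Matrix.cons_val,
    Fintype.card_fin, Nat.cast_ofNat] at h
  have : 0 ≤ a ^ p + b ^ p + c ^ p :=
    add_nonneg (add_nonneg (hp.pow_nonneg _) (hp.pow_nonneg _)) (hp.pow_nonneg _)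
  refine h.trans (mul_le_mul_of_nonneg_left ?_ (by positivity))
  linarith

variable [Fintype A]

theorem expect_jump_pow_le (F : (Fin n → A) → ℝ) (S v : Fin n → Bool) (m : ℕ) [NeZero m]
    {p : ℕ} (hp : Even p) :
    𝔼 x, (F (x + (2 * m) • signOn A S v) - F x) ^ p ≤
      3 ^ p * (2 * 𝔼 u, 𝔼 x, (F (x + signOff A S u) - F x) ^ p +
        m ^ p * 𝔼 x, avgOff S (fun δ => F (x + signVec A δ) - F (x - signVec A δ)) v ^ p) := by
  set w := signOn A S v
  set Fs : (Fin n → A) → ℝ := fun x => 𝔼 u, F (x + signOff A S u)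
  have h1 : 𝔼 x, (Fs x - F x) ^ p ≤ 𝔼 u, 𝔼 x, (F (x + signOff A S u) - F x) ^ p := by
    rw [Finset.expect_comm]
    refine expect_mono_real fun x => ?_
    have e : Fs x - F x = 𝔼 u, (F (x + signOff A S u) - F x) := by
      rw [Finset.expect_sub_distrib, Fintype.expect_const]
    rw [e]
    exact expect_pow_le_of_even _ hp
  have h2 : 𝔼 x, (F (x + (2 * m) • w) - Fs (x + (2 * m) • w)) ^ p = 𝔼 x, (Fs x - F x) ^ p := by
    rw [expect_add_right (fun x => (F x - Fs x) ^ p)]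
    refine Finset.expect_congr rfl fun x _ => ?_
    rw [← neg_sub, hp.neg_pow]
  have h3 : ∀ x, Fs (x + w) - Fs (x - w) =
      avgOff S (fun δ => F (x + signVec A δ) - F (x - signVec A δ)) v := by
    intro x
    simp only [avgOff, signVec_mix, Finset.expect_sub_distrib, Fs]
    congr 1
    · simp only [add_assoc, w]
    · rw [← expect_not]
      refine Finset.expect_congr rfl fun u _ => ?_
      rw [signOff_not]
      congr 1
      abel
  have h4 : 𝔼 x, (Fs (x + (2 * m) • w) - Fs x) ^ p ≤
      m ^ p * 𝔼 x, (Fs (x + w) - Fs (x - w)) ^ p := by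
    have e1 : ∀ x, Fs (x + (2 * m) • w) - Fs x =
        ∑ t : Fin m, (Fs (x + (2 * (t + 1 : ℕ)) • w) - Fs (x + (2 * (t : ℕ)) • w)) := by
      intro x
      rw [Fin.sum_univ_eq_sum_range
        (fun t => Fs (x + (2 * (t + 1)) • w) - Fs (x + (2 * t) • w)) m,
        Finset.sum_range_sub (fun t => Fs (x + (2 * t) • w))]
      simp
    have e2 : ∀ t : Fin m,
        𝔼 x, (Fs (x + (2 * (t + 1 : ℕ)) • w) - Fs (x + (2 * (t : ℕ)) • w)) ^ p =
          𝔼 x, (Fs (x + w) - Fs (x - w)) ^ p := by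
      intro t
      rw [← expect_add_right (fun x => (Fs (x + w) - Fs (x - w)) ^ p) ((2 * (t : ℕ) + 1) • w)]
      refine Finset.expect_congr rfl fun x _ => ?_
      congr 3
      · rw [add_smul, mul_add, add_smul, two_mul 1, add_smul]
        abel
      · rw [add_smul, one_smul]
        abel
    calc _ ≤ 𝔼 x, (m : ℝ) ^ p * 𝔼 t : Fin m,
          (Fs (x + (2 * (t + 1 : ℕ)) • w) - Fs (x + (2 * (t : ℕ)) • w)) ^ p :=
          expect_mono_real fun x => by
            rw [e1]
            exact sum_fin_pow_le m _ hp
      _ = _ := by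
        rw [← Finset.mul_expect, Finset.expect_comm]
        simp only [e2, Fintype.expect_const]
  calc 𝔼 x, (F (x + (2 * m) • w) - F x) ^ p
      ≤ 𝔼 x, 3 ^ p * ((F (x + (2 * m) • w) - Fs (x + (2 * m) • w)) ^ p +
          (Fs (x + (2 * m) • w) - Fs x) ^ p + (Fs x - F x) ^ p) :=
        expect_mono_real fun x => by
          refine le_trans (le_of_eq ?_) (add_add_pow_le_of_even _ _ _ hp)
          congr 1
          ring
    _ = 3 ^ p * (2 * 𝔼 x, (Fs x - F x) ^ p + 𝔼 x, (Fs (x + (2 * m) • w) - Fs x) ^ p) := by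
        rw [← Finset.mul_expect, Finset.expect_add_distrib, Finset.expect_add_distrib, h2]
        ring
    _ ≤ _ := by
        simp only [h3] at h4
        gcongr

theorem le_mul_add_of_le_of_le {X Y T Q K a b : ℝ} (hX : X ≤ b * (2 * T + a * Y)) (hY : Y ≤ K * Q)
    (ha : 0 ≤ a) (hb : 0 ≤ b) (hT : 0 ≤ T) (hQ : 0 ≤ Q) (hK : 0 ≤ K) :
    X ≤ b * (2 + K) * (T + a * Q) := by
  have h1 := mul_le_mul_of_nonneg_left hY ha
  have h2 : 0 ≤ K * T := by positivity
  have h3 : 0 ≤ a * Q := by positivity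
  have h4 : b * (2 * T + a * Y) ≤ b * ((2 + K) * (T + a * Q)) :=
    mul_le_mul_of_nonneg_left (by linarith) hb
  linarith

theorem exists_expect_torus_pow_le (r : ℕ) : ∃ C : ℝ, 0 ≤ C ∧
    ∀ (n L m : ℕ) [NeZero L] [NeZero m] (A : Type) [CommRing A] [Fintype A]
      (F : (Fin n → A) → ℝ),
      𝔼 c : Fin n → Fin L, 𝔼 v : Fin n → Bool, 𝔼 x : Fin n → A,
        (F (x + (2 * m) • signOn A (fun j => decide (c j = 0)) v) - F x) ^ (2 * (r + 2)) ≤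
      C * ((𝔼 c : Fin n → Fin L, 𝔼 v : Fin n → Bool, 𝔼 x : Fin n → A,
          (F (x + signOff A (fun j => decide (c j = 0)) v) - F x) ^ (2 * (r + 2))) +
        m ^ (2 * (r + 2)) * ((1 / L) * (∑ j : Fin n, 𝔼 v : Fin n → Bool, 𝔼 x : Fin n → A,
            (F (x + signVec A v) - F (x + signVec A (flipAt j v))) ^ (2 * (r + 2))) +
          (1 / L) ^ (r + 2) * 𝔼 v : Fin n → Bool, 𝔼 x : Fin n → A,
            (F (x + signVec A v) - F (x - signVec A v)) ^ (2 * (r + 2)))) := by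
  obtain ⟨C, hC, H⟩ := exists_expect_avgOff_pow_le r
  have hp : Even (2 * (r + 2)) := even_two_mul _
  generalize 2 * (r + 2) = p at H hp ⊢
  refine ⟨3 ^ p * (2 + C * (2 ^ p * 2)), by positivity, fun n L m _ _ A _ _ F => ?_⟩
  set S : (Fin n → Fin L) → Fin n → Bool := fun c j => decide (c j = 0)
  set h : (Fin n → A) → (Fin n → Bool) → ℝ :=
    fun x δ => F (x + signVec A δ) - F (x - signVec A δ)
  have hmean : ∀ x, 𝔼 δ, h x δ = 0 := by
    intro x
    simp only [h]
    rw [Finset.expect_sub_distrib, sub_eq_zero, ← expect_not]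
    refine Finset.expect_congr rfl fun u _ => ?_
    rw [signVec_not, sub_eq_add_neg]
  set T₀ := 𝔼 c : Fin n → Fin L, 𝔼 v, 𝔼 x, (F (x + signOff A (S c) v) - F x) ^ p with hT₀
  set T₁ := ∑ j, 𝔼 v, 𝔼 x, (F (x + signVec A v) - F (x + signVec A (flipAt j v))) ^ p with hT₁
  set T₂ := 𝔼 v, 𝔼 x, (F (x + signVec A v) - F (x - signVec A v)) ^ p with hT₂
  have n0 : 0 ≤ T₀ := expect_nonneg_real fun c => expect_nonneg_real fun v =>
    expect_nonneg_real fun x => hp.pow_nonneg _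
  have n1 : 0 ≤ T₁ := by
    rw [hT₁]
    refine sum_nonneg fun j _ => ?_
    exact expect_nonneg_real fun v => expect_nonneg_real fun x => hp.pow_nonneg _
  have n2 : 0 ≤ T₂ := expect_nonneg_real fun v => expect_nonneg_real fun x => hp.pow_nonneg _
  have a1 : 𝔼 c, 𝔼 v, 𝔼 x, avgOff (S c) (h x) v ^ p ≤
      C * (2 ^ p * 2) * ((1 / L) * T₁ + (1 / L) ^ (r + 2) * T₂) := by
    have b1 : 𝔼 c, 𝔼 v, 𝔼 x, avgOff (S c) (h x) v ^ p =
        𝔼 x, 𝔼 c, 𝔼 v, avgOff (S c) (h x) v ^ p := by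
      rw [Finset.expect_comm (s := (univ : Finset (Fin n → A)))]
      exact Finset.expect_congr rfl fun c _ => Finset.expect_comm ..
    have b2 : ∀ j, 𝔼 x, 𝔼 v, (h x v - h x (flipAt j v)) ^ p ≤ 2 ^ p * 2 *
        𝔼 v, 𝔼 x, (F (x + signVec A v) - F (x + signVec A (flipAt j v))) ^ p := by
      intro j
      have d1 : ∀ x, 𝔼 v, (h x v - h x (flipAt j v)) ^ p ≤ 2 ^ p * 2 *
          𝔼 v, (F (x + signVec A v) - F (x + signVec A (flipAt j v))) ^ p := by
        intro x
        have d2 : 𝔼 v, (F (x - signVec A v) - F (x - signVec A (flipAt j v))) ^ p =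
            𝔼 v, (F (x + signVec A v) - F (x + signVec A (flipAt j v))) ^ p := by
          rw [← expect_not]
          refine Finset.expect_congr rfl fun u _ => ?_
          rw [flipAt_not, signVec_not, signVec_not, sub_neg_eq_add, sub_neg_eq_add]
        calc _ ≤ 𝔼 v, 2 ^ p * ((F (x + signVec A v) - F (x + signVec A (flipAt j v))) ^ p +
              (F (x - signVec A v) - F (x - signVec A (flipAt j v))) ^ p) :=
              expect_mono_real fun v => by
                refine le_trans (le_of_eq ?_) (sub_pow_le_of_even _ _ hp)
                congr 1
                simp only [h]
                ring
          _ = _ := by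
            rw [← Finset.mul_expect, Finset.expect_add_distrib, d2]
            ring
      refine (expect_mono_real d1).trans_eq ?_
      rw [← Finset.mul_expect, Finset.expect_comm]
    have b3 : 𝔼 x, 𝔼 v, h x v ^ p = T₂ := by rw [Finset.expect_comm]
    rw [b1]
    calc _ ≤ 𝔼 x, C * ((1 / L) * ∑ j, 𝔼 v, (h x v - h x (flipAt j v)) ^ p +
          (1 / L) ^ (r + 2) * 𝔼 v, h x v ^ p) := expect_mono_real fun x => H n L (h x) (hmean x)
      _ = C * ((1 / L) * ∑ j, 𝔼 x, 𝔼 v, (h x v - h x (flipAt j v)) ^ p +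
          (1 / L) ^ (r + 2) * T₂) := by
        rw [← Finset.mul_expect, Finset.expect_add_distrib, ← Finset.mul_expect,
          ← Finset.mul_expect, Finset.expect_sum_comm, b3]
      _ ≤ C * ((1 / L) * (2 ^ p * 2 * T₁) + (1 / L) ^ (r + 2) * (2 ^ p * 2 * T₂)) := by
        have c1 : ∑ j, 𝔼 x, 𝔼 v, (h x v - h x (flipAt j v)) ^ p ≤ 2 ^ p * 2 * T₁ := by
          rw [hT₁, mul_sum]
          exact sum_le_sum fun j _ => b2 j
        have c2 : T₂ ≤ 2 ^ p * 2 * T₂ := by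
          have : (1 : ℝ) ≤ 2 ^ p := one_le_pow₀ (by norm_num)
          nlinarith
        gcongr
      _ = _ := by ring
  have a2 : 𝔼 c, 𝔼 v, 𝔼 x, (F (x + (2 * m) • signOn A (S c) v) - F x) ^ p ≤
      3 ^ p * (2 * T₀ + m ^ p * 𝔼 c, 𝔼 v, 𝔼 x, avgOff (S c) (h x) v ^ p) := by
    refine (expect_mono_real fun c => expect_mono_real fun v =>
      expect_jump_pow_le F (S c) v m hp).trans_eq ?_
    simp only [← Finset.mul_expect, Finset.expect_add_distrib, Fintype.expect_const]
    rfl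
  have q1 : (0 : ℝ) ≤ 1 / L := one_div_nonneg.2 (Nat.cast_nonneg L)
  exact le_mul_add_of_le_of_le a2 a1 (pow_nonneg (Nat.cast_nonneg m) p)
    (pow_nonneg (by norm_num) p) n0
    (add_nonneg (mul_nonneg q1 n1) (mul_nonneg (pow_nonneg q1 _) n2))
    (mul_nonneg hC (mul_nonneg (pow_nonneg (by norm_num) p) (by norm_num)))

end

/-! ### Lebesgue spaces -/

section

open MeasureTheory

theorem eLpNorm_ofReal_rpow_eq_lintegral {p : ℝ} (hp : 0 < p) (f : ℝ → ℝ) :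
    eLpNorm f (ENNReal.ofReal p) volume ^ p = ∫⁻ t, ENNReal.ofReal (|f t| ^ p) := by
  rw [eLpNorm_eq_eLpNorm' (by simpa using hp) ENNReal.ofReal_ne_top,
    ENNReal.toReal_ofReal hp.le, ← lintegral_rpow_enorm_eq_rpow_eLpNorm' hp]
  refine lintegral_congr fun t => ?_
  rw [Real.enorm_eq_ofReal_abs, ENNReal.ofReal_rpow_of_nonneg (abs_nonneg _) hp.le]

theorem lpSpace_norm_nonneg {p : ℝ} (f : LpSpace p) : 0 ≤ ‖f‖ := by
  rw [Lp.norm_def]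
  exact ENNReal.toReal_nonneg

theorem ofReal_norm_sub_rpow {p : ℝ} (hp : 0 < p) (f g : LpSpace p) :
    ENNReal.ofReal (‖f - g‖ ^ p) = ∫⁻ t, ENNReal.ofReal (|f t - g t| ^ p) := by
  rw [← ENNReal.ofReal_rpow_of_nonneg (lpSpace_norm_nonneg _) hp.le, Lp.norm_def,
    ENNReal.ofReal_toReal (Lp.eLpNorm_ne_top _), eLpNorm_ofReal_rpow_eq_lintegral hp]
  refine lintegral_congr_ae ?_
  filter_upwards [Lp.coeFn_sub f g] with t ht
  rw [ht, Pi.sub_apply]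

theorem integrable_sub_pow {k : ℕ} (hk : k ≠ 0) (hk2 : Even k) (f g : LpSpace k) :
    Integrable (fun t => (f t - g t) ^ k) := by
  have h := (Lp.memLp (f - g)).integrable_norm_rpow (by simp; omega) ENNReal.ofReal_ne_top
  refine h.congr ?_
  filter_upwards [Lp.coeFn_sub f g] with t ht
  rw [ht, ENNReal.toReal_ofReal (Nat.cast_nonneg k), Real.rpow_natCast, Pi.sub_apply,
    Real.norm_eq_abs, hk2.pow_abs]

theorem norm_sub_pow_eq_integral {k : ℕ} (hk : k ≠ 0) (hk2 : Even k) (f g : LpSpace k) :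
    ‖f - g‖ ^ k = ∫ t, (f t - g t) ^ k := by
  have hk0 : (0 : ℝ) < k := by positivity
  have h := ofReal_norm_sub_rpow hk0 f g
  simp only [Real.rpow_natCast, hk2.pow_abs] at h
  rw [integral_eq_lintegral_of_nonneg_ae (.of_forall fun t => hk2.pow_nonneg _)
    (integrable_sub_pow hk hk2 f g).1, ← h, ENNReal.toReal_ofReal (hk2.pow_nonneg _)]

theorem integral_expect {ι : Type*} [Fintype ι] {f : ι → ℝ → ℝ} (h : ∀ i, Integrable (f i)) :
    ∫ t, 𝔼 i, f i t = 𝔼 i, ∫ t, f i t := by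
  simp only [Fintype.expect_eq_sum_div_card]
  rw [integral_div, integral_finsetSum _ fun i _ => h i]

theorem integrable_expect {ι : Type*} [Fintype ι] {f : ι → ℝ → ℝ} (h : ∀ i, Integrable (f i)) :
    Integrable fun t => 𝔼 i, f i t := by
  simp only [Fintype.expect_eq_sum_div_card]
  exact (integrable_finsetSum _ fun i _ => h i).div_const _

theorem integrable_mul_add {f g h : ℝ → ℝ} (hf : Integrable f) (hg : Integrable g)
    (hh : Integrable h) (C M a b : ℝ) :
    Integrable fun t => C * (f t + M * (a * g t + b * h t)) :=
  (hf.add (((hg.const_mul a).add (hh.const_mul b)).const_mul M)).const_mul C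

theorem integral_mul_add {f g h : ℝ → ℝ} (hf : Integrable f) (hg : Integrable g)
    (hh : Integrable h) (C M a b : ℝ) :
    ∫ t, C * (f t + M * (a * g t + b * h t)) =
      C * ((∫ t, f t) + M * (a * (∫ t, g t) + b * ∫ t, h t)) := by
  have h₁ : Integrable fun t => a * g t := hg.const_mul a
  have h₂ : Integrable fun t => b * h t := hh.const_mul b
  have h₃ : Integrable fun t => M * (a * g t + b * h t) := (h₁.add h₂).const_mul M
  rw [integral_const_mul, integral_add hf h₃, integral_const_mul, integral_add h₁ h₂,
    integral_const_mul, integral_const_mul]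

theorem exists_expect_torus_norm_pow_le (r : ℕ) : ∃ C : ℝ, 0 ≤ C ∧
    ∀ (n L m : ℕ) [NeZero L] [NeZero m] (A : Type) [CommRing A] [Fintype A]
      (F : (Fin n → A) → LpSpace ((2 * (r + 2) : ℕ) : ℝ)),
      𝔼 c : Fin n → Fin L, 𝔼 v : Fin n → Bool, 𝔼 x : Fin n → A,
        ‖F (x + (2 * m) • signOn A (fun j => decide (c j = 0)) v) - F x‖ ^ (2 * (r + 2)) ≤
      C * ((𝔼 c : Fin n → Fin L, 𝔼 v : Fin n → Bool, 𝔼 x : Fin n → A,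
          ‖F (x + signOff A (fun j => decide (c j = 0)) v) - F x‖ ^ (2 * (r + 2))) +
        m ^ (2 * (r + 2)) * ((1 / L) * (∑ j : Fin n, 𝔼 v : Fin n → Bool, 𝔼 x : Fin n → A,
            ‖F (x + signVec A v) - F (x + signVec A (flipAt j v))‖ ^ (2 * (r + 2))) +
          (1 / L) ^ (r + 2) * 𝔼 v : Fin n → Bool, 𝔼 x : Fin n → A,
            ‖F (x + signVec A v) - F (x - signVec A v)‖ ^ (2 * (r + 2)))) := by
  obtain ⟨C, hC, H⟩ := exists_expect_torus_pow_le r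
  refine ⟨C, hC, fun n L m _ _ A _ _ F => ?_⟩
  have hk : 2 * (r + 2) ≠ 0 := by omega
  have hp : Even (2 * (r + 2)) := even_two_mul _
  generalize 2 * (r + 2) = p at H hp hk F ⊢
  have I := fun a b => integrable_sub_pow hk hp (F a) (F b)
  have E := fun a b => norm_sub_pow_eq_integral hk hp (F a) (F b)
  have I₀ := integrable_expect fun c : Fin n → Fin L => integrable_expect fun v : Fin n → Bool =>
    integrable_expect fun x : Fin n → A =>
      I (x + (2 * m) • signOn A (fun j => decide (c j = 0)) v) x
  have I₁ := integrable_expect fun c : Fin n → Fin L => integrable_expect fun v : Fin n → Bool =>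
    integrable_expect fun x : Fin n → A => I (x + signOff A (fun j => decide (c j = 0)) v) x
  have I₂ : ∀ j : Fin n, _ := fun j => integrable_expect fun v : Fin n → Bool =>
    integrable_expect fun x : Fin n → A => I (x + signVec A v) (x + signVec A (flipAt j v))
  have I₃ := integrable_expect fun v : Fin n → Bool =>
    integrable_expect fun x : Fin n → A => I (x + signVec A v) (x - signVec A v)
  have I₂' := integrable_finsetSum univ fun j _ => I₂ j
  have key := integral_mono I₀ (integrable_mul_add I₁ I₂' I₃ C ((m : ℝ) ^ p) (1 / L)
    ((1 / (L : ℝ)) ^ (r + 2))) (fun t => H n L m A fun x => F x t)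
  rw [integral_mul_add I₁ I₂' I₃] at key
  rw [integral_finsetSum _ fun j _ => I₂ j,
    integral_expect fun c => integrable_expect fun v => integrable_expect fun x => I _ _,
    integral_expect fun c => integrable_expect fun v => integrable_expect fun x => I _ _] at key
  have S : ∀ y z : (Fin n → Bool) → (Fin n → A) → Fin n → A,
      ∫ t, 𝔼 v, 𝔼 x, (F (y v x) t - F (z v x) t) ^ p =
        𝔼 v, 𝔼 x, ‖F (y v x) - F (z v x)‖ ^ p := by
    intro y z
    rw [integral_expect fun v => integrable_expect fun x => I _ _]
    refine Finset.expect_congr rfl fun v _ => ?_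
    rw [integral_expect fun x => I _ _]
    simp only [E]
  have S₁ := fun c : Fin n → Fin L =>
    S (fun v x => x + (2 * m) • signOn A (fun j => decide (c j = 0)) v) fun _ x => x
  have S₂ := fun c : Fin n → Fin L =>
    S (fun v x => x + signOff A (fun j => decide (c j = 0)) v) fun _ x => x
  have S₃ := fun j : Fin n => S (fun v x => x + signVec A v) fun v x => x + signVec A (flipAt j v)
  have S₄ := S (fun v x => x + signVec A v) fun v x => x - signVec A v
  simp only [S₁, S₂, S₃, S₄] at key
  exact key

end

/-! ### Functions on the line split into unit intervals -/

section

open MeasureTheory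

theorem lintegral_floor_fract (H : ℤ → ℝ → ENNReal) :
    ∫⁻ t : ℝ, H ⌊t⌋ (Int.fract t) = ∑' z, ∫⁻ s in Set.Ico (0 : ℝ) 1, H z s := by
  rw [← setLIntegral_univ, ← iUnion_Ico_intCast ℝ,
    lintegral_iUnion (fun _ => measurableSet_Ico) (Set.pairwise_disjoint_Ico_intCast ℝ)]
  refine tsum_congr fun z => ?_
  rw [← lintegral_indicator measurableSet_Ico, ← lintegral_indicator measurableSet_Ico,
    ← lintegral_sub_right_eq_self ((Set.Ico (0 : ℝ) 1).indicator (H z)) (z : ℝ)]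
  refine lintegral_congr fun t => ?_
  by_cases ht : t ∈ Set.Ico (z : ℝ) (z + 1)
  · have hz : ⌊t⌋ = z := Int.floor_eq_iff.2 ht
    have ht' : t - z ∈ Set.Ico (0 : ℝ) 1 := ⟨by linarith [ht.1], by linarith [ht.2]⟩
    rw [Set.indicator_of_mem ht, Set.indicator_of_mem ht', Int.fract, hz]
  · have ht' : t - z ∉ Set.Ico (0 : ℝ) 1 := fun h => ht ⟨by linarith [h.1], by linarith [h.2]⟩
    rw [Set.indicator_of_notMem ht, Set.indicator_of_notMem ht']

theorem memLp_ofReal_of_lintegral_lt_top {p : ℝ} (hp : 0 < p) {f : ℝ → ℝ} (hf : Measurable f)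
    (h : ∫⁻ t, ENNReal.ofReal (|f t| ^ p) < ⊤) : MemLp f (ENNReal.ofReal p) volume := by
  refine ⟨hf.aestronglyMeasurable, ?_⟩
  rw [← eLpNorm_ofReal_rpow_eq_lintegral hp] at h
  exact (ENNReal.rpow_lt_top_iff_of_pos hp).1 h

theorem ofReal_norm_toLp_sub_rpow {p : ℝ} (hp : 0 < p) {f g : ℝ → ℝ}
    (hf : MemLp f (ENNReal.ofReal p) volume) (hg : MemLp g (ENNReal.ofReal p) volume) :
    ENNReal.ofReal (‖hf.toLp f - hg.toLp g‖ ^ p) = ∫⁻ t, ENNReal.ofReal (|f t - g t| ^ p) := by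
  rw [ofReal_norm_sub_rpow hp]
  refine lintegral_congr_ae ?_
  filter_upwards [hf.coeFn_toLp, hg.coeFn_toLp] with t h1 h2
  rw [h1, h2]

theorem exists_step_embedding {ι : Type} [Fintype ι] {q : ℝ} (hq : 0 < q) :
    ∃ Φ : (ι → ℝ) → LpSpace q, ∀ x y, ‖Φ x - Φ y‖ ^ q = ∑ i, |x i - y i| ^ q := by
  obtain ⟨e⟩ : Nonempty (ι ↪ ℤ) :=
    ⟨(Fintype.equivFin ι).toEmbedding.trans (Fin.valEmbedding.trans Nat.castEmbedding)⟩
  set T : (ι → ℝ) → ℝ → ℝ := fun x t => Function.extend e x 0 ⌊t⌋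
  have hT : ∀ x, Measurable (T x) := fun x =>
    (measurable_from_top (f := Function.extend e x 0)).comp Int.measurable_floor
  have hsum : ∀ x y, ∫⁻ t, ENNReal.ofReal (|T x t - T y t| ^ q) =
      ENNReal.ofReal (∑ i, |x i - y i| ^ q) := by
    intro x y
    rw [lintegral_floor_fract fun z _ => ENNReal.ofReal
      (|Function.extend e x 0 z - Function.extend e y 0 z| ^ q)]
    simp only [lintegral_const, Measure.restrict_apply MeasurableSet.univ, Set.univ_inter,
      Real.volume_Ico, sub_zero, ENNReal.ofReal_one, mul_one]
    rw [ENNReal.ofReal_sum_of_nonneg fun i _ => Real.rpow_nonneg (abs_nonneg _) _,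
      ← tsum_fintype (L := .unconditional _)]
    rw [← e.injective.tsum_eq]
    · simp only [e.injective.extend_apply]
    · intro z hz
      by_contra h
      refine hz ?_
      have h' : ¬ ∃ a, e a = z := h
      simp [Function.extend_apply' _ _ _ h', Real.zero_rpow hq.ne']
  have hT0 : T 0 = 0 := by
    funext t
    by_cases h : ∃ a, e a = ⌊t⌋
    · obtain ⟨a, ha⟩ := h
      simp [T, ← ha, e.injective.extend_apply]
    · simp [T, Function.extend_apply' _ _ _ h]
  have hL : ∀ x, MemLp (T x) (ENNReal.ofReal q) volume := fun x =>
    memLp_ofReal_of_lintegral_lt_top hq (hT x) (by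
      have := hsum x 0
      simp only [hT0, Pi.zero_apply, sub_zero] at this
      rw [this]
      exact ENNReal.ofReal_lt_top)
  refine ⟨fun x => (hL x).toLp _, fun x y => ?_⟩
  have h := (ofReal_norm_toLp_sub_rpow hq (hL x) (hL y)).trans (hsum x y)
  exact (ENNReal.ofReal_eq_ofReal_iff (Real.rpow_nonneg (lpSpace_norm_nonneg _) _)
    (sum_nonneg fun i _ => Real.rpow_nonneg (abs_nonneg _) _)).1 h

end

/-! ### Scaled characters of a cyclic group -/

/-- The scaled distance between the images of two points of a cyclic group on the circle. -/
noncomputable def chordDist (m : ℕ) [NeZero m] (a b : ZMod (4 * m)) : ℝ :=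
  m * ‖ZMod.stdAddChar a - ZMod.stdAddChar b‖

section

variable {m : ℕ} [NeZero m]

theorem chordDist_nonneg (a b : ZMod (4 * m)) : 0 ≤ chordDist m a b := by
  unfold chordDist; positivity

theorem chordDist_self (a : ZMod (4 * m)) : chordDist m a a = 0 := by simp [chordDist]

theorem chordDist_comm (a b : ZMod (4 * m)) : chordDist m a b = chordDist m b a := by
  rw [chordDist, norm_sub_rev, chordDist]

theorem chordDist_triangle (a b c : ZMod (4 * m)) :
    chordDist m a c ≤ chordDist m a b + chordDist m b c := by
  unfold chordDist
  rw [← mul_add]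
  exact mul_le_mul_of_nonneg_left (norm_sub_le_norm_sub_add_norm_sub _ _ _) (Nat.cast_nonneg m)

theorem chordDist_add_left (a u w : ZMod (4 * m)) :
    chordDist m (a + u) (a + w) = chordDist m u w := by
  unfold chordDist
  rw [AddChar.map_add_eq_mul, AddChar.map_add_eq_mul, ← mul_sub, norm_mul, AddChar.norm_apply,
    one_mul]

theorem chordDist_one_zero_le : chordDist m 1 0 ≤ 2 := by
  have hm : (0 : ℝ) < m := Nat.cast_pos.2 (NeZero.pos m)
  have h1 : ZMod.stdAddChar (1 : ZMod (4 * m)) =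
      Complex.exp (Complex.I * (2 * Real.pi / (4 * m) : ℝ)) := by
    have := ZMod.stdAddChar_coe (N := 4 * m) 1
    rw [Int.cast_one] at this
    rw [this]
    congr 1
    push_cast
    ring
  have h2 := Real.norm_exp_I_mul_ofReal_sub_one_le (x := 2 * Real.pi / (4 * m))
  rw [chordDist, h1, AddChar.map_zero_eq_one]
  rw [Real.norm_of_nonneg (by positivity)] at h2
  calc (m : ℝ) * _ ≤ m * (2 * Real.pi / (4 * m)) := by gcongr
    _ = Real.pi / 2 := by field_simp; ring
    _ ≤ 2 := by linarith [Real.pi_le_four]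

theorem chordDist_sign_zero_le {u : ZMod (4 * m)} (hu : u = 1 ∨ u = -1 ∨ u = 0) :
    chordDist m u 0 ≤ 2 := by
  rcases hu with rfl | rfl | rfl
  · exact chordDist_one_zero_le
  · rw [← chordDist_add_left 1, add_neg_cancel, add_zero, chordDist_comm]
    exact chordDist_one_zero_le
  · rw [chordDist_self]; norm_num

theorem chordDist_add_le {a u w : ZMod (4 * m)} (hu : u = 1 ∨ u = -1 ∨ u = 0)
    (hw : w = 1 ∨ w = -1 ∨ w = 0) : chordDist m (a + u) (a + w) ≤ 4 := by
  rw [chordDist_add_left]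
  have h := chordDist_triangle u 0 w
  rw [chordDist_comm 0 w] at h
  linarith [chordDist_sign_zero_le hu, chordDist_sign_zero_le hw]

theorem chordDist_antipode {a u : ZMod (4 * m)} (hu : u = 1 ∨ u = -1) :
    chordDist m (a + (2 * m) • u) a = 2 * m := by
  have h0 : chordDist m (a + (2 * m) • u) a = chordDist m ((2 * m) • u) 0 := by
    rw [← chordDist_add_left a _ 0, add_zero]
  have h1 : ((2 * m : ℕ) : ZMod (4 * m)) + ((2 * m : ℕ) : ZMod (4 * m)) = 0 := by
    rw [← Nat.cast_add, ← two_mul, ← mul_assoc]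
    exact ZMod.natCast_self _
  have h2 : (2 * m) • u = ((2 * m : ℕ) : ZMod (4 * m)) := by
    rcases hu with rfl | rfl
    · rw [nsmul_one]
    · rw [smul_neg, nsmul_one, neg_eq_iff_add_eq_zero, h1]
  have h3 : ZMod.stdAddChar ((2 * m : ℕ) : ZMod (4 * m)) = -1 := by
    have := ZMod.stdAddChar_coe (N := 4 * m) ((2 * m : ℕ) : ℤ)
    rw [Int.cast_natCast] at this
    rw [this, ← Complex.exp_pi_mul_I]
    congr 1
    have hm : (m : ℂ) ≠ 0 := Nat.cast_ne_zero.2 (NeZero.ne m)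
    push_cast
    field_simp
    ring
  rw [h0, h2, chordDist, h3, AddChar.map_zero_eq_one]
  norm_num
  ring

theorem exists_torus_map {q : ℝ} (hq : 0 < q) (n m : ℕ) [NeZero m] :
    ∃ g : (Fin n → ZMod (4 * m)) → LpSpace q, ∀ x y,
      ‖g x - g y‖ ^ q ≤ ∑ j, 2 * chordDist m (x j) (y j) ^ q ∧
      ∑ j, (chordDist m (x j) (y j) / 2) ^ q ≤ ‖g x - g y‖ ^ q := by
  obtain ⟨Φ, hΦ⟩ := exists_step_embedding (ι := Fin n × Bool) hq
  set X : (Fin n → ZMod (4 * m)) → Fin n × Bool → ℝ := fun x jb =>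
    m * if jb.2 then (ZMod.stdAddChar (x jb.1)).re else (ZMod.stdAddChar (x jb.1)).im
  refine ⟨fun x => Φ (X x), fun x y => ?_⟩
  have hm : (0 : ℝ) ≤ m := Nat.cast_nonneg m
  rw [hΦ, Fintype.sum_prod_type]
  simp only [Fintype.sum_bool, X, if_true, Bool.false_eq_true, if_false, ← mul_sub, abs_mul,
    abs_of_nonneg hm, ← Complex.sub_re, ← Complex.sub_im]
  constructor
  · refine sum_le_sum fun j _ => ?_
    rw [two_mul]
    unfold chordDist
    gcongr
    · exact Complex.abs_re_le_norm _
    · exact Complex.abs_im_le_norm _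
  · refine sum_le_sum fun j _ => ?_
    have h := Complex.norm_le_abs_re_add_abs_im
      (ZMod.stdAddChar (x j) - ZMod.stdAddChar (y j))
    set z := ZMod.stdAddChar (x j) - ZMod.stdAddChar (y j) with hz
    have hd : chordDist m (x j) (y j) = m * ‖z‖ := rfl
    have hre : 0 ≤ (m * |z.re|) ^ q := by positivity
    have him : 0 ≤ (m * |z.im|) ^ q := by positivity
    rw [hd]
    rcases le_total |z.re| |z.im| with h' | h'
    · have : (m * ‖z‖ / 2) ^ q ≤ (m * |z.im|) ^ q := by
        refine Real.rpow_le_rpow (by positivity) ?_ hq.le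
        rw [mul_div_assoc]
        exact mul_le_mul_of_nonneg_left (by linarith) hm
      linarith
    · have : (m * ‖z‖ / 2) ^ q ≤ (m * |z.re|) ^ q := by
        refine Real.rpow_le_rpow (by positivity) ?_ hq.le
        rw [mul_div_assoc]
        exact mul_le_mul_of_nonneg_left (by linarith) hm
      linarith

end

section

theorem expect_comp_eval {n L : ℕ} [NeZero L] (j : Fin n) (g : Fin L → ℝ) :
    𝔼 c : Fin n → Fin L, g (c j) = 𝔼 a, g a := by
  have h : ∀ a : Fin L, 𝔼 c : Fin n → Fin L, g (c j + a) = 𝔼 c : Fin n → Fin L, g (c j) :=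
    fun a => expect_add_right (fun c : Fin n → Fin L => g (c j)) fun _ => a
  have h' : 𝔼 a : Fin L, 𝔼 c : Fin n → Fin L, g (c j + a) = 𝔼 c : Fin n → Fin L, g (c j) := by
    simp only [h, Fintype.expect_const]
  rw [← h', Finset.expect_comm]
  have h'' : ∀ c : Fin n → Fin L, 𝔼 a : Fin L, g (c j + a) = 𝔼 a, g a := fun c => by
    simp only [add_comm (c j)]
    exact expect_add_right g (c j)
  simp only [h'', Fintype.expect_const]

theorem expect_card_eq_zero {n L : ℕ} [NeZero L] (b : ℝ) :
    𝔼 c : Fin n → Fin L, ∑ j, (if c j = 0 then b else 0) = n * (b / L) := by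
  rw [Finset.expect_sum_comm]
  have h : ∀ j : Fin n, 𝔼 c : Fin n → Fin L, (if c j = 0 then b else 0) = b / L := fun j => by
    rw [expect_comp_eval j fun a => if a = 0 then b else 0, Fintype.expect_eq_sum_div_card]
    simp
  simp only [h, sum_const, card_univ, Fintype.card_fin, nsmul_eq_mul]

theorem signVec_mem {A : Type*} [CommRing A] (v : Fin n → Bool) (j : Fin n) :
    signVec A v j = 1 ∨ signVec A v j = -1 := by
  unfold signVec
  split <;> simp

theorem exists_torus_map_bounds {q : ℝ} (hq : 0 < q) (n m : ℕ) [NeZero m] :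
    ∃ g : (Fin n → ZMod (4 * m)) → LpSpace q,
      (∀ x S v, ∑ j, (if S j then (m : ℝ) ^ q else 0) ≤
        ‖g (x + (2 * m) • signOn _ S v) - g x‖ ^ q) ∧
      (∀ x S v, ‖g (x + signOff _ S v) - g x‖ ^ q ≤ n * (2 * 4 ^ q)) ∧
      (∀ x v, ‖g (x + signVec _ v) - g (x - signVec _ v)‖ ^ q ≤ n * (2 * 4 ^ q)) ∧
      (∀ x v j, ‖g (x + signVec _ v) - g (x + signVec _ (flipAt j v))‖ ^ q ≤ 2 * 4 ^ q) := by
  obtain ⟨g, hg⟩ := exists_torus_map hq n m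
  have hub : ∀ x u w : Fin n → ZMod (4 * m), (∀ j, u j = 1 ∨ u j = -1 ∨ u j = 0) →
      (∀ j, w j = 1 ∨ w j = -1 ∨ w j = 0) →
      ‖g (x + u) - g (x + w)‖ ^ q ≤ n * (2 * 4 ^ q) := by
    intro x u w hu hw
    refine (hg _ _).1.trans ?_
    calc _ ≤ ∑ j : Fin n, 2 * (4 : ℝ) ^ q := by
          refine sum_le_sum fun j _ => ?_
          have := chordDist_add_le (a := x j) (hu j) (hw j)
          have h0 := chordDist_nonneg (x j + u j) (x j + w j)
          simp only [Pi.add_apply]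
          gcongr
      _ = _ := by simp
  have hs : ∀ (v : Fin n → Bool) j, signVec (ZMod (4 * m)) v j = 1 ∨
      signVec (ZMod (4 * m)) v j = -1 ∨ signVec (ZMod (4 * m)) v j = 0 := fun v j =>
    (signVec_mem v j).imp_right Or.inl
  refine ⟨g, fun x S v => le_trans ?_ (hg _ _).2, fun x S v => ?_, fun x v => ?_, fun x v j => ?_⟩
  · refine sum_le_sum fun j _ => ?_
    split
    next h =>
      have : signOn (ZMod (4 * m)) S v j = signVec _ v j := by simp [signOn, h]
      rw [Pi.add_apply, Pi.smul_apply, this, chordDist_antipode (signVec_mem v j),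
        mul_div_cancel_left₀ _ two_ne_zero]
    next h =>
      exact Real.rpow_nonneg (div_nonneg (chordDist_nonneg _ _) zero_le_two) _
  · have := hub x (signOff _ S v) 0 (fun j => ?_) (fun j => by simp)
    · rwa [add_zero] at this
    · unfold signOff
      split
      · simp
      · exact hs v j
  · rw [sub_eq_add_neg x]
    exact hub x (signVec _ v) (-signVec _ v) (hs v) fun j => by
      rcases signVec_mem (A := ZMod (4 * m)) v j with h | h <;> simp [h]
  · refine (hg _ _).1.trans ?_
    rw [sum_eq_single j]
    · have := chordDist_add_le (a := x j) (hs v j) (hs (flipAt j v) j)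
      have h0 := chordDist_nonneg (x j + signVec _ v j) (x j + signVec _ (flipAt j v) j)
      simp only [Pi.add_apply]
      gcongr
    · intro i _ hi
      have : signVec (ZMod (4 * m)) (flipAt j v) i = signVec _ v i := by
        simp [signVec, flipAt, hi]
      rw [Pi.add_apply, Pi.add_apply, this, chordDist_self, Real.zero_rpow hq.ne', mul_zero]
    · simp

end

section

theorem rpow_le_norm_pow {q p' θ : ℝ} {p : ℕ} (hq : 0 < q) {f : LpSpace q → LpSpace p'}
    (hf : ∀ x y, ‖x - y‖ ^ θ ≤ ‖f x - f y‖) (hθ : 0 ≤ θ) {x y : LpSpace q} {B : ℝ} (hB : 0 ≤ B)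
    (h : B ≤ ‖x - y‖ ^ q) : B ^ (θ * p / q) ≤ ‖f x - f y‖ ^ p := by
  have h0 := lpSpace_norm_nonneg (x - y)
  calc B ^ (θ * p / q) ≤ (‖x - y‖ ^ q) ^ (θ * p / q) := by gcongr
    _ = (‖x - y‖ ^ θ) ^ p := by
      rw [← Real.rpow_mul h0, mul_div_cancel₀ _ hq.ne', Real.rpow_mul_natCast h0]
    _ ≤ _ := by
      gcongr
      exact hf x y

theorem norm_pow_le_mul_rpow {q p' θ D : ℝ} {p : ℕ} (hq : 0 < q) {f : LpSpace q → LpSpace p'}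
    (hf : ∀ x y, ‖f x - f y‖ ≤ D * ‖x - y‖ ^ θ) (hθ : 0 ≤ θ) (hD : 0 ≤ D) {x y : LpSpace q}
    {B : ℝ} (h : ‖x - y‖ ^ q ≤ B) : ‖f x - f y‖ ^ p ≤ D ^ p * B ^ (θ * p / q) := by
  have h0 := lpSpace_norm_nonneg (x - y)
  have h1 := lpSpace_norm_nonneg (f x - f y)
  have h2 : 0 ≤ ‖x - y‖ ^ q := Real.rpow_nonneg h0 _
  calc ‖f x - f y‖ ^ p ≤ (D * ‖x - y‖ ^ θ) ^ p := by
        gcongr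
        exact hf x y
    _ = D ^ p * (‖x - y‖ ^ q) ^ (θ * p / q) := by
      rw [mul_pow, ← Real.rpow_mul h0, mul_div_cancel₀ _ hq.ne', Real.rpow_mul_natCast h0]
    _ ≤ _ := by gcongr

theorem expect_le_const {ι : Type*} [Fintype ι] [Nonempty ι] {f : ι → ℝ} {a : ℝ}
    (h : ∀ i, f i ≤ a) : 𝔼 i, f i ≤ a :=
  (expect_mono_real h).trans_eq (Fintype.expect_const a)

theorem le_expect_const {ι : Type*} [Fintype ι] [Nonempty ι] {f : ι → ℝ} {a : ℝ}
    (h : ∀ i, a ≤ f i) : a ≤ 𝔼 i, f i :=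
  (Fintype.expect_const a).symm.trans_le (expect_mono_real h)

theorem exists_rpow_le_of_snowflake {r : ℕ} {q θ D : ℝ} (hq : 0 < q) (hθ : 0 ≤ θ) (hD : 0 ≤ D)
    (hs : 1 ≤ θ * (2 * (r + 2) : ℕ) / q) {f : LpSpace q → LpSpace ((2 * (r + 2) : ℕ) : ℝ)}
    (hf : ∀ x y, ‖x - y‖ ^ θ ≤ ‖f x - f y‖ ∧ ‖f x - f y‖ ≤ D * ‖x - y‖ ^ θ) :
    ∃ C : ℝ, 0 ≤ C ∧ ∀ (n L m : ℕ) [NeZero L] [NeZero m],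
      (n * ((m : ℝ) ^ q / L)) ^ (θ * (2 * (r + 2) : ℕ) / q) ≤
        C * ((n : ℝ) ^ (θ * (2 * (r + 2) : ℕ) / q) + m ^ (2 * (r + 2)) * ((1 / L) * n +
          (1 / L) ^ (r + 2) * (n : ℝ) ^ (θ * (2 * (r + 2) : ℕ) / q))) := by
  obtain ⟨C, hC, H⟩ := exists_expect_torus_norm_pow_le r
  generalize 2 * (r + 2) = p at *
  set s := θ * p / q with hs'
  refine ⟨C * (D ^ p * (2 * 4 ^ q) ^ s), by positivity, fun n L m _ _ => ?_⟩
  have : NeZero (4 * m) := ⟨mul_ne_zero four_ne_zero (NeZero.ne m)⟩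
  obtain ⟨g, g₁, g₂, g₃, g₄⟩ := exists_torus_map_bounds hq n m
  have key := H n L m (ZMod (4 * m)) fun x => f (g x)
  set K : ℝ := D ^ p * (2 * 4 ^ q) ^ s with hK
  have hK0 : 0 ≤ K := by positivity
  have hn : D ^ p * (n * (2 * 4 ^ q)) ^ s = K * (n : ℝ) ^ s := by
    rw [Real.mul_rpow (Nat.cast_nonneg n) (by positivity), hK]
    ring
  have u₂ : ∀ x S v, ‖f (g (x + signOff _ S v)) - f (g x)‖ ^ p ≤ K * (n : ℝ) ^ s := fun x S v =>
    (norm_pow_le_mul_rpow hq (fun x y => (hf x y).2) hθ hD (g₂ x S v)).trans_eq hn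
  have u₃ : ∀ x v, ‖f (g (x + signVec _ v)) - f (g (x - signVec _ v))‖ ^ p ≤ K * (n : ℝ) ^ s :=
    fun x v => (norm_pow_le_mul_rpow hq (fun x y => (hf x y).2) hθ hD (g₃ x v)).trans_eq hn
  have u₄ : ∀ x v j, ‖f (g (x + signVec _ v)) - f (g (x + signVec _ (flipAt j v)))‖ ^ p ≤ K :=
    fun x v j => norm_pow_le_mul_rpow hq (fun x y => (hf x y).2) hθ hD (g₄ x v j)
  have hm : (0 : ℝ) ≤ (m : ℝ) ^ q := by positivity
  have hS : ∀ S : Fin n → Bool, 0 ≤ ∑ j, (if S j then (m : ℝ) ^ q else 0) := fun S =>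
    sum_nonneg fun j _ => by split <;> simp [hm]
  have lower : (n * ((m : ℝ) ^ q / L)) ^ s ≤ 𝔼 c : Fin n → Fin L, 𝔼 v : Fin n → Bool,
      𝔼 x : Fin n → ZMod (4 * m),
        ‖f (g (x + (2 * m) • signOn _ (fun j => decide (c j = 0)) v)) - f (g x)‖ ^ p := by
    rw [← expect_card_eq_zero]
    refine (expect_rpow_le_of_nonneg _ (fun c => ?_) hs).trans (expect_mono_real fun c => ?_)
    · simpa using hS fun j => decide (c j = 0)
    · refine le_expect_const fun v => le_expect_const fun x => ?_
      have := rpow_le_norm_pow (p := p) hq (fun x y => (hf x y).1) hθ (hS _)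
        (g₁ x (fun j => decide (c j = 0)) v)
      simpa using this
  have w₂ : 𝔼 c : Fin n → Fin L, 𝔼 v : Fin n → Bool, 𝔼 x : Fin n → ZMod (4 * m),
      ‖f (g (x + signOff _ (fun j => decide (c j = 0)) v)) - f (g x)‖ ^ p ≤ K * (n : ℝ) ^ s :=
    expect_le_const fun c => expect_le_const fun v => expect_le_const fun x => u₂ x _ v
  have w₃ : 𝔼 v : Fin n → Bool, 𝔼 x : Fin n → ZMod (4 * m),
      ‖f (g (x + signVec _ v)) - f (g (x - signVec _ v))‖ ^ p ≤ K * (n : ℝ) ^ s :=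
    expect_le_const fun v => expect_le_const fun x => u₃ x v
  have w₄ : ∑ j : Fin n, 𝔼 v : Fin n → Bool, 𝔼 x : Fin n → ZMod (4 * m),
      ‖f (g (x + signVec _ v)) - f (g (x + signVec _ (flipAt j v)))‖ ^ p ≤ n * K := by
    refine (sum_le_sum fun j _ => expect_le_const fun v => expect_le_const fun x =>
      u₄ x v j).trans_eq ?_
    simp
  refine lower.trans (key.trans ?_)
  have q1 : (0 : ℝ) ≤ 1 / L := one_div_nonneg.2 (Nat.cast_nonneg L)
  calc _ ≤ C * (K * (n : ℝ) ^ s + m ^ p * ((1 / L) * (n * K) + (1 / L) ^ (r + 2) *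
        (K * (n : ℝ) ^ s))) := by gcongr
    _ = _ := by ring

theorem le_div_of_even_snowflake {r : ℕ} {q θ D : ℝ} (hq : 2 < q) (hθ : 0 ≤ θ) (hD : 0 ≤ D)
    {f : LpSpace q → LpSpace ((2 * (r + 2) : ℕ) : ℝ)}
    (hf : ∀ x y, ‖x - y‖ ^ θ ≤ ‖f x - f y‖ ∧ ‖f x - f y‖ ≤ D * ‖x - y‖ ^ θ) :
    θ ≤ q / (2 * (r + 2) : ℕ) := by
  by_contra! hlt
  have hq0 : 0 < q := by linarith
  have hp0 : (0 : ℝ) < (2 * (r + 2) : ℕ) := by positivity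
  have hs : 1 < θ * (2 * (r + 2) : ℕ) / q := by
    rw [lt_div_iff₀ hq0, one_mul]
    exact (div_lt_iff₀ hp0).1 hlt
  obtain ⟨C, hC, H⟩ := exists_rpow_le_of_snowflake hq0 hθ hD hs.le hf
  generalize θ * (2 * (r + 2) : ℕ) / q = s at H hs
  have hs0 : 0 < s := by linarith
  have h1 : ∀ m : ℕ, 0 < m → ((m : ℝ) ^ (q - 2)) ^ s ≤ 2 * C := by
    intro m hm
    have hm' : (0 : ℝ) < m := Nat.cast_pos.2 hm
    have : NeZero m := ⟨hm.ne'⟩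
    have : NeZero (m ^ 2) := ⟨by positivity⟩
    have h2 : ∀ k : ℕ, 0 < k → ((m : ℝ) ^ q) ^ s ≤
        C * (2 * ((m : ℝ) ^ 2) ^ s + m ^ (2 * (r + 2)) * (k : ℝ) ^ (1 - s)) := by
      intro k hk
      have hk' : (0 : ℝ) < k := Nat.cast_pos.2 hk
      have h := H (k * m ^ 2) (m ^ 2) m
      have e1 : ((k * m ^ 2 : ℕ) : ℝ) * ((m : ℝ) ^ q / (m ^ 2 : ℕ)) = k * (m : ℝ) ^ q := by
        push_cast
        field_simp
      have e2 : (m : ℝ) ^ (2 * (r + 2)) * (1 / (m ^ 2 : ℕ)) ^ (r + 2) = 1 := by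
        push_cast
        rw [one_div, inv_pow, ← pow_mul, mul_inv_cancel₀ (by positivity)]
      have e3 : 1 / ((m ^ 2 : ℕ) : ℝ) * (k * m ^ 2 : ℕ) = k := by
        push_cast
        field_simp
      rw [mul_add ((m : ℝ) ^ (2 * (r + 2))), ← mul_assoc _ (_ ^ (r + 2)), e2, e3, e1] at h
      rw [Nat.cast_mul, Nat.cast_pow, Real.mul_rpow hk'.le (by positivity),
        Real.mul_rpow hk'.le (by positivity)] at h
      have hks : 0 < (k : ℝ) ^ s := by positivity
      refine le_of_mul_le_mul_left (h.trans_eq ?_) hks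
      have e4 : (k : ℝ) ^ s * (k : ℝ) ^ (1 - s) = k := by
        rw [← Real.rpow_add hk']; simp
      linear_combination (-C * (m : ℝ) ^ (2 * (r + 2))) * e4
    have h3 : Filter.Tendsto (fun k : ℕ => C * (2 * ((m : ℝ) ^ 2) ^ s +
        m ^ (2 * (r + 2)) * (k : ℝ) ^ (1 - s))) Filter.atTop
        (nhds (C * (2 * ((m : ℝ) ^ 2) ^ s + m ^ (2 * (r + 2)) * 0))) := by
      refine ((Filter.Tendsto.const_mul _ ?_).const_add _).const_mul C
      have := (tendsto_rpow_neg_atTop (sub_pos.2 hs)).comp (tendsto_natCast_atTop_atTop (R := ℝ))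
      simpa [Function.comp_def] using this
    have h4 := ge_of_tendsto h3 (Filter.eventually_atTop.2 ⟨1, fun k hk => h2 k hk⟩)
    have e5 : (m : ℝ) ^ (q - 2) * (m : ℝ) ^ 2 = (m : ℝ) ^ q := by
      rw [← Real.rpow_natCast, ← Real.rpow_add hm']
      norm_num
    rw [← e5, Real.mul_rpow (by positivity) (by positivity)] at h4
    refine le_of_mul_le_mul_right (h4.trans_eq ?_) (by positivity : 0 < ((m : ℝ) ^ 2) ^ s)
    ring
  have h5 : Filter.Tendsto (fun m : ℕ => ((m : ℝ) ^ (q - 2)) ^ s) Filter.atTop Filter.atTop :=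
    (tendsto_rpow_atTop hs0).comp
      ((tendsto_rpow_atTop (sub_pos.2 hq)).comp tendsto_natCast_atTop_atTop)
  obtain ⟨m, hm, hm'⟩ := ((h5.eventually_gt_atTop (2 * C)).and
    (Filter.eventually_gt_atTop 0)).exists
  exact absurd (h1 m hm') (not_le.2 hm)

end

/-! ### Snowflakes of the line -/

section

/-- The components of a snowflake embedding of the line into a sequence space. -/
noncomputable def snowKernel (α : ℝ) (k : ℤ × Bool) (a : ℝ) : ℝ :=
  6 * (2 : ℝ) ^ (k.1 * α) *
    if k.2 then Real.cos (a / 2 ^ (k.1 : ℝ)) - 1 else Real.sin (a / 2 ^ (k.1 : ℝ))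

theorem snowKernel_zero (α : ℝ) (k : ℤ × Bool) : snowKernel α k 0 = 0 := by
  simp [snowKernel]

theorem continuous_snowKernel (α : ℝ) (k : ℤ × Bool) : Continuous (snowKernel α k) := by
  unfold snowKernel
  split <;> fun_prop

theorem abs_snowKernel_sub_le (α a b : ℝ) (k : ℤ × Bool) :
    |snowKernel α k a - snowKernel α k b| ≤
      6 * (2 : ℝ) ^ (k.1 * α) * min 2 (|a - b| / 2 ^ (k.1 : ℝ)) := by
  have h2 : (0 : ℝ) < 2 ^ (k.1 : ℝ) := by positivity
  rw [snowKernel, snowKernel, ← mul_sub, abs_mul,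
    abs_of_pos (by positivity : 0 < 6 * (2 : ℝ) ^ (k.1 * α))]
  refine mul_le_mul_of_nonneg_left (le_min ?_ ?_) (by positivity)
  · split
    · refine abs_le.2 ⟨?_, ?_⟩ <;>
      linarith [Real.cos_le_one (a / 2 ^ (k.1 : ℝ)), Real.cos_le_one (b / 2 ^ (k.1 : ℝ)),
        Real.neg_one_le_cos (a / 2 ^ (k.1 : ℝ)), Real.neg_one_le_cos (b / 2 ^ (k.1 : ℝ))]
    · refine abs_le.2 ⟨?_, ?_⟩ <;>
      linarith [Real.sin_le_one (a / 2 ^ (k.1 : ℝ)), Real.sin_le_one (b / 2 ^ (k.1 : ℝ)),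
        Real.neg_one_le_sin (a / 2 ^ (k.1 : ℝ)), Real.neg_one_le_sin (b / 2 ^ (k.1 : ℝ))]
  · have e : |a - b| / 2 ^ (k.1 : ℝ) = |a / 2 ^ (k.1 : ℝ) - b / 2 ^ (k.1 : ℝ)| := by
      rw [← sub_div, abs_div, abs_of_pos h2]
    rw [e]
    split
    · rw [sub_sub_sub_cancel_right]
      exact Real.abs_cos_sub_cos_le _ _
    · exact Real.abs_sin_sub_sin_le _ _

theorem exists_one_le_abs_trig_sub {α β : ℝ} (h₁ : 1 / 2 ≤ |α - β|) (h₂ : |α - β| ≤ 1) :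
    1 ≤ 6 * |Real.cos α - Real.cos β| ∨ 1 ≤ 6 * |Real.sin α - Real.sin β| := by
  by_contra! h
  have hc := Real.cos_le_one_sub_mul_cos_sq (x := α - β) (by linarith [Real.pi_gt_three])
  have hs : (Real.cos α - Real.cos β) ^ 2 + (Real.sin α - Real.sin β) ^ 2 =
      2 - 2 * Real.cos (α - β) := by
    rw [Real.cos_sub]
    nlinarith [Real.sin_sq_add_cos_sq α, Real.sin_sq_add_cos_sq β]
  have hv : 1 / 4 ≤ (α - β) ^ 2 := by
    rw [← sq_abs]; nlinarith
  have hpi : 1 / 8 ≤ 2 / Real.pi ^ 2 := by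
    rw [div_le_div_iff₀ (by norm_num) (by positivity)]
    nlinarith [Real.pi_le_four, Real.pi_pos]
  have h3 : 1 / 8 * (1 / 4) ≤ 2 / Real.pi ^ 2 * (α - β) ^ 2 := by gcongr
  have h4 := sq_abs (Real.cos α - Real.cos β)
  have h5 := sq_abs (Real.sin α - Real.sin β)
  have h6 : |Real.cos α - Real.cos β| ^ 2 ≤ (1 / 6) ^ 2 := by
    have := h.1
    gcongr
    linarith
  have h7 : |Real.sin α - Real.sin β| ^ 2 ≤ (1 / 6) ^ 2 := by
    have := h.2
    gcongr
    linarith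
  linarith

theorem summable_two_rpow_neg_mul_abs {δ : ℝ} (hδ : 0 < δ) :
    Summable fun i : ℤ => (2 : ℝ) ^ (-δ * |(i : ℝ)|) := by
  have h : Summable fun n : ℕ => (2 : ℝ) ^ (-δ * n) := by
    have : ∀ n : ℕ, (2 : ℝ) ^ (-δ * n) = ((2 : ℝ) ^ (-δ)) ^ n := fun n =>
      Real.rpow_mul_natCast (by norm_num) _ _
    simp only [this]
    exact summable_geometric_of_lt_one (by positivity)
      (Real.rpow_lt_one_of_one_lt_of_neg (by norm_num) (by linarith))
  refine Summable.of_nat_of_neg ?_ ?_ <;> simpa using h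

theorem exists_two_rpow_le_lt {u : ℝ} (hu : 0 < u) :
    ∃ J : ℤ, (2 : ℝ) ^ (J : ℝ) ≤ u ∧ u < 2 ^ ((J : ℝ) + 1) := by
  obtain ⟨J, h1, h2⟩ := exists_mem_Ico_zpow hu (one_lt_two : (1 : ℝ) < 2)
  refine ⟨J, by rwa [Real.rpow_intCast], ?_⟩
  have : ((J : ℝ) + 1) = ((J + 1 : ℤ) : ℝ) := by push_cast; rfl
  rwa [this, Real.rpow_intCast]

theorem abs_snowKernel_sub_rpow_le {p q : ℝ} (hq : 0 < q) (hqp : q < p) {a b : ℝ} {J : ℤ}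
    (h₁ : (2 : ℝ) ^ (J : ℝ) ≤ |a - b|) (h₂ : |a - b| < 2 ^ ((J : ℝ) + 1)) (k : ℤ × Bool) :
    |snowKernel (q / p) k a - snowKernel (q / p) k b| ^ p ≤
      12 ^ p * |a - b| ^ q * 2 ^ (-min q (p - q) * |((k.1 - J : ℤ) : ℝ)|) := by
  have hp : 0 < p := hq.trans hqp
  obtain ⟨j, β⟩ := k
  set i : ℝ := ((j - J : ℤ) : ℝ) with hi
  have hj : (j : ℝ) = J + i := by rw [hi]; push_cast; ring
  have hmin : min 2 (|a - b| / 2 ^ (j : ℝ)) ≤ 2 * 2 ^ (-max i 0) := by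
    rcases le_total i 0 with h | h
    · rw [max_eq_right h]
      simp
    · rw [max_eq_left h]
      refine (min_le_right _ _).trans ?_
      rw [div_le_iff₀ (by positivity), mul_assoc, ← Real.rpow_add two_pos]
      refine h₂.le.trans_eq ?_
      rw [Real.rpow_add two_pos, Real.rpow_one, mul_comm, hj]
      congr 2
      ring
  have key : |snowKernel (q / p) (j, β) a - snowKernel (q / p) (j, β) b| ≤
      12 * 2 ^ (j * (q / p) - max i 0) := by
    refine (abs_snowKernel_sub_le _ _ _ _).trans ?_
    calc _ ≤ 6 * (2 : ℝ) ^ (j * (q / p)) * (2 * 2 ^ (-max i 0)) := by gcongr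
      _ = _ := by
        rw [sub_eq_add_neg, Real.rpow_add two_pos]
        ring
  calc _ ≤ (12 * (2 : ℝ) ^ (j * (q / p) - max i 0)) ^ p := by gcongr
    _ = 12 ^ p * 2 ^ (j * q - p * max i 0) := by
      rw [Real.mul_rpow (by norm_num) (by positivity), ← Real.rpow_mul (by norm_num)]
      congr 2
      field_simp
    _ ≤ 12 ^ p * 2 ^ (J * q + -min q (p - q) * |i|) := by
      gcongr
      · norm_num
      · have m1 := min_le_left q (p - q)
        have m2 := min_le_right q (p - q)
        rw [hj]
        rcases le_total i 0 with h | h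
        · rw [max_eq_right h, abs_of_nonpos h]
          nlinarith
        · rw [max_eq_left h, abs_of_nonneg h]
          nlinarith
    _ = 12 ^ p * (2 ^ (J : ℝ)) ^ q * 2 ^ (-min q (p - q) * |i|) := by
      rw [Real.rpow_add two_pos, Real.rpow_mul (by norm_num), mul_assoc]
    _ ≤ _ := by gcongr

theorem exists_le_abs_snowKernel_sub_rpow {p q : ℝ} (hq : 0 < q) (hqp : q < p) {a b : ℝ} {J : ℤ}
    (h₁ : (2 : ℝ) ^ (J : ℝ) ≤ |a - b|) (h₂ : |a - b| < 2 ^ ((J : ℝ) + 1)) :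
    ∃ k, |a - b| ^ q ≤ |snowKernel (q / p) k a - snowKernel (q / p) k b| ^ p := by
  have hp : 0 < p := hq.trans hqp
  set R : ℝ := 2 ^ ((J : ℝ) + 1) with hR
  have hR0 : 0 < R := by positivity
  have hJ : (2 : ℝ) ^ (((J + 1 : ℤ)) : ℝ) = R := by push_cast; rfl
  have hJ2 : (2 : ℝ) ^ (J : ℝ) = R / 2 := by
    rw [hR, Real.rpow_add two_pos, Real.rpow_one]; ring
  have e : |a / R - b / R| = |a - b| / R := by rw [← sub_div, abs_div, abs_of_pos hR0]
  have main : ∀ z : ℝ, 1 ≤ 6 * |z| → |a - b| ^ q ≤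
      |6 * (2 : ℝ) ^ (((J + 1 : ℤ) : ℝ) * (q / p)) * z| ^ p := by
    intro z hz
    rw [abs_mul, abs_of_pos (by positivity : 0 < 6 * (2 : ℝ) ^ (((J + 1 : ℤ) : ℝ) * (q / p))),
      mul_right_comm, Real.mul_rpow (by positivity) (by positivity), Real.rpow_mul (by norm_num),
      hJ, ← Real.rpow_mul hR0.le, div_mul_cancel₀ _ hp.ne']
    calc |a - b| ^ q ≤ 1 * R ^ q := by
          rw [one_mul]
          gcongr
      _ ≤ _ := by
        gcongr
        exact Real.one_le_rpow hz hp.le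
  rcases exists_one_le_abs_trig_sub (α := a / R) (β := b / R)
    (by rw [e, le_div_iff₀ hR0]; linarith) (by rw [e, div_le_one hR0]; exact h₂.le) with h | h
  · refine ⟨(J + 1, true), ?_⟩
    simp only [snowKernel, if_true, hJ, ← mul_sub, sub_sub_sub_cancel_right]
    exact main _ h
  · refine ⟨(J + 1, false), ?_⟩
    simp only [snowKernel, Bool.false_eq_true, if_false, hJ, ← mul_sub]
    exact main _ h

theorem exists_tsum_snowKernel_bounds {p q : ℝ} (hq : 0 < q) (hqp : q < p) :
    ∃ C : ℝ, 0 ≤ C ∧ ∀ a b : ℝ,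
      ENNReal.ofReal (|a - b| ^ q) ≤ ∑' k, ENNReal.ofReal
        (|snowKernel (q / p) k a - snowKernel (q / p) k b| ^ p) ∧
      ∑' k, ENNReal.ofReal (|snowKernel (q / p) k a - snowKernel (q / p) k b| ^ p) ≤
        ENNReal.ofReal C * ENNReal.ofReal (|a - b| ^ q) := by
  have hp : 0 < p := hq.trans hqp
  have hS := summable_two_rpow_neg_mul_abs (lt_min hq (sub_pos.2 hqp))
  set w : ℤ → ℝ := fun i => (2 : ℝ) ^ (-min q (p - q) * |(i : ℝ)|) with hw
  have hw0 : ∀ i, 0 ≤ w i := fun i => by positivity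
  have hW : 0 ≤ ∑' i, w i := tsum_nonneg hw0
  refine ⟨12 ^ p * (∑' i, w i) * 2, by positivity, fun a b => ?_⟩
  rcases eq_or_ne a b with rfl | hab
  · simp [Real.zero_rpow hq.ne', Real.zero_rpow hp.ne']
  obtain ⟨J, h₁, h₂⟩ := exists_two_rpow_le_lt (abs_pos.2 (sub_ne_zero.2 hab))
  constructor
  · obtain ⟨k, hk⟩ := exists_le_abs_snowKernel_sub_rpow hq hqp h₁ h₂
    exact (ENNReal.ofReal_le_ofReal hk).trans (ENNReal.le_tsum k)
  · have hX : 0 ≤ 12 ^ p * |a - b| ^ q := by positivity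
    calc _ ≤ ∑' k : ℤ × Bool, ENNReal.ofReal (12 ^ p * |a - b| ^ q * w (k.1 - J)) :=
          ENNReal.tsum_le_tsum fun k => ENNReal.ofReal_le_ofReal
            (abs_snowKernel_sub_rpow_le hq hqp h₁ h₂ k)
      _ = ∑' j : ℤ, ENNReal.ofReal (12 ^ p * |a - b| ^ q * w (j - J)) * 2 := by
        rw [ENNReal.tsum_prod']
        refine tsum_congr fun j => ?_
        rw [tsum_fintype, Fintype.sum_bool, mul_two]
      _ = (∑' i : ℤ, ENNReal.ofReal (12 ^ p * |a - b| ^ q * w i)) * 2 := by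
        rw [ENNReal.tsum_mul_right,
          ← (Equiv.subRight J).tsum_eq fun i => ENNReal.ofReal (12 ^ p * |a - b| ^ q * w i)]
        rfl
      _ = _ := by
        simp only [ENNReal.ofReal_mul hX]
        rw [ENNReal.tsum_mul_left, ← ENNReal.ofReal_tsum_of_nonneg hw0 hS,
          ENNReal.ofReal_mul (by positivity), ENNReal.ofReal_mul (by positivity),
          ENNReal.ofReal_mul (by positivity), ENNReal.ofReal_ofNat]
        ring

end

/-! ### Snowflakes of Lebesgue spaces -/

section

open MeasureTheory

/-- Distribute the compositions of `f` with the functions `K k` over the unit intervals. -/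
noncomputable def spread {κ : Type} (σ : ℤ ≃ ℤ × κ) (K : κ → ℝ → ℝ) (f : ℝ → ℝ) (t : ℝ) : ℝ :=
  K (σ ⌊t⌋).2 (f ((σ ⌊t⌋).1 + Int.fract t))

theorem measurable_spread {κ : Type} (σ : ℤ ≃ ℤ × κ) {K : κ → ℝ → ℝ} (hK : ∀ k, Measurable (K k))
    {f : ℝ → ℝ} (hf : Measurable f) : Measurable (spread σ K f) := by
  have h : Measurable fun z : ℤ × ℝ => K (σ z.1).2 (f ((σ z.1).1 + z.2)) :=
    measurable_from_prod_countable_right fun z => by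
      have h1 : Measurable fun s : ℝ => f ((σ z).1 + s) :=
        hf.comp (measurable_const.add measurable_id)
      exact (hK (σ z).2).comp h1
  exact h.comp (Int.measurable_floor.prodMk measurable_fract)

theorem lintegral_spread_sub {κ : Type} [Countable κ] (σ : ℤ ≃ ℤ × κ) {K : κ → ℝ → ℝ} (hK : ∀ k, Measurable (K k))
    {f g : ℝ → ℝ} (hf : Measurable f) (hg : Measurable g) (p : ℝ) :
    ∫⁻ t, ENNReal.ofReal (|spread σ K f t - spread σ K g t| ^ p) =
      ∫⁻ t, ∑' k, ENNReal.ofReal (|K k (f t) - K k (g t)| ^ p) := by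
  have h : ∀ (z : ℤ) (k : κ), Measurable fun s : ℝ =>
      ENNReal.ofReal (|K k (f (z + s)) - K k (g (z + s))| ^ p) := fun z k => by
    have h1 : Measurable fun s : ℝ => K k (f (z + s)) :=
      (hK _).comp (hf.comp (measurable_const.add measurable_id))
    have h2 : Measurable fun s : ℝ => K k (g (z + s)) :=
      (hK _).comp (hg.comp (measurable_const.add measurable_id))
    fun_prop
  calc _ = ∑' z, ∫⁻ s in Set.Ico (0 : ℝ) 1, ENNReal.ofReal
        (|K (σ z).2 (f ((σ z).1 + s)) - K (σ z).2 (g ((σ z).1 + s))| ^ p) :=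
        lintegral_floor_fract fun z s => ENNReal.ofReal
          (|K (σ z).2 (f ((σ z).1 + s)) - K (σ z).2 (g ((σ z).1 + s))| ^ p)
    _ = ∑' x : ℤ × κ, ∫⁻ s in Set.Ico (0 : ℝ) 1, ENNReal.ofReal
        (|K x.2 (f (x.1 + s)) - K x.2 (g (x.1 + s))| ^ p) :=
        σ.tsum_eq fun x : ℤ × κ => ∫⁻ s in Set.Ico (0 : ℝ) 1, ENNReal.ofReal
          (|K x.2 (f (x.1 + s)) - K x.2 (g (x.1 + s))| ^ p)
    _ = ∑' z : ℤ, ∫⁻ s in Set.Ico (0 : ℝ) 1, ∑' k, ENNReal.ofReal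
        (|K k (f (z + s)) - K k (g (z + s))| ^ p) := by
      rw [ENNReal.tsum_prod']
      exact tsum_congr fun z => (lintegral_tsum fun k => (h z k).aemeasurable).symm
    _ = _ := by
      rw [← lintegral_floor_fract fun z s => ∑' k, ENNReal.ofReal
        (|K k (f (z + s)) - K k (g (z + s))| ^ p)]
      simp only [Int.floor_add_fract]

theorem exists_snowflake_embedding {p q : ℝ} (hq : 0 < q) (hqp : q < p) :
    ∃ D : ℝ, 1 ≤ D ∧ ∃ f : LpSpace q → LpSpace p, ∀ x y : LpSpace q,
      ‖x - y‖ ^ (q / p) ≤ ‖f x - f y‖ ∧ ‖f x - f y‖ ≤ D * ‖x - y‖ ^ (q / p) := by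
  have hp : 0 < p := hq.trans hqp
  obtain ⟨C, hC, H⟩ := exists_tsum_snowKernel_bounds hq hqp
  obtain ⟨σ⟩ : Nonempty (ℤ ≃ ℤ × (ℤ × Bool)) := nonempty_equiv_of_countable
  have hK : ∀ k, Measurable (snowKernel (q / p) k) := fun k => (continuous_snowKernel _ k).measurable
  have hm : ∀ x : LpSpace q, Measurable x := fun x => (Lp.stronglyMeasurable x).measurable
  set T : LpSpace q → ℝ → ℝ := fun x => spread σ (snowKernel (q / p)) x with hT
  have hS0 : spread σ (snowKernel (q / p)) 0 = 0 := by
    funext t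
    exact snowKernel_zero _ _
  have hL : ∀ x, MemLp (T x) (ENNReal.ofReal p) volume := fun x =>
    memLp_ofReal_of_lintegral_lt_top hp (measurable_spread σ hK (hm x)) (by
      have h := lintegral_spread_sub σ hK (hm x) (measurable_zero (α := ℝ) (β := ℝ)) p
      simp only [hS0, Pi.zero_apply, sub_zero] at h
      rw [h]
      have h' : eLpNorm x (ENNReal.ofReal q) volume ^ q < ⊤ :=
        ENNReal.rpow_lt_top_of_nonneg hq.le (Lp.eLpNorm_ne_top x)
      rw [eLpNorm_ofReal_rpow_eq_lintegral hq] at h'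
      calc _ ≤ ∫⁻ t, ENNReal.ofReal C * ENNReal.ofReal (|x t| ^ q) :=
            lintegral_mono fun t => by simpa using (H (x t) 0).2
        _ = ENNReal.ofReal C * ∫⁻ t, ENNReal.ofReal (|x t| ^ q) :=
          lintegral_const_mul' _ _ ENNReal.ofReal_ne_top
        _ < ⊤ := ENNReal.mul_lt_top ENNReal.ofReal_lt_top h')
  set F : LpSpace q → LpSpace p := fun x => (hL x).toLp _
  have hF : ∀ x y, ‖x - y‖ ^ q ≤ ‖F x - F y‖ ^ p ∧ ‖F x - F y‖ ^ p ≤ C * ‖x - y‖ ^ q := by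
    intro x y
    have h1 := ofReal_norm_sub_rpow hq x y
    have h2 : ENNReal.ofReal (‖F x - F y‖ ^ p) = _ :=
      (ofReal_norm_toLp_sub_rpow hp (hL x) (hL y)).trans (lintegral_spread_sub σ hK (hm x) (hm y) p)
    have n1 : 0 ≤ ‖x - y‖ ^ q := Real.rpow_nonneg (lpSpace_norm_nonneg _) _
    have n2 : 0 ≤ ‖F x - F y‖ ^ p := Real.rpow_nonneg (lpSpace_norm_nonneg _) _
    constructor
    · rw [← ENNReal.ofReal_le_ofReal_iff n2, h1, h2]
      exact lintegral_mono fun t => (H (x t) (y t)).1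
    · rw [← ENNReal.ofReal_le_ofReal_iff (mul_nonneg hC n1), ENNReal.ofReal_mul hC, h1, h2,
        ← lintegral_const_mul' _ _ ENNReal.ofReal_ne_top]
      exact lintegral_mono fun t => (H (x t) (y t)).2
  refine ⟨max 1 (C ^ p⁻¹), le_max_left _ _, F, fun x y => ?_⟩
  have n1 := lpSpace_norm_nonneg (x - y)
  have n2 := lpSpace_norm_nonneg (F x - F y)
  have hi : 0 ≤ p⁻¹ := by positivity
  have e1 : (‖x - y‖ ^ q) ^ p⁻¹ = ‖x - y‖ ^ (q / p) := by
    rw [← Real.rpow_mul n1, div_eq_mul_inv]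
  have e2 : (‖F x - F y‖ ^ p) ^ p⁻¹ = ‖F x - F y‖ := Real.rpow_rpow_inv n2 hp.ne'
  have n3 : 0 ≤ ‖x - y‖ ^ q := Real.rpow_nonneg n1 _
  constructor
  · rw [← e1, ← e2]
    exact Real.rpow_le_rpow n3 (hF x y).1 hi
  · rw [← e1, ← e2]
    refine (Real.rpow_le_rpow (Real.rpow_nonneg n2 _) (hF x y).2 hi).trans ?_
    rw [Real.mul_rpow hC n3]
    gcongr
    exact le_max_right _ _

theorem snowflake_comp {p q s θ α D D' : ℝ} (hα : 0 ≤ α) (hD : 0 ≤ D) (hD' : 0 ≤ D')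
    {f : LpSpace q → LpSpace p} {g : LpSpace p → LpSpace s}
    (hf : ∀ x y, ‖x - y‖ ^ θ ≤ ‖f x - f y‖ ∧ ‖f x - f y‖ ≤ D * ‖x - y‖ ^ θ)
    (hg : ∀ x y, ‖x - y‖ ^ α ≤ ‖g x - g y‖ ∧ ‖g x - g y‖ ≤ D' * ‖x - y‖ ^ α)
    (x y : LpSpace q) : ‖x - y‖ ^ (θ * α) ≤ ‖(g ∘ f) x - (g ∘ f) y‖ ∧
      ‖(g ∘ f) x - (g ∘ f) y‖ ≤ D' * D ^ α * ‖x - y‖ ^ (θ * α) := by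
  have n1 := lpSpace_norm_nonneg (x - y)
  have n2 := lpSpace_norm_nonneg (f x - f y)
  have n3 : 0 ≤ ‖x - y‖ ^ θ := Real.rpow_nonneg n1 _
  rw [Real.rpow_mul n1, mul_assoc, ← Real.mul_rpow hD n3]
  exact ⟨(Real.rpow_le_rpow n3 (hf x y).1 hα).trans (hg _ _).1, (hg _ _).2.trans
    (mul_le_mul_of_nonneg_left (Real.rpow_le_rpow n2 (hf x y).2 hα) hD')⟩

end

end

/-- **Theorem 1.3 (of the geometric statements): the critical `L_p` snowflake exponent of
`L_q` equals `q/p`.** Let `2 < q < p < ∞`. Then (i) the `(q/p)`-snowflake of `L_q` admits a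
bi-Lipschitz embedding into `L_p`, and (ii) if the `θ`-snowflake of `L_q` (with `θ ∈ (0,1]`)
admits a bi-Lipschitz embedding into `L_p`, then `θ ≤ q/p`. -/
theorem critical_snowflake_exponent (p q : ℝ) (hp : 2 < p) (hq : 2 < q) (hqp : q < p) :
    (∃ D : ℝ, 1 ≤ D ∧ ∃ f : LpSpace q → LpSpace p, ∀ x y : LpSpace q,
      ‖x - y‖ ^ (q / p) ≤ ‖f x - f y‖ ∧ ‖f x - f y‖ ≤ D * ‖x - y‖ ^ (q / p)) ∧
    (∀ θ : ℝ, 0 < θ → θ ≤ 1 →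
      (∃ D : ℝ, 1 ≤ D ∧ ∃ f : LpSpace q → LpSpace p, ∀ x y : LpSpace q,
        ‖x - y‖ ^ θ ≤ ‖f x - f y‖ ∧ ‖f x - f y‖ ≤ D * ‖x - y‖ ^ θ) →
      θ ≤ q / p) := by
  have hp0 : 0 < p := by linarith
  refine ⟨exists_snowflake_embedding (by linarith) hqp, fun θ hθ _ ⟨D, hD, f, hf⟩ => ?_⟩
  obtain ⟨r, hr⟩ := exists_nat_gt p
  have hr' : p < (2 * (r + 2) : ℕ) := by push_cast; linarith
  have hp' : (0 : ℝ) < (2 * (r + 2) : ℕ) := hp0.trans hr'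
  have hα : 0 ≤ p / (2 * (r + 2) : ℕ) := div_nonneg hp0.le hp'.le
  obtain ⟨D', hD', g, hg⟩ := exists_snowflake_embedding hp0 hr'
  have hD0 : 0 ≤ D' * D ^ (p / (2 * (r + 2) : ℕ)) :=
    mul_nonneg (zero_le_one.trans hD') (Real.rpow_nonneg (zero_le_one.trans hD) _)
  have hle := le_div_of_even_snowflake hq (mul_nonneg hθ.le hα) hD0
    (snowflake_comp hα (zero_le_one.trans hD) (zero_le_one.trans hD') hf hg)
  rw [← mul_div_assoc, div_le_div_iff_of_pos_right hp'] at hle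
  rwa [le_div_iff₀ hp0]
end

section
/- For every p ∈ [2, ∞) there exists C = C(p) ∈ (0, ∞) such that for all k, m, n ∈ ℕ with k ≤ n and m ≥ √(n/k), every f : ℤ_{8m}^n → L_p satisfies ( (1/binom(n,k)) Σ_{S ⊆ [n], |S| = k} E[ ‖f(x + 4m·ε_S) − f(x)‖_{L_p}^p ] )^{1/p} ≤ C·m·( (k/n) Σ_{j=1}^n E[ ‖f(x + e_j) − f(x)‖_{L_p}^p ] + (k/n)^{p/2} E[ ‖f(x + ε) − f(x)‖_{L_p}^p ] )^{1/p}, where the expectations are with respect to (x, ε) chosen uniformly at random from ℤ_{8m}^n × {−1,1}^n. -/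
open Finset

open scoped BigOperators

namespace XpInequality

section ScalarInequalities

lemma abs_expect_rpow_le {α : Type*} [Fintype α] [Nonempty α] (g : α → ℝ) {p : ℝ} (hp : 1 ≤ p) :
    |𝔼 a, g a| ^ p ≤ 𝔼 a, |g a| ^ p := by
  have h1 : |𝔼 a, g a| ^ p ≤ (𝔼 a, |g a|) ^ p :=
    Real.rpow_le_rpow (abs_nonneg _) (abs_expect_le _ _) (by linarith)
  refine h1.trans ?_
  have hc : (Fintype.card α : ℝ) ≠ 0 := by simp
  have h2 := Real.rpow_arith_mean_le_arith_mean_rpow (univ : Finset α)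
    (fun _ => (Fintype.card α : ℝ)⁻¹) (fun a => |g a|) (fun _ _ => by positivity)
    (by simp [hc]) (fun _ _ => abs_nonneg _) hp
  rw [Fintype.expect_eq_sum_div_card, Fintype.expect_eq_sum_div_card]
  simpa [← mul_sum, div_eq_inv_mul] using h2

lemma abs_add_rpow_le (a b : ℝ) {p : ℝ} (hp : 1 ≤ p) :
    |a + b| ^ p ≤ 2 ^ p * (|a| ^ p + |b| ^ p) := by
  have h := Real.rpow_sum_le_const_mul_sum_rpow (univ : Finset (Fin 2)) ![a, b] hp
  simp only [Fin.sum_univ_two, card_univ, Fintype.card_fin] at h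
  simp only [Matrix.cons_val_zero, Matrix.cons_val_one] at h
  have h1 : |a + b| ^ p ≤ (|a| + |b|) ^ p :=
    Real.rpow_le_rpow (abs_nonneg _) (abs_add_le _ _) (by linarith)
  have h2 : ((2 : ℕ) : ℝ) ^ (p - 1) ≤ 2 ^ p := by
    push_cast
    exact Real.rpow_le_rpow_of_exponent_le (by norm_num) (by linarith)
  exact (h1.trans h).trans (by gcongr)

lemma rpow_one_add_add_rpow_one_sub_le {p t : ℝ} (hp : 2 ≤ p) (ht0 : 0 ≤ t) (ht : t ≤ 1 / 2) :
    ((1 + t) ^ p + (1 - t) ^ p) / 2 ≤ 1 + p ^ 2 * Real.exp (p ^ 2) * t ^ 2 := by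
  have key : ∀ s : ℝ, 0 ≤ 1 + s → (1 + s) ^ p ≤ Real.exp (p * s) := by
    intro s hs
    calc (1 + s) ^ p ≤ (Real.exp s) ^ p :=
          Real.rpow_le_rpow hs (by linarith [Real.add_one_le_exp s]) (by linarith)
      _ = Real.exp (p * s) := by rw [← Real.exp_mul, mul_comm]
  have h1 := key t (by linarith)
  have h2 := key (-t) (by linarith)
  have h3 := Real.cosh_le_exp_half_sq (p * t)
  rw [Real.cosh_eq] at h3
  have h4 : Real.exp ((p * t) ^ 2 / 2) ≤ 1 + (p * t) ^ 2 / 2 * Real.exp ((p * t) ^ 2 / 2) := by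
    have h5 := Real.add_one_le_exp (-((p * t) ^ 2 / 2))
    have h6 : Real.exp ((p * t) ^ 2 / 2) * Real.exp (-((p * t) ^ 2 / 2)) = 1 := by
      rw [← Real.exp_add]; simp
    nlinarith [Real.exp_pos ((p * t) ^ 2 / 2)]
  have h7 : Real.exp ((p * t) ^ 2 / 2) ≤ Real.exp (p ^ 2) := by
    apply Real.exp_le_exp.2
    have : t ^ 2 ≤ 1 := by nlinarith
    nlinarith [sq_nonneg p, mul_le_mul_of_nonneg_left this (sq_nonneg p)]
  have h8 : (p * t) ^ 2 / 2 * Real.exp ((p * t) ^ 2 / 2) ≤ p ^ 2 * Real.exp (p ^ 2) * t ^ 2 := by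
    have : (p * t) ^ 2 / 2 * Real.exp ((p * t) ^ 2 / 2) ≤ (p * t) ^ 2 * Real.exp (p ^ 2) := by
      gcongr
      linarith [sq_nonneg (p * t)]
    linarith [mul_pow p t 2]
  have e1 : p * -t = -(p * t) := by ring
  have e2 : 1 + -t = 1 - t := by ring
  rw [e1, e2] at h2
  linarith

/-- The constant in the two-point inequality. -/
noncomputable def twoPointConst (p : ℝ) : ℝ := p ^ 2 * Real.exp (p ^ 2) + 3 ^ p

lemma one_le_twoPointConst {p : ℝ} (hp : 2 ≤ p) : 1 ≤ twoPointConst p := by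
  have : (1 : ℝ) ≤ 3 ^ p := Real.one_le_rpow (by norm_num) (by linarith)
  have : 0 ≤ p ^ 2 * Real.exp (p ^ 2) := by positivity
  unfold twoPointConst
  linarith

lemma two_point_aux {p a g : ℝ} (hp : 2 ≤ p) (ha : 0 ≤ a) (hg : 0 ≤ g) :
    (|a + g| ^ p + |a - g| ^ p) / 2 ≤
      a ^ p + twoPointConst p * (a ^ (p - 2) * g ^ 2 + g ^ p) := by
  have hap : 0 ≤ a ^ p := Real.rpow_nonneg ha _
  have hap2 : 0 ≤ a ^ (p - 2) := Real.rpow_nonneg ha _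
  have hgp : 0 ≤ g ^ p := Real.rpow_nonneg hg _
  have h3 : (0 : ℝ) ≤ 3 ^ p := by positivity
  have hexp : 0 ≤ p ^ 2 * Real.exp (p ^ 2) := by positivity
  unfold twoPointConst
  by_cases h : a ≤ 2 * g
  · have h1 : |a + g| ^ p ≤ 3 ^ p * g ^ p := by
      rw [← Real.mul_rpow (by norm_num) hg]
      apply Real.rpow_le_rpow (abs_nonneg _) _ (by linarith)
      rw [abs_le]; constructor <;> linarith
    have h2 : |a - g| ^ p ≤ 3 ^ p * g ^ p := by
      rw [← Real.mul_rpow (by norm_num) hg]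
      apply Real.rpow_le_rpow (abs_nonneg _) _ (by linarith)
      rw [abs_le]; constructor <;> linarith
    have h4 : 0 ≤ (p ^ 2 * Real.exp (p ^ 2) + 3 ^ p) * (a ^ (p - 2) * g ^ 2) := by positivity
    have h5 : 0 ≤ p ^ 2 * Real.exp (p ^ 2) * g ^ p := by positivity
    linarith
  · push Not at h
    have ha' : 0 < a := by linarith
    have hta : g / a ≤ 1 / 2 := by
      rw [div_le_iff₀ ha']; linarith
    have ht0 : 0 ≤ g / a := by positivity
    have hh := rpow_one_add_add_rpow_one_sub_le hp ht0 hta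
    have e1 : |a + g| ^ p = a ^ p * (1 + g / a) ^ p := by
      rw [← Real.mul_rpow ha (by linarith), abs_of_nonneg (by linarith)]
      congr 1; field_simp
    have e2 : |a - g| ^ p = a ^ p * (1 - g / a) ^ p := by
      rw [← Real.mul_rpow ha (by linarith), abs_of_nonneg (by linarith)]
      congr 1; field_simp
    have e3 : a ^ (p - 2) * g ^ 2 = a ^ p * (g / a) ^ 2 := by
      rw [Real.rpow_sub ha', Real.rpow_two]; field_simp
    have h5 : 0 ≤ a ^ p * (g / a) ^ 2 := by positivity
    rw [e1, e2, e3]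
    have := mul_le_mul_of_nonneg_left hh hap
    have h6 : 0 ≤ 3 ^ p * (a ^ p * (g / a) ^ 2) := by positivity
    have h7 : 0 ≤ (p ^ 2 * Real.exp (p ^ 2) + 3 ^ p) * g ^ p := by positivity
    linarith

lemma two_point {p : ℝ} (hp : 2 ≤ p) (a g : ℝ) :
    (|a + g| ^ p + |a - g| ^ p) / 2 ≤
      |a| ^ p + twoPointConst p * (|a| ^ (p - 2) * g ^ 2 + |g| ^ p) := by
  have h := two_point_aux hp (abs_nonneg a) (abs_nonneg g)
  rw [sq_abs] at h
  refine le_trans (le_of_eq ?_) h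
  rcases abs_cases a with ⟨h1, -⟩ | ⟨h1, -⟩ <;> rcases abs_cases g with ⟨h2, -⟩ | ⟨h2, -⟩ <;>
    rw [h1, h2]
  · rw [sub_neg_eq_add, ← sub_eq_add_neg, add_comm]
  · rw [← abs_neg (-a + g), ← abs_neg (-a - g)]
    ring_nf
  · rw [← abs_neg (-a + -g), ← abs_neg (-a - -g)]
    ring_nf

lemma rpow_sub_two_mul_le {p C u w : ℝ} (hp : 2 ≤ p) (hC : 0 < C) (hu : 0 ≤ u) (hw : 0 ≤ w) :
    C * (u ^ (p - 2) * w) ≤ u ^ p + C ^ (p / 2) * w ^ (p / 2) := by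
  have e : ∀ z : ℝ, 0 ≤ z → z ^ 2 = z ^ (2 : ℝ) := fun z _ => (Real.rpow_two z).symm
  have hup : u ^ (p - 2) * u ^ 2 = u ^ p := by
    rw [e u hu, ← Real.rpow_add_of_nonneg hu (by linarith) (by norm_num)]
    congr 1; ring
  have hCw : 0 ≤ C * w := by positivity
  have hwp : C ^ (p / 2) * w ^ (p / 2) = (C * w) ^ ((p - 2) / 2) * (C * w) := by
    rw [← Real.mul_rpow hC.le hw]
    nth_rewrite 3 [← Real.rpow_one (C * w)]
    rw [← Real.rpow_add_of_nonneg hCw (by linarith) (by norm_num)]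
    congr 1; ring
  have hu' : u ^ (p - 2) = (u ^ 2) ^ ((p - 2) / 2) := by
    rw [e u hu, ← Real.rpow_mul hu]; congr 1; ring
  by_cases h : C * w ≤ u ^ 2
  · have : u ^ (p - 2) * (C * w) ≤ u ^ (p - 2) * u ^ 2 := by gcongr
    have : 0 ≤ C ^ (p / 2) * w ^ (p / 2) := by positivity
    linarith
  · push Not at h
    have : u ^ (p - 2) * (C * w) ≤ (C * w) ^ ((p - 2) / 2) * (C * w) := by
      rw [hu']
      gcongr
    have : 0 ≤ u ^ p := by positivity
    linarith

end ScalarInequalities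

section Cube

variable {ι : Type*} [Fintype ι] [DecidableEq ι]

/-- The sign `±1` of a Boolean. -/
noncomputable def sgn (b : Bool) : ℝ := if b then 1 else -1

lemma sgn_mul_self (b : Bool) : sgn b * sgn b = 1 := by cases b <;> simp [sgn]

lemma sgn_not (b : Bool) : sgn (!b) = -sgn b := by cases b <;> simp [sgn]

lemma abs_sgn (b : Bool) : |sgn b| = 1 := by cases b <;> simp [sgn]

/-- Flipping the `i`-th coordinate of a point of the discrete cube. -/
def flip (i : ι) (ε : ι → Bool) : ι → Bool := Function.update ε i (!ε i)

omit [Fintype ι] in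
@[simp] lemma flip_same (i : ι) (ε : ι → Bool) : flip i ε i = !ε i := by simp [flip]

omit [Fintype ι] in
lemma flip_of_ne {i j : ι} (h : j ≠ i) (ε : ι → Bool) : flip i ε j = ε j := by simp [flip, h]

omit [Fintype ι] in
lemma flip_flip (i : ι) (ε : ι → Bool) : flip i (flip i ε) = ε := by simp [flip]

lemma expect_flip (i : ι) (φ : (ι → Bool) → ℝ) : 𝔼 ε, φ (flip i ε) = 𝔼 ε, φ ε :=
  Fintype.expect_equiv ⟨flip i, flip i, flip_flip i, flip_flip i⟩ _ _ fun _ => rfl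

lemma expect_eq_expect_flip_average (i : ι) (φ : (ι → Bool) → ℝ) :
    𝔼 ε, φ ε = 𝔼 ε, (φ ε + φ (flip i ε)) / 2 := by
  rw [← expect_div, expect_add_distrib, expect_flip]; ring

lemma expect_not (φ : (ι → Bool) → ℝ) : 𝔼 ε : ι → Bool, φ (fun j => !ε j) = 𝔼 ε, φ ε :=
  Fintype.expect_equiv (Equiv.piCongrRight fun _ : ι => Equiv.boolNot)
    (fun ε : ι → Bool => φ fun j => !ε j) φ fun _ => rfl

/-- Mixing two independent uniform points of the cube yields a uniform point. -/
lemma expect_expect_piecewise (S : Finset ι) (φ : (ι → Bool) → ℝ) :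
    𝔼 ε, 𝔼 δ, φ (S.piecewise ε δ) = 𝔼 ε, φ ε := by
  have h : 𝔼 z : (ι → Bool) × (ι → Bool), φ (S.piecewise z.1 z.2) =
      𝔼 z : (ι → Bool) × (ι → Bool), φ z.1 := by
    have hinv : Function.Involutive fun z : (ι → Bool) × (ι → Bool) =>
        (S.piecewise z.1 z.2, S.piecewise z.2 z.1) := by
      rintro ⟨a, b⟩
      ext j <;> by_cases hj : j ∈ S <;> simp [hj]
    exact Fintype.expect_equiv hinv.toPerm _ _ fun _ => rfl
  rw [← univ_product_univ, expect_product, expect_product] at h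
  simpa using h

/-- The conditional expectation of `h` with respect to the coordinates in `S`. -/
noncomputable def condAvg (S : Finset ι) (h : (ι → Bool) → ℝ) (ε : ι → Bool) : ℝ :=
  𝔼 δ, h (S.piecewise ε δ)

lemma condAvg_flip {S : Finset ι} {i : ι} (hi : i ∉ S) (h : (ι → Bool) → ℝ) (ε : ι → Bool) :
    condAvg S h (flip i ε) = condAvg S h ε := by
  unfold condAvg
  congr 1 with δ
  congr 1 with j
  by_cases hj : j ∈ S
  · have : j ≠ i := fun e => hi (e ▸ hj)
    simp [hj, flip_of_ne this]
  · simp [hj]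

lemma expect_abs_condAvg_rpow_le (S : Finset ι) (h : (ι → Bool) → ℝ) {p : ℝ} (hp : 1 ≤ p) :
    𝔼 ε, |condAvg S h ε| ^ p ≤ 𝔼 ε, |h ε| ^ p := by
  rw [← expect_expect_piecewise S fun ε => |h ε| ^ p]
  exact expect_le_expect fun ε _ => abs_expect_rpow_le _ hp

omit [Fintype ι] in
lemma piecewise_flip {S : Finset ι} {i : ι} (hi : i ∉ S) (ε δ : ι → Bool) :
    S.piecewise ε (flip i δ) = flip i (S.piecewise ε δ) := by
  simp [flip, update_piecewise_of_notMem, hi]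

lemma condAvg_insert {S : Finset ι} {i : ι} (hi : i ∉ S) (h : (ι → Bool) → ℝ) (ε : ι → Bool) :
    condAvg (insert i S) h ε =
      condAvg S h ε + sgn (ε i) * condAvg S (fun δ => sgn (δ i) * h δ) ε := by
  have key : condAvg (insert i S) h ε =
      𝔼 δ, (1 + sgn (ε i) * sgn (δ i)) * h (S.piecewise ε δ) := by
    unfold condAvg
    rw [expect_eq_expect_flip_average i, expect_eq_expect_flip_average i fun δ =>
      (1 + sgn (ε i) * sgn (δ i)) * h (S.piecewise ε δ)]
    refine expect_congr rfl fun δ _ => ?_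
    rw [piecewise_insert, piecewise_insert, update_piecewise_of_notMem _ _ _ hi,
      update_piecewise_of_notMem _ _ _ hi]
    have e : Function.update (flip i δ) i (ε i) = Function.update δ i (ε i) := by simp [flip]
    rw [e, flip_same, sgn_not]
    by_cases hb : δ i = ε i
    · have : Function.update δ i (ε i) = δ := by rw [← hb]; simp
      rw [this, hb]
      linear_combination (-(h (S.piecewise ε δ)) + h (S.piecewise ε (flip i δ))) / 2 *
        sgn_mul_self (ε i)
    · have hb' : ε i = !δ i := by cases hx : δ i <;> cases hy : ε i <;> simp_all
      have : Function.update δ i (ε i) = flip i δ := by rw [hb']; rfl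
      rw [this, hb', sgn_not]
      linear_combination (h (S.piecewise ε δ) - h (S.piecewise ε (flip i δ))) / 2 *
        sgn_mul_self (δ i)
  rw [key]
  simp only [condAvg, mul_expect, ← expect_add_distrib]
  refine expect_congr rfl fun δ _ => ?_
  rw [piecewise_eq_of_notMem _ _ _ hi]
  ring

lemma expect_sgn_mul_sgn (i j : ι) :
    𝔼 ε : ι → Bool, sgn (ε i) * sgn (ε j) = if i = j then 1 else 0 := by
  split_ifs with h
  · subst h
    simp only [sgn_mul_self]
    exact Fintype.expect_const _
  · rw [expect_eq_expect_flip_average i]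
    refine expect_eq_zero fun ε _ => ?_
    rw [flip_same, flip_of_ne (Ne.symm h), sgn_not]
    ring

/-- Bessel's inequality for the Rademacher functions. -/
lemma sum_sq_expect_sgn_mul_le (T : Finset ι) (ψ : (ι → Bool) → ℝ) :
    ∑ i ∈ T, (𝔼 δ, sgn (δ i) * ψ δ) ^ 2 ≤ 𝔼 δ, ψ δ ^ 2 := by
  set c : ι → ℝ := fun i => 𝔼 δ, sgn (δ i) * ψ δ with hc
  have h0 : 0 ≤ 𝔼 δ : ι → Bool, (ψ δ - ∑ i ∈ T, c i * sgn (δ i)) ^ 2 :=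
    expect_nonneg fun _ _ => sq_nonneg _
  have h1 : 𝔼 δ : ι → Bool, ψ δ * ∑ i ∈ T, c i * sgn (δ i) = ∑ i ∈ T, c i ^ 2 := by
    simp only [mul_sum]
    rw [expect_sum_comm]
    refine sum_congr rfl fun i _ => ?_
    rw [pow_two]
    nth_rewrite 3 [hc]
    rw [mul_expect]
    exact expect_congr rfl fun δ _ => by ring
  have h2 : 𝔼 δ : ι → Bool, (∑ i ∈ T, c i * sgn (δ i)) ^ 2 = ∑ i ∈ T, c i ^ 2 := by
    simp only [pow_two, sum_mul_sum]
    rw [expect_sum_comm]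
    refine sum_congr rfl fun i hi => ?_
    rw [expect_sum_comm]
    have : ∀ j, 𝔼 δ : ι → Bool, c i * sgn (δ i) * (c j * sgn (δ j)) =
        if i = j then c i * c j else 0 := by
      intro j
      have := expect_sgn_mul_sgn i j
      calc 𝔼 δ : ι → Bool, c i * sgn (δ i) * (c j * sgn (δ j))
          = c i * c j * 𝔼 δ : ι → Bool, sgn (δ i) * sgn (δ j) := by
            rw [mul_expect]; exact expect_congr rfl fun δ _ => by ring
        _ = _ := by rw [this]; split_ifs <;> simp
    simp [this, hi]
  have h3 : 𝔼 δ : ι → Bool, (ψ δ - ∑ i ∈ T, c i * sgn (δ i)) ^ 2 =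
      𝔼 δ, ψ δ ^ 2 - 2 * (𝔼 δ : ι → Bool, ψ δ * ∑ i ∈ T, c i * sgn (δ i)) +
        𝔼 δ : ι → Bool, (∑ i ∈ T, c i * sgn (δ i)) ^ 2 := by
    rw [mul_expect, ← expect_sub_distrib, ← expect_add_distrib]
    exact expect_congr rfl fun δ _ => by ring
  rw [h3, h1, h2] at h0
  linarith

lemma sum_sq_condAvg_sgn_mul_le {S T : Finset ι} (hST : Disjoint S T) (h : (ι → Bool) → ℝ)
    (ε : ι → Bool) :
    ∑ i ∈ T, condAvg S (fun δ => sgn (δ i) * h δ) ε ^ 2 ≤ condAvg S (fun δ => h δ ^ 2) ε := by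
  refine le_trans (le_of_eq ?_) (sum_sq_expect_sgn_mul_le T fun δ => h (S.piecewise ε δ))
  refine sum_congr rfl fun i hi => ?_
  have hi' : i ∉ S := fun hS => disjoint_left.1 hST hS hi
  simp [condAvg, hi']

lemma expect_abs_condAvg_sgn_mul_rpow_le {S : Finset ι} {i : ι} (hi : i ∉ S)
    (h : (ι → Bool) → ℝ) {p : ℝ} (hp : 1 ≤ p) :
    𝔼 ε, |condAvg S (fun δ => sgn (δ i) * h δ) ε| ^ p ≤ 𝔼 ε, |h ε - h (flip i ε)| ^ p := by
  have e : ∀ ε, condAvg S (fun δ => sgn (δ i) * h δ) ε =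
      condAvg S (fun δ => sgn (δ i) * ((h δ - h (flip i δ)) / 2)) ε := by
    intro ε
    unfold condAvg
    rw [expect_eq_expect_flip_average i]
    refine expect_congr rfl fun δ _ => ?_
    simp only [piecewise_flip hi, flip_same, sgn_not]
    ring
  simp only [e]
  refine (expect_abs_condAvg_rpow_le S _ hp).trans (expect_le_expect fun ε _ => ?_)
  apply Real.rpow_le_rpow (abs_nonneg _) _ (by linarith)
  rw [abs_mul, abs_sgn, abs_div, abs_two]
  linarith [abs_nonneg (h ε - h (flip i ε))]

lemma expect_abs_condAvg_insert_rpow_le {S : Finset ι} {i : ι} (hi : i ∉ S)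
    (h : (ι → Bool) → ℝ) {p : ℝ} (hp : 2 ≤ p) :
    𝔼 ε, |condAvg (insert i S) h ε| ^ p ≤ 𝔼 ε, |condAvg S h ε| ^ p + twoPointConst p *
      (𝔼 ε, |condAvg S h ε| ^ (p - 2) * condAvg S (fun δ => sgn (δ i) * h δ) ε ^ 2 +
        𝔼 ε, |h ε - h (flip i ε)| ^ p) := by
  have h0 : 0 ≤ twoPointConst p := by linarith [one_le_twoPointConst hp]
  have h1 := expect_abs_condAvg_sgn_mul_rpow_le hi h (p := p) (by linarith)
  refine le_trans ?_ (add_le_add_right (mul_le_mul_of_nonneg_left (add_le_add_right h1 _) h0) _)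
  rw [← expect_add_distrib, mul_expect, ← expect_add_distrib, expect_eq_expect_flip_average i]
  refine expect_le_expect fun ε _ => ?_
  rw [condAvg_insert hi, condAvg_insert hi, condAvg_flip hi, condAvg_flip hi, flip_same, sgn_not]
  refine le_trans (le_of_eq ?_) (two_point hp _ _)
  cases ε i
  · simp only [sgn]; norm_num; ring_nf
  · simp only [sgn]; norm_num; ring_nf

/-- Averages of `|condAvg S h|^p` over sets `S` of a given size. -/
noncomputable def levelAvg (p : ℝ) (h : (ι → Bool) → ℝ) (j : ℕ) : ℝ :=
  (∑ S ∈ powersetCard j (univ : Finset ι), 𝔼 ε, |condAvg S h ε| ^ p) /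
    ((Fintype.card ι).choose j)

lemma sum_powersetCard_succ (j : ℕ) (φ : Finset ι → ℝ) :
    (j + 1) * ∑ T ∈ powersetCard (j + 1) (univ : Finset ι), φ T =
      ∑ S ∈ powersetCard j (univ : Finset ι), ∑ i ∈ Sᶜ, φ (insert i S) := by
  have h1 : (j + 1) * ∑ T ∈ powersetCard (j + 1) (univ : Finset ι), φ T =
      ∑ T ∈ powersetCard (j + 1) (univ : Finset ι), ∑ _i ∈ T, φ T := by
    rw [mul_sum]
    refine sum_congr rfl fun T hT => ?_
    rw [sum_const, (mem_powersetCard.1 hT).2]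
    simp
  rw [h1, sum_sigma', sum_sigma']
  refine sum_bij' (fun z _ => ⟨z.1.erase z.2, z.2⟩) (fun z _ => ⟨insert z.2 z.1, z.2⟩) ?_ ?_ ?_ ?_ ?_
  · rintro ⟨T, i⟩ h
    simp only [mem_sigma, mem_powersetCard, subset_univ, true_and] at h
    simp [card_erase_of_mem h.2, h.1]
  · rintro ⟨S, i⟩ h
    simp only [mem_sigma, mem_powersetCard, subset_univ, true_and, mem_compl] at h
    simp [card_insert_of_notMem h.2, h.1]
  · rintro ⟨T, i⟩ h
    simp only [mem_sigma, mem_powersetCard, subset_univ, true_and] at h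
    simp [insert_erase h.2]
  · rintro ⟨S, i⟩ h
    simp only [mem_sigma, mem_powersetCard, subset_univ, true_and, mem_compl] at h
    simp [erase_insert h.2]
  · rintro ⟨T, i⟩ h
    simp only [mem_sigma, mem_powersetCard, subset_univ, true_and] at h
    simp [insert_erase h.2]

lemma levelAvg_zero {p : ℝ} (hp : 0 < p) {h : (ι → Bool) → ℝ} (h0 : 𝔼 ε, h ε = 0) :
    levelAvg p h 0 = 0 := by
  simp [levelAvg, condAvg, h0, Real.zero_rpow hp.ne']

lemma expect_condAvg_sq_rpow_le (S : Finset ι) (h : (ι → Bool) → ℝ) {p : ℝ} (hp : 2 ≤ p) :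
    𝔼 ε, condAvg S (fun δ => h δ ^ 2) ε ^ (p / 2) ≤ 𝔼 ε, |h ε| ^ p := by
  refine le_trans (expect_le_expect fun ε _ => ?_)
    ((expect_abs_condAvg_rpow_le S (fun δ => h δ ^ 2) (p := p / 2) (by linarith)).trans
      (le_of_eq (expect_congr rfl fun ε _ => ?_)))
  · apply Real.rpow_le_rpow (expect_nonneg fun _ _ => sq_nonneg _) (le_abs_self _) (by linarith)
  · rw [abs_of_nonneg (sq_nonneg _), ← sq_abs, ← Real.rpow_two, ← Real.rpow_mul (abs_nonneg _)]
    congr 1; ring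

/-- The error term in the recursion for `levelAvg`. -/
noncomputable def levelError (p : ℝ) (h : (ι → Bool) → ℝ) (k : ℕ) : ℝ :=
  twoPointConst p ^ (p / 2) * ((2 * (k / Fintype.card ι)) ^ (p / 2) * 𝔼 ε, |h ε| ^ p) +
    2 * twoPointConst p * (k / Fintype.card ι * ∑ i, 𝔼 ε, |h ε - h (flip i ε)| ^ p)

lemma mul_add_le_of_le_two_mul {k n s C V D : ℝ} (hk : 0 < k) (hn : 0 < n) (hs : n ≤ 2 * s)
    (hC : 0 ≤ C) (hV : 0 ≤ V) (hD : 0 ≤ D) :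
    C * (V + D) ≤ s * (1 / k) * (C * (2 * (k / n) * V) + 2 * C * (k / n * D)) := by
  have : s * (1 / k) * (C * (2 * (k / n) * V) + 2 * C * (k / n * D)) =
      (2 * s / n) * (C * (V + D)) := by
    field_simp
  rw [this]
  have h5 : 1 ≤ 2 * s / n := by rwa [le_div_iff₀ hn, one_mul]
  exact le_mul_of_one_le_left (by positivity) h5

lemma sum_compl_condAvg_insert_le {p : ℝ} (hp : 2 ≤ p) (h : (ι → Bool) → ℝ) {k : ℕ} (hk : 1 ≤ k)
    (hkn : 2 * k ≤ Fintype.card ι) {S : Finset ι} (hS : #S < k) :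
    ∑ i ∈ Sᶜ, 𝔼 ε, |condAvg (insert i S) h ε| ^ p ≤
      #Sᶜ * ((1 + 1 / k) * (𝔼 ε, |condAvg S h ε| ^ p) + 1 / k * levelError p h k) := by
  set n : ℕ := Fintype.card ι with hn
  set C := twoPointConst p with hC
  set A := 𝔼 ε, |condAvg S h ε| ^ p with hA
  set D := ∑ i, 𝔼 ε, |h ε - h (flip i ε)| ^ p with hD
  have hC1 : 1 ≤ C := one_le_twoPointConst hp
  have hk0 : (0 : ℝ) < k := by exact_mod_cast hk
  have hn0 : (0 : ℝ) < n := by exact_mod_cast (by omega : 0 < n)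
  have hcard : (n : ℝ) ≤ 2 * #Sᶜ := by
    rw [card_compl]
    exact_mod_cast (by omega : n ≤ 2 * (Fintype.card ι - #S))
  have hDn : ∀ i, 0 ≤ 𝔼 ε, |h ε - h (flip i ε)| ^ p := fun i =>
    expect_nonneg fun _ _ => by positivity
  have hDS : ∑ i ∈ Sᶜ, 𝔼 ε, |h ε - h (flip i ε)| ^ p ≤ D :=
    sum_le_sum_of_subset_of_nonneg (subset_univ _) fun i _ _ => hDn i
  have hD0 : 0 ≤ D := sum_nonneg fun i _ => hDn i
  have h1 : ∑ i ∈ Sᶜ, 𝔼 ε, |condAvg (insert i S) h ε| ^ p ≤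
      #Sᶜ * A + C * ((𝔼 ε, |condAvg S h ε| ^ (p - 2) * condAvg S (fun δ => h δ ^ 2) ε) + D) := by
    calc ∑ i ∈ Sᶜ, 𝔼 ε, |condAvg (insert i S) h ε| ^ p
        ≤ ∑ i ∈ Sᶜ, (A + C *
          (𝔼 ε, |condAvg S h ε| ^ (p - 2) * condAvg S (fun δ => sgn (δ i) * h δ) ε ^ 2 +
            𝔼 ε, |h ε - h (flip i ε)| ^ p)) :=
          sum_le_sum fun i hi => expect_abs_condAvg_insert_rpow_le (mem_compl.1 hi) h hp
      _ = #Sᶜ * A + C * ((𝔼 ε, |condAvg S h ε| ^ (p - 2) *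
            ∑ i ∈ Sᶜ, condAvg S (fun δ => sgn (δ i) * h δ) ε ^ 2) +
            ∑ i ∈ Sᶜ, 𝔼 ε, |h ε - h (flip i ε)| ^ p) := by
          simp only [mul_sum, expect_sum_comm]
          rw [sum_add_distrib, sum_const, nsmul_eq_mul, ← mul_sum, sum_add_distrib]
      _ ≤ _ := by
          gcongr with ε
          exact sum_sq_condAvg_sgn_mul_le disjoint_compl_right h ε
  set V := 𝔼 ε, |condAvg S h ε| ^ (p - 2) * condAvg S (fun δ => h δ ^ 2) ε with hV
  have h2 : C * (2 * (k / n) * V) ≤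
      A + C ^ (p / 2) * ((2 * (k / n)) ^ (p / 2) * 𝔼 ε, |h ε| ^ p) := by
    have hs : ∀ ε, 0 ≤ condAvg S (fun δ => h δ ^ 2) ε := fun ε =>
      expect_nonneg fun _ _ => sq_nonneg _
    calc C * (2 * (k / n) * V)
        = 𝔼 ε, C * (|condAvg S h ε| ^ (p - 2) *
            (2 * (k / n) * condAvg S (fun δ => h δ ^ 2) ε)) := by
          rw [hV, mul_expect, mul_expect]
          exact expect_congr rfl fun ε _ => by ring
      _ ≤ 𝔼 ε, (|condAvg S h ε| ^ p +
            C ^ (p / 2) * (2 * (k / n) * condAvg S (fun δ => h δ ^ 2) ε) ^ (p / 2)) :=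
          expect_le_expect fun ε _ => rpow_sub_two_mul_le hp (by linarith) (abs_nonneg _)
            (mul_nonneg (by positivity) (hs ε))
      _ = A + C ^ (p / 2) * ((2 * (k / n)) ^ (p / 2) *
            𝔼 ε, condAvg S (fun δ => h δ ^ 2) ε ^ (p / 2)) := by
          rw [expect_add_distrib, mul_expect, mul_expect]
          congr 1
          refine expect_congr rfl fun ε _ => ?_
          rw [Real.mul_rpow (by positivity) (hs ε)]
      _ ≤ _ := by
          exact add_le_add le_rfl (mul_le_mul_of_nonneg_left (mul_le_mul_of_nonneg_left
            (expect_condAvg_sq_rpow_le S h hp) (by positivity)) (by positivity))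
  have h3 : (#Sᶜ : ℝ) * (1 / k) * (C * (2 * (k / n) * V) + 2 * C * (k / n * D)) ≤
      #Sᶜ * (1 / k) * (A + levelError p h k) := by
    unfold levelError
    rw [← add_assoc]
    gcongr
  have hV0 : 0 ≤ V := expect_nonneg fun ε _ => mul_nonneg (by positivity)
    (expect_nonneg fun _ _ => sq_nonneg _)
  have h4 : C * (V + D) ≤ (#Sᶜ : ℝ) * (1 / k) * (C * (2 * (k / n) * V) + 2 * C * (k / n * D)) :=
    mul_add_le_of_le_two_mul hk0 hn0 hcard (by linarith) hV0 hD0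
  linarith

lemma levelAvg_succ_le {p : ℝ} (hp : 2 ≤ p) (h : (ι → Bool) → ℝ) {k j : ℕ} (hjk : j < k)
    (hkn : 2 * k ≤ Fintype.card ι) :
    levelAvg p h (j + 1) ≤ (1 + 1 / k) * levelAvg p h j + 1 / k * levelError p h k := by
  set n : ℕ := Fintype.card ι with hn
  have hch : (0 : ℝ) < n.choose j := by exact_mod_cast Nat.choose_pos (by omega)
  have hch' : (0 : ℝ) < n.choose (j + 1) := by exact_mod_cast Nat.choose_pos (by omega)
  have hnj : (0 : ℝ) < (n - j : ℕ) := by exact_mod_cast (by omega : 0 < n - j)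
  have hcc : (n.choose (j + 1) : ℝ) * (j + 1) = n.choose j * (n - j : ℕ) := by
    exact_mod_cast Nat.choose_succ_right_eq n j
  have h1 := sum_powersetCard_succ j fun S : Finset ι => 𝔼 ε, |condAvg S h ε| ^ p
  have h2 : ∑ S ∈ powersetCard j (univ : Finset ι), ∑ i ∈ Sᶜ,
      𝔼 ε, |condAvg (insert i S) h ε| ^ p ≤ ∑ S ∈ powersetCard j (univ : Finset ι),
      (n - j : ℕ) * ((1 + 1 / k) * (𝔼 ε, |condAvg S h ε| ^ p) + 1 / k * levelError p h k) := by
    refine sum_le_sum fun S hS => ?_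
    have hSj : #S = j := (mem_powersetCard.1 hS).2
    have := sum_compl_condAvg_insert_le hp h (k := k) (by omega) hkn (S := S) (by omega)
    rwa [card_compl, hSj] at this
  rw [← mul_sum, sum_add_distrib, ← mul_sum, sum_const, card_powersetCard, card_univ,
    nsmul_eq_mul] at h2
  rw [← h1] at h2
  unfold levelAvg
  rw [div_le_iff₀ hch']
  have hj1 : (0 : ℝ) < j + 1 := by positivity
  refine le_of_mul_le_mul_left ?_ hj1
  refine h2.trans (le_of_eq ?_)
  rw [← hn]
  have hsum := div_mul_cancel₀ (∑ S ∈ powersetCard j (univ : Finset ι),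
    𝔼 ε, |condAvg S h ε| ^ p) hch.ne'
  linear_combination -((1 + 1 / k) * ((∑ S ∈ powersetCard j (univ : Finset ι),
    𝔼 ε, |condAvg S h ε| ^ p) / n.choose j) + 1 / k * levelError p h k) * hcc -
    (n - j : ℕ) * (1 + 1 / k) * hsum

lemma levelAvg_le_of_two_mul_le {p : ℝ} (hp : 2 ≤ p) {h : (ι → Bool) → ℝ} (h0 : 𝔼 ε, h ε = 0)
    {k : ℕ} (hk : 1 ≤ k) (hkn : 2 * k ≤ Fintype.card ι) :
    levelAvg p h k ≤ Real.exp 1 * levelError p h k := by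
  have hk0 : (0 : ℝ) < k := by exact_mod_cast hk
  have hC1 := one_le_twoPointConst hp
  have hB : 0 ≤ levelError p h k := by
    unfold levelError
    have : 0 ≤ 𝔼 ε, |h ε| ^ p := expect_nonneg fun _ _ => by positivity
    have : 0 ≤ ∑ i, 𝔼 ε, |h ε - h (flip i ε)| ^ p :=
      sum_nonneg fun _ _ => expect_nonneg fun _ _ => by positivity
    positivity
  have key : ∀ j ≤ k, levelAvg p h j ≤ ((1 + 1 / k : ℝ) ^ j - 1) * levelError p h k := by
    intro j
    induction j with
    | zero => intro _; simp [levelAvg_zero (by linarith : 0 < p) h0]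
    | succ j ih =>
      intro hj
      have h1 := levelAvg_succ_le hp h (k := k) (j := j) (by omega) hkn
      have h2 := mul_le_mul_of_nonneg_left (ih (by omega)) (by positivity : (0 : ℝ) ≤ 1 + 1 / k)
      refine h1.trans ((add_le_add_left h2 _).trans (le_of_eq ?_))
      ring
  refine (key k le_rfl).trans (mul_le_mul_of_nonneg_right ?_ hB)
  have h1 : (1 + 1 / k : ℝ) ^ k ≤ Real.exp 1 := by
    calc (1 + 1 / k : ℝ) ^ k ≤ (Real.exp (1 / k)) ^ k := by
          gcongr
          linarith [Real.add_one_le_exp (1 / k : ℝ)]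
      _ = Real.exp 1 := by
          rw [← Real.exp_nat_mul]; congr 1; field_simp
  linarith

lemma levelAvg_le_expect {p : ℝ} (hp : 1 ≤ p) (h : (ι → Bool) → ℝ) {k : ℕ}
    (hkn : k ≤ Fintype.card ι) : levelAvg p h k ≤ 𝔼 ε, |h ε| ^ p := by
  have hch : (0 : ℝ) < (Fintype.card ι).choose k := by exact_mod_cast Nat.choose_pos hkn
  unfold levelAvg
  rw [div_le_iff₀ hch]
  calc _ ≤ ∑ S ∈ powersetCard k (univ : Finset ι), 𝔼 ε, |h ε| ^ p :=
        sum_le_sum fun S _ => expect_abs_condAvg_rpow_le S h hp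
    _ = _ := by simp [mul_comm]

/-- The constant in the `X_p` inequality on the discrete cube. -/
noncomputable def cubeConst (p : ℝ) : ℝ :=
  Real.exp 1 * (2 * twoPointConst p ^ (p / 2) * 2 ^ (p / 2) + 2 * twoPointConst p)

/-- The sharp `X_p` inequality for real-valued functions on the discrete cube. -/
lemma levelAvg_le {p : ℝ} (hp : 2 ≤ p) {h : (ι → Bool) → ℝ} (h0 : 𝔼 ε, h ε = 0)
    {k : ℕ} (hk : 1 ≤ k) (hkn : k ≤ Fintype.card ι) :
    levelAvg p h k ≤ cubeConst p * ((k / Fintype.card ι) *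
      ∑ i, 𝔼 ε, |h ε - h (flip i ε)| ^ p +
      (k / Fintype.card ι : ℝ) ^ (p / 2) * 𝔼 ε, |h ε| ^ p) := by
  set n : ℕ := Fintype.card ι with hn
  have hC1 := one_le_twoPointConst hp
  have hn0 : (0 : ℝ) < n := by exact_mod_cast (by omega : 0 < n)
  have hH : 0 ≤ 𝔼 ε, |h ε| ^ p := expect_nonneg fun _ _ => by positivity
  have hD : 0 ≤ ∑ i, 𝔼 ε, |h ε - h (flip i ε)| ^ p :=
    sum_nonneg fun _ _ => expect_nonneg fun _ _ => by positivity
  set H := 𝔼 ε, |h ε| ^ p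
  set D := ∑ i, 𝔼 ε, |h ε - h (flip i ε)| ^ p
  have hP : 0 ≤ (k / n : ℝ) ^ (p / 2) * H := by positivity
  have hQ : 0 ≤ (k / n : ℝ) * D := by positivity
  set a := twoPointConst p ^ (p / 2) * 2 ^ (p / 2) with ha
  have ha1 : 2 ^ (p / 2) ≤ a :=
    le_mul_of_one_le_left (by positivity) (Real.one_le_rpow hC1 (by linarith))
  have ha0 : 0 < a := lt_of_lt_of_le (by positivity) ha1
  have hcub : cubeConst p = Real.exp 1 * (2 * a + 2 * twoPointConst p) := by
    unfold cubeConst; ring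
  by_cases h2 : 2 * k ≤ n
  · refine (levelAvg_le_of_two_mul_le hp h0 hk h2).trans ?_
    rw [hcub, mul_assoc]
    refine mul_le_mul_of_nonneg_left ?_ (Real.exp_pos 1).le
    unfold levelError
    rw [Real.mul_rpow (by norm_num) (by positivity)]
    have e : twoPointConst p ^ (p / 2) * (2 ^ (p / 2) * (k / Fintype.card ι : ℝ) ^ (p / 2) * H) =
        a * ((k / n : ℝ) ^ (p / 2) * H) := by rw [ha]; ring
    rw [e]
    nlinarith [mul_nonneg ha0.le hP, mul_nonneg ha0.le hQ,
      mul_nonneg (by linarith : 0 ≤ twoPointConst p) hP]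
  · have h3 : 1 ≤ a * (k / n : ℝ) ^ (p / 2) := by
      have : (1 : ℝ) ≤ 2 * (k / n) := by
        rw [← mul_div_assoc, le_div_iff₀ hn0]
        exact_mod_cast (by omega : 1 * n ≤ 2 * k)
      calc (1 : ℝ) ≤ (2 * (k / n)) ^ (p / 2) := Real.one_le_rpow this (by linarith)
        _ = 2 ^ (p / 2) * (k / n : ℝ) ^ (p / 2) := Real.mul_rpow (by norm_num) (by positivity)
        _ ≤ _ := by gcongr
    refine (levelAvg_le_expect (by linarith) h hkn).trans ?_
    have h4 : H ≤ a * ((k / n : ℝ) ^ (p / 2) * H) := by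
      rw [← mul_assoc]; exact le_mul_of_one_le_left hH h3
    have he : 1 ≤ Real.exp 1 := Real.one_le_exp (by norm_num)
    have h5 : a ≤ cubeConst p := by rw [hcub]; nlinarith
    calc H ≤ a * ((k / n : ℝ) ^ (p / 2) * H) := h4
      _ ≤ cubeConst p * ((k / n : ℝ) ^ (p / 2) * H) := by gcongr
      _ ≤ _ := by
        refine mul_le_mul_of_nonneg_left (by linarith) (ha0.le.trans h5)

end Cube

section Torus

variable {X : Type*} [AddCommGroup X] [Fintype X]

lemma expect_add_right (v : X) (φ : X → ℝ) : 𝔼 x, φ (x + v) = 𝔼 x, φ x :=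
  Fintype.expect_equiv (Equiv.addRight v) _ _ fun _ => rfl

/-- The mean `p`-th power of the increments of `f` in the direction `v`. -/
noncomputable def osc (p : ℝ) (f : X → ℝ) (v : X) : ℝ := 𝔼 x, |f (x + v) - f x| ^ p

lemma osc_nonneg (p : ℝ) (f : X → ℝ) (v : X) : 0 ≤ osc p f v :=
  expect_nonneg fun _ _ => by positivity

lemma expect_abs_sub_rpow_eq_osc (p : ℝ) (f : X → ℝ) (u w : X) :
    𝔼 x, |f (x + u) - f (x + w)| ^ p = osc p f (u - w) := by
  unfold osc
  rw [← expect_add_right w fun x => |f (x + (u - w)) - f x| ^ p]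
  refine expect_congr rfl fun x _ => ?_
  rw [add_assoc, add_sub_cancel]

lemma osc_neg (p : ℝ) (f : X → ℝ) (v : X) : osc p f (-v) = osc p f v := by
  rw [← zero_sub, ← expect_abs_sub_rpow_eq_osc]
  simp only [osc, add_zero, abs_sub_comm]

lemma osc_nsmul_le {p : ℝ} (hp : 1 ≤ p) (f : X → ℝ) (N : ℕ) (v : X) :
    osc p f (N • v) ≤ N ^ p * osc p f v := by
  have hstep : ∀ i : ℕ, 𝔼 x, |f (x + (i + 1) • v) - f (x + i • v)| ^ p = osc p f v := by
    intro i
    rw [expect_abs_sub_rpow_eq_osc, add_smul, one_smul, add_sub_cancel_left]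
  calc osc p f (N • v)
      ≤ 𝔼 x, (N : ℝ) ^ (p - 1) *
          ∑ i ∈ range N, |f (x + (i + 1) • v) - f (x + i • v)| ^ p := by
        refine expect_le_expect fun x _ => ?_
        have h1 := Real.rpow_sum_le_const_mul_sum_rpow (range N)
          (fun i => f (x + (i + 1) • v) - f (x + i • v)) hp
        rw [card_range] at h1
        refine le_trans (Real.rpow_le_rpow (abs_nonneg _) ?_ (by linarith)) h1
        have h2 := sum_range_sub (fun i => f (x + i • v)) N
        rw [zero_smul, add_zero] at h2
        rw [← h2]
        exact abs_sum_le_sum_abs _ _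
    _ = (N : ℝ) ^ (p - 1) * (N * osc p f v) := by
        rw [← mul_expect, expect_sum_comm]
        simp [hstep]
    _ = N ^ p * osc p f v := by
        rcases Nat.eq_zero_or_pos N with rfl | hN
        · simp [Real.zero_rpow (by linarith : p ≠ 0)]
        · have : (0 : ℝ) < N := by exact_mod_cast hN
          rw [Real.rpow_sub_one this.ne']; field_simp

lemma osc_le_of_approx {p : ℝ} (hp : 1 ≤ p) (f g : X → ℝ) (v : X) :
    osc p f v ≤ 4 ^ p * (2 * (𝔼 x, |g x - f x| ^ p) + osc p g v) := by
  set D := 𝔼 x, |g x - f x| ^ p with hD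
  have hD0 : 0 ≤ D := expect_nonneg fun _ _ => by positivity
  have h1 : osc p f v ≤ 𝔼 x, 2 ^ p * (|g (x + v) - f (x + v)| ^ p +
      2 ^ p * (|g x - f x| ^ p + |g (x + v) - g x| ^ p)) := by
    refine expect_le_expect fun x _ => ?_
    have e : f (x + v) - f x = -(g (x + v) - f (x + v)) + ((g x - f x) + (g (x + v) - g x)) := by
      ring
    rw [e]
    refine (abs_add_rpow_le _ _ hp).trans ?_
    rw [abs_neg]
    gcongr
    exact abs_add_rpow_le _ _ hp
  rw [← mul_expect, expect_add_distrib, ← mul_expect, expect_add_distrib,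
    expect_add_right v fun x => |g x - f x| ^ p] at h1
  have h2 : (4 : ℝ) ^ p = 2 ^ p * 2 ^ p := by
    rw [← Real.mul_rpow (by norm_num) (by norm_num)]; norm_num
  have h3 : (1 : ℝ) ≤ 2 ^ p := Real.one_le_rpow (by norm_num) (by linarith)
  refine h1.trans ?_
  rw [h2, mul_assoc]
  refine mul_le_mul_of_nonneg_left ?_ (by positivity)
  change D + 2 ^ p * (D + osc p g v) ≤ _
  nlinarith

end Torus

section SignVectors

variable {ι : Type*} [Fintype ι] [DecidableEq ι] {R : Type*} [CommRing R] [Fintype R]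

/-- The vector of signs in `R` associated with a point of the discrete cube. -/
def signVec (R : Type*) [CommRing R] (ε : ι → Bool) : ι → R := fun j => if ε j then 1 else -1

/-- The restriction of a vector to a set of coordinates. -/
def restrictTo (S : Finset ι) (v : ι → R) : ι → R := fun j => if j ∈ S then v j else 0

omit [Fintype ι] [DecidableEq ι] [Fintype R] in
lemma signVec_not (ε : ι → Bool) : signVec R (fun j => !ε j) = -signVec R ε := by
  ext j
  cases h : ε j <;> simp [signVec, h]

omit [Fintype R] in
lemma signVec_piecewise (S : Finset ι) (ε δ : ι → Bool) :
    signVec R (S.piecewise ε δ) = restrictTo S (signVec R ε) + restrictTo Sᶜ (signVec R δ) := by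
  ext j
  by_cases hj : j ∈ S <;> simp [signVec, restrictTo, hj]

omit [Fintype ι] [Fintype R] in
lemma signVec_sub_signVec_flip (i : ι) (ε : ι → Bool) :
    signVec R ε - signVec R (flip i ε) = 2 • Pi.single i (if ε i then 1 else -1) := by
  ext j
  by_cases hj : j = i
  · subst hj
    cases h : ε j <;> simp [signVec, h] <;> ring
  · simp [signVec, flip_of_ne hj, hj]

/-- The average of `f` over all sign translates. -/
noncomputable def signAvg (f : (ι → R) → ℝ) (x : ι → R) : ℝ := 𝔼 δ, f (x + signVec R δ)

/-- The odd increment of `f` at `x` in the direction of a sign vector. -/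
def signIncr (f : (ι → R) → ℝ) (x : ι → R) (ε : ι → Bool) : ℝ :=
  f (x + signVec R ε) - f (x - signVec R ε)

omit [Fintype R] in
lemma expect_signIncr (f : (ι → R) → ℝ) (x : ι → R) : 𝔼 ε, signIncr f x ε = 0 := by
  unfold signIncr
  rw [expect_sub_distrib, ← expect_not fun ε => f (x - signVec R ε)]
  simp [signVec_not]

lemma expect_signAvg_sub_le {p : ℝ} (hp : 1 ≤ p) (f : (ι → R) → ℝ) :
    𝔼 x, |signAvg f x - f x| ^ p ≤ 𝔼 ε, osc p f (signVec R ε) := by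
  unfold osc
  rw [expect_comm]
  refine expect_le_expect fun x _ => ?_
  have : signAvg f x - f x = 𝔼 δ, (f (x + signVec R δ) - f x) := by
    rw [expect_sub_distrib, Fintype.expect_const]; rfl
  rw [this]
  exact abs_expect_rpow_le _ hp

lemma osc_signAvg_le {p : ℝ} (hp : 1 ≤ p) (f : (ι → R) → ℝ) (S : Finset ι) (ε : ι → Bool) :
    osc p (signAvg f) (2 • restrictTo S (signVec R ε)) ≤
      𝔼 x, |condAvg S (signIncr f x) ε| ^ p := by
  set r := restrictTo S (signVec R ε) with hr
  have e : ∀ x, signAvg f (x + 2 • r) - signAvg f x =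
      𝔼 η, 𝔼 δ, (f (x + 2 • r + signVec R (S.piecewise η δ)) -
        f (x + signVec R (S.piecewise η δ))) := by
    intro x
    unfold signAvg
    rw [← expect_sub_distrib]
    exact (expect_expect_piecewise S
      fun δ => f (x + 2 • r + signVec R δ) - f (x + signVec R δ)).symm
  have h1 : osc p (signAvg f) (2 • r) ≤ 𝔼 η, 𝔼 x,
      |𝔼 δ, (f (x + 2 • r + signVec R (S.piecewise η δ)) -
        f (x + signVec R (S.piecewise η δ)))| ^ p := by
    rw [expect_comm]
    refine expect_le_expect fun x _ => ?_
    rw [e]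
    exact abs_expect_rpow_le _ hp
  refine h1.trans (le_of_eq ?_)
  have h2 : ∀ η : ι → Bool, 𝔼 x, |𝔼 δ, (f (x + 2 • r + signVec R (S.piecewise η δ)) -
        f (x + signVec R (S.piecewise η δ)))| ^ p = 𝔼 x, |condAvg S (signIncr f x) ε| ^ p := by
    intro η
    refine (expect_add_right (-r - restrictTo S (signVec R η)) _).symm.trans ?_
    refine expect_congr rfl fun x _ => ?_
    congr 2
    unfold condAvg signIncr
    rw [expect_sub_distrib, expect_sub_distrib]
    congr 1
    · refine expect_congr rfl fun δ _ => ?_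
      rw [signVec_piecewise, signVec_piecewise]
      congr 1
      rw [← hr]
      abel
    · rw [← expect_not]
      refine expect_congr rfl fun δ _ => ?_
      rw [signVec_piecewise, signVec_piecewise, ← hr]
      congr 1
      have : restrictTo Sᶜ (signVec R fun j => !δ j) = -restrictTo Sᶜ (signVec R δ) := by
        rw [signVec_not]
        ext j
        by_cases hj : j ∈ S <;> simp [restrictTo, hj]
      rw [this]
      abel
  simp only [h2]
  exact Fintype.expect_const _

lemma expect_expect_signIncr_le {p : ℝ} (hp : 1 ≤ p) (f : (ι → R) → ℝ) :
    𝔼 x, 𝔼 ε, |signIncr f x ε| ^ p ≤ 2 * 2 ^ p * 𝔼 ε, osc p f (signVec R ε) := by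
  rw [expect_comm, mul_expect]
  refine expect_le_expect fun ε _ => ?_
  calc 𝔼 x, |signIncr f x ε| ^ p
      ≤ 𝔼 x, 2 ^ p * (|f (x + signVec R ε) - f (x + 0)| ^ p +
          |f (x + 0) - f (x + -signVec R ε)| ^ p) := by
        refine expect_le_expect fun x _ => ?_
        have e : signIncr f x ε = (f (x + signVec R ε) - f (x + 0)) +
            (f (x + 0) - f (x + -signVec R ε)) := by
          simp [signIncr, sub_eq_add_neg]
        rw [e]
        exact abs_add_rpow_le _ _ hp
    _ = 2 * 2 ^ p * osc p f (signVec R ε) := by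
        rw [← mul_expect, expect_add_distrib, expect_abs_sub_rpow_eq_osc,
          expect_abs_sub_rpow_eq_osc, sub_zero, zero_sub, neg_neg]
        ring

lemma expect_expect_signIncr_flip_le {p : ℝ} (hp : 1 ≤ p) (f : (ι → R) → ℝ) (i : ι) :
    𝔼 x, 𝔼 ε, |signIncr f x ε - signIncr f x (flip i ε)| ^ p ≤
      2 * 4 ^ p * osc p f (Pi.single i 1) := by
  rw [expect_comm]
  refine expect_le univ_nonempty fun ε _ => ?_
  set u := signVec R ε
  set w := signVec R (flip i ε)
  have huw : osc p f (u - w) ≤ 2 ^ p * osc p f (Pi.single i 1) := by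
    rw [signVec_sub_signVec_flip]
    refine (osc_nsmul_le hp f 2 _).trans (le_of_eq ?_)
    cases ε i
    · simp [Pi.single_neg, osc_neg]
    · simp
  calc 𝔼 x, |signIncr f x ε - signIncr f x (flip i ε)| ^ p
      ≤ 𝔼 x, 2 ^ p * (|f (x + u) - f (x + w)| ^ p + |f (x + -w) - f (x + -u)| ^ p) := by
        refine expect_le_expect fun x _ => ?_
        have e : signIncr f x ε - signIncr f x (flip i ε) =
            (f (x + u) - f (x + w)) + (f (x + -w) - f (x + -u)) := by
          simp only [signIncr, sub_eq_add_neg]; ring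
        rw [e]
        exact abs_add_rpow_le _ _ hp
    _ = 2 * 2 ^ p * osc p f (u - w) := by
        rw [← mul_expect, expect_add_distrib, expect_abs_sub_rpow_eq_osc,
          expect_abs_sub_rpow_eq_osc, neg_sub_neg]
        ring
    _ ≤ 2 * 2 ^ p * (2 ^ p * osc p f (Pi.single i 1)) := by gcongr
    _ = 2 * 4 ^ p * osc p f (Pi.single i 1) := by
        have h2 : (4 : ℝ) ^ p = 2 ^ p * 2 ^ p := by
          rw [← Real.mul_rpow (by norm_num) (by norm_num)]; norm_num
        rw [h2]; ring

/-- The constant in the metric `X_p` inequality. -/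
noncomputable def torusConst (p : ℝ) : ℝ :=
  4 ^ p * (2 + 2 ^ p * (cubeConst p * (2 * 4 ^ p)))

lemma cubeConst_pos {p : ℝ} (hp : 2 ≤ p) : 0 < cubeConst p := by
  have := one_le_twoPointConst hp
  unfold cubeConst
  positivity

lemma torusConst_pos {p : ℝ} (hp : 2 ≤ p) : 0 < torusConst p := by
  have := cubeConst_pos hp
  unfold torusConst
  positivity

lemma sum_osc_signAvg_div_le {p : ℝ} (hp : 2 ≤ p) (f : (ι → R) → ℝ) {k : ℕ} (hk : 1 ≤ k)
    (hkn : k ≤ Fintype.card ι) :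
    (∑ S ∈ powersetCard k (univ : Finset ι),
        𝔼 ε, osc p (signAvg f) (2 • restrictTo S (signVec R ε))) / (Fintype.card ι).choose k ≤
      cubeConst p * (2 * 4 ^ p) * ((k / Fintype.card ι) * ∑ i, osc p f (Pi.single i 1) +
        (k / Fintype.card ι : ℝ) ^ (p / 2) * 𝔼 ε, osc p f (signVec R ε)) := by
  have hc := cubeConst_pos hp
  have h24 : (2 : ℝ) ^ p ≤ 4 ^ p := Real.rpow_le_rpow (by norm_num) (by norm_num) (by linarith)
  have hD0 : 0 ≤ 𝔼 ε : ι → Bool, osc p f (signVec R ε) := expect_nonneg fun _ _ => osc_nonneg _ _ _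
  calc _ ≤ (∑ S ∈ powersetCard k (univ : Finset ι),
        𝔼 ε, 𝔼 x, |condAvg S (signIncr f x) ε| ^ p) / (Fintype.card ι).choose k := by
        gcongr with S _
        exact osc_signAvg_le (by linarith) f S _
    _ = 𝔼 x, levelAvg p (signIncr f x) k := by
        unfold levelAvg
        rw [← expect_div, expect_sum_comm]
        congr 1
        exact sum_congr rfl fun S _ => expect_comm _ _ _
    _ ≤ 𝔼 x, cubeConst p * ((k / Fintype.card ι) *
          ∑ i, 𝔼 ε, |signIncr f x ε - signIncr f x (flip i ε)| ^ p +
          (k / Fintype.card ι : ℝ) ^ (p / 2) * 𝔼 ε, |signIncr f x ε| ^ p) :=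
        expect_le_expect fun x _ => levelAvg_le hp (expect_signIncr f x) hk hkn
    _ = cubeConst p * ((k / Fintype.card ι) *
          ∑ i, 𝔼 x, 𝔼 ε, |signIncr f x ε - signIncr f x (flip i ε)| ^ p +
          (k / Fintype.card ι : ℝ) ^ (p / 2) * 𝔼 x, 𝔼 ε, |signIncr f x ε| ^ p) := by
        rw [← mul_expect, expect_add_distrib, ← mul_expect, ← mul_expect, expect_sum_comm]
    _ ≤ cubeConst p * ((k / Fintype.card ι) *
          ∑ i, 2 * 4 ^ p * osc p f (Pi.single i 1) +
          (k / Fintype.card ι : ℝ) ^ (p / 2) *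
            (2 * 4 ^ p * 𝔼 ε, osc p f (signVec R ε))) := by
        have h1 := expect_expect_signIncr_le (p := p) (by linarith) f
        have h2 := h1.trans (mul_le_mul_of_nonneg_right
          (mul_le_mul_of_nonneg_left h24 zero_le_two) hD0)
        have h3 := sum_le_sum fun i (_ : i ∈ (univ : Finset ι)) =>
          expect_expect_signIncr_flip_le (p := p) (by linarith) f i
        exact mul_le_mul_of_nonneg_left (add_le_add
          (mul_le_mul_of_nonneg_left h3 (by positivity))
          (mul_le_mul_of_nonneg_left h2 (by positivity))) hc.le
    _ = _ := by rw [← mul_sum]; ring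

/-- The sharp metric `X_p` inequality for real-valued functions. -/
lemma sum_osc_div_le {p : ℝ} (hp : 2 ≤ p) (f : (ι → R) → ℝ) {k m : ℕ} (hk : 1 ≤ k)
    (hkn : k ≤ Fintype.card ι) (hm : √(Fintype.card ι / k : ℝ) ≤ m) :
    (∑ S ∈ powersetCard k (univ : Finset ι),
        𝔼 ε, osc p f ((2 * m) • (2 • restrictTo S (signVec R ε)))) / (Fintype.card ι).choose k ≤
      torusConst p * m ^ p * ((k / Fintype.card ι) * ∑ i, osc p f (Pi.single i 1) +
        (k / Fintype.card ι : ℝ) ^ (p / 2) * 𝔼 ε, osc p f (signVec R ε)) := by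
  set n : ℕ := Fintype.card ι with hn
  set D := 𝔼 ε : ι → Bool, osc p f (signVec R ε) with hD
  set Q := (k / n : ℝ) * ∑ i, osc p f (Pi.single i 1) with hQ
  set P := (k / n : ℝ) ^ (p / 2) * D with hP
  have hk0 : (0 : ℝ) < k := by exact_mod_cast hk
  have hn0 : (0 : ℝ) < n := by exact_mod_cast (by omega : 0 < n)
  have hD0 : 0 ≤ D := expect_nonneg fun _ _ => osc_nonneg _ _ _
  have hQ0 : 0 ≤ Q := mul_nonneg (by positivity) (sum_nonneg fun _ _ => osc_nonneg _ _ _)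
  have hch : (0 : ℝ) < n.choose k := by exact_mod_cast Nat.choose_pos hkn
  have hDP : D ≤ m ^ p * P := by
    have h1 : (1 : ℝ) ≤ m ^ p * (k / n : ℝ) ^ (p / 2) := by
      have h2 : (n / k : ℝ) ≤ (m : ℝ) ^ 2 := (Real.sqrt_le_left (by positivity)).1 hm
      have h3 : (m : ℝ) ^ p = ((m : ℝ) ^ 2) ^ (p / 2) := by
        rw [← Real.rpow_two, ← Real.rpow_mul (by positivity)]; congr 1; ring
      rw [h3, ← Real.mul_rpow (by positivity) (by positivity)]
      refine Real.one_le_rpow ?_ (by linarith)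
      rw [div_le_iff₀ hk0] at h2
      rwa [← mul_div_assoc, le_div_iff₀ hn0, one_mul]
    rw [hP, ← mul_assoc]
    exact le_mul_of_one_le_left hD0 h1
  have hmain := sum_osc_signAvg_div_le hp f hk hkn
  rw [← hn, ← hD, ← hQ, ← hP] at hmain
  set Y := ∑ S ∈ powersetCard k (univ : Finset ι),
    𝔼 ε, osc p (signAvg f) (2 • restrictTo S (signVec R ε)) with hY
  have hstep : ∑ S ∈ powersetCard k (univ : Finset ι),
      𝔼 ε, osc p f ((2 * m) • (2 • restrictTo S (signVec R ε))) ≤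
      4 ^ p * (n.choose k * (2 * D) + (2 * m) ^ p * Y) := by
    calc _ ≤ ∑ S ∈ powersetCard k (univ : Finset ι), 𝔼 ε, 4 ^ p * (2 * D + (2 * m) ^ p *
          osc p (signAvg f) (2 • restrictTo S (signVec R ε))) := by
          refine sum_le_sum fun S _ => expect_le_expect fun ε _ => ?_
          refine (osc_le_of_approx (by linarith) f (signAvg f) _).trans ?_
          have h1 := expect_signAvg_sub_le (p := p) (by linarith) f
          have h2 := osc_nsmul_le (p := p) (by linarith) (signAvg f) (2 * m)
            (2 • restrictTo S (signVec R ε))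
          push_cast at h2
          exact mul_le_mul_of_nonneg_left (add_le_add (by linarith) h2) (by positivity)
      _ = _ := by
          simp only [← mul_expect, expect_add_distrib, Fintype.expect_const]
          rw [← mul_sum, sum_add_distrib, ← mul_sum, sum_const, card_powersetCard, card_univ,
            nsmul_eq_mul, ← mul_sum, ← hn]
          ring
  have hmp : (0 : ℝ) ≤ m ^ p := by positivity
  have h2m : (2 * m : ℝ) ^ p = 2 ^ p * m ^ p := Real.mul_rpow (by norm_num) (by positivity)
  calc _ ≤ 4 ^ p * (n.choose k * (2 * D) + (2 * m) ^ p * Y) / n.choose k := by gcongr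
    _ = 4 ^ p * (2 * D + 2 ^ p * m ^ p * (Y / n.choose k)) := by
        rw [h2m]; field_simp
    _ ≤ 4 ^ p * (2 * (m ^ p * (Q + P)) + 2 ^ p * m ^ p *
          (cubeConst p * (2 * 4 ^ p) * (Q + P))) := by
        have : D ≤ m ^ p * (Q + P) := by nlinarith [mul_nonneg hmp hQ0]
        gcongr
    _ = _ := by unfold torusConst; ring

end SignVectors

/-- The sharp metric `X_p` inequality for real-valued functions on `ℤ_{8m}^n`, with explicit
sums. -/
lemma sum_zmod_le {p : ℝ} (hp : 2 ≤ p) (k m n : ℕ) [NeZero (8 * m)] (hk : 1 ≤ k) (hkn : k ≤ n)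
    (hm : √((n : ℝ) / k) ≤ m) (f : (Fin n → ZMod (8 * m)) → ℝ) :
    (∑ S ∈ powersetCard k (univ : Finset (Fin n)),
        (∑ x : Fin n → ZMod (8 * m), ∑ ε : Fin n → Bool,
          |f (x + fun j => if j ∈ S then
              4 * (m : ZMod (8 * m)) * (if ε j then 1 else -1) else 0) - f x| ^ p) /
        (16 * m : ℝ) ^ n) / (n.choose k) ≤
    torusConst p * m ^ p * (((k : ℝ) / n) * ∑ j : Fin n,
          (∑ x : Fin n → ZMod (8 * m),
            |f (x + fun i => if i = j then (1 : ZMod (8 * m)) else 0) - f x| ^ p) /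
          (8 * m : ℝ) ^ n +
        ((k : ℝ) / n) ^ (p / 2) * (∑ x : Fin n → ZMod (8 * m), ∑ ε : Fin n → Bool,
            |f (x + fun j => if ε j then (1 : ZMod (8 * m)) else -1) - f x| ^ p) /
          (16 * m : ℝ) ^ n) := by
  have h := sum_osc_div_le (ι := Fin n) (R := ZMod (8 * m)) hp f hk
    (by rwa [Fintype.card_fin]) (by rwa [Fintype.card_fin])
  rw [Fintype.card_fin] at h
  have hX : (Fintype.card (Fin n → ZMod (8 * m)) : ℝ) = (8 * m) ^ n := by
    simp [ZMod.card]
  have hB : (Fintype.card (Fin n → Bool) : ℝ) = 2 ^ n := by simp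
  have hsum : ∀ v : (Fin n → Bool) → Fin n → ZMod (8 * m),
      𝔼 ε, osc p f (v ε) = (∑ x, ∑ ε, |f (x + v ε) - f x| ^ p) / (16 * m : ℝ) ^ n := by
    intro v
    unfold osc
    rw [Fintype.expect_eq_sum_div_card, hB]
    simp only [Fintype.expect_eq_sum_div_card, hX]
    rw [← sum_div, sum_comm, div_div, ← mul_pow]
    congr 2; ring
  have hv : ∀ (S : Finset (Fin n)) (ε : Fin n → Bool),
      (2 * m) • (2 • restrictTo S (signVec (ZMod (8 * m)) ε)) = fun j => if j ∈ S then
        4 * (m : ZMod (8 * m)) * (if ε j then 1 else -1) else 0 := by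
    intro S ε
    ext j
    by_cases hj : j ∈ S
    · rw [smul_smul, Pi.smul_apply]
      simp only [restrictTo, signVec, hj, if_true, nsmul_eq_mul]
      push_cast; ring
    · simp [restrictTo, hj]
  have he : ∀ j : Fin n, (Pi.single j 1 : Fin n → ZMod (8 * m)) =
      fun i => if i = j then (1 : ZMod (8 * m)) else 0 := by
    intro j
    ext i
    simp [Pi.single_apply]
  simp only [hsum, hv, he] at h
  rw [mul_div_assoc]
  simp only [osc, Fintype.expect_eq_sum_div_card, hX] at h
  exact h

section Reduction

open MeasureTheory

lemma integrable_abs_sub_rpow {p : ℝ} (hp : 2 ≤ p) (g₁ g₂ : LpSpace p) :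
    Integrable fun t => |g₁ t - g₂ t| ^ p := by
  have h := ((Lp.memLp g₁).sub (Lp.memLp g₂)).integrable_norm_rpow
    (ENNReal.ofReal_pos.2 (by linarith)).ne' ENNReal.ofReal_ne_top
  rwa [ENNReal.toReal_ofReal (by linarith)] at h

lemma norm_sub_rpow_eq_integral {p : ℝ} (hp : 2 ≤ p) (g₁ g₂ : LpSpace p) :
    ‖g₁ - g₂‖ ^ p = ∫ t, |g₁ t - g₂ t| ^ p := by
  have h0 : 0 ≤ ∫ t, |g₁ t - g₂ t| ^ p := integral_nonneg fun _ => by positivity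
  rw [Lp.norm_def, eLpNorm_congr_ae (Lp.coeFn_sub g₁ g₂),
    MemLp.eLpNorm_eq_integral_rpow_norm (ENNReal.ofReal_pos.2 (by linarith)).ne'
      ENNReal.ofReal_ne_top ((Lp.memLp g₁).sub (Lp.memLp g₂)),
    ENNReal.toReal_ofReal (by linarith : 0 ≤ p)]
  simp only [Pi.sub_apply, Real.norm_eq_abs]
  rw [ENNReal.toReal_ofReal (by positivity), Real.rpow_inv_rpow h0 (by linarith)]

lemma sum_norm_zmod_le {p : ℝ} (hp : 2 ≤ p) (k m n : ℕ) [NeZero (8 * m)] (hk : 1 ≤ k)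
    (hkn : k ≤ n) (hm : √((n : ℝ) / k) ≤ m) (f : (Fin n → ZMod (8 * m)) → LpSpace p) :
    (∑ S ∈ powersetCard k (univ : Finset (Fin n)),
        (∑ x : Fin n → ZMod (8 * m), ∑ ε : Fin n → Bool,
          ‖f (x + fun j => if j ∈ S then
              4 * (m : ZMod (8 * m)) * (if ε j then 1 else -1) else 0) - f x‖ ^ p) /
        (16 * m : ℝ) ^ n) / (n.choose k) ≤
    torusConst p * m ^ p * (((k : ℝ) / n) * ∑ j : Fin n,
          (∑ x : Fin n → ZMod (8 * m),
            ‖f (x + fun i => if i = j then (1 : ZMod (8 * m)) else 0) - f x‖ ^ p) /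
          (8 * m : ℝ) ^ n +
        ((k : ℝ) / n) ^ (p / 2) * (∑ x : Fin n → ZMod (8 * m), ∑ ε : Fin n → Bool,
            ‖f (x + fun j => if ε j then (1 : ZMod (8 * m)) else -1) - f x‖ ^ p) /
          (16 * m : ℝ) ^ n) := by
  have hI := integrable_abs_sub_rpow hp
  have hI1 : ∀ v : (Fin n → ZMod (8 * m)), Integrable fun t => ∑ x, |f (x + v) t - f x t| ^ p :=
    fun v => integrable_finsetSum _ fun x _ => hI _ _
  have hI2 : ∀ v : (Fin n → Bool) → (Fin n → ZMod (8 * m)),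
      Integrable fun t => ∑ x, ∑ ε, |f (x + v ε) t - f x t| ^ p :=
    fun v => integrable_finsetSum _ fun x _ => integrable_finsetSum _ fun ε _ => hI _ _
  have h1 : ∀ v : (Fin n → ZMod (8 * m)),
      ∑ x, ‖f (x + v) - f x‖ ^ p = ∫ t, ∑ x, |f (x + v) t - f x t| ^ p := by
    intro v
    rw [integral_finsetSum _ fun x _ => hI _ _]
    exact sum_congr rfl fun x _ => norm_sub_rpow_eq_integral hp _ _
  have h2 : ∀ v : (Fin n → Bool) → (Fin n → ZMod (8 * m)),
      ∑ x, ∑ ε, ‖f (x + v ε) - f x‖ ^ p = ∫ t, ∑ x, ∑ ε, |f (x + v ε) t - f x t| ^ p := by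
    intro v
    rw [integral_finsetSum _ fun x _ => integrable_finsetSum _ fun ε _ => hI _ _]
    refine sum_congr rfl fun x _ => ?_
    rw [integral_finsetSum _ fun ε _ => hI _ _]
    exact sum_congr rfl fun ε _ => norm_sub_rpow_eq_integral hp _ _
  have h3 := fun S : Finset (Fin n) => h2 fun ε j => if j ∈ S then
    4 * (m : ZMod (8 * m)) * (if ε j then 1 else -1) else 0
  have h4 := h2 fun ε j => if ε j then (1 : ZMod (8 * m)) else -1
  simp only [h1, h3, h4, ← integral_div, ← integral_const_mul]
  have hI5 := fun S (_ : S ∈ powersetCard k (univ : Finset (Fin n))) =>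
    (hI2 fun ε j => if j ∈ S then
      4 * (m : ZMod (8 * m)) * (if ε j then 1 else -1) else 0).div_const ((16 * m : ℝ) ^ n)
  have hI6 := fun j (_ : j ∈ (univ : Finset (Fin n))) =>
    (hI1 fun i => if i = j then (1 : ZMod (8 * m)) else 0).div_const ((8 * m : ℝ) ^ n)
  have hI7 := ((hI2 fun ε j => if ε j then (1 : ZMod (8 * m)) else -1).const_mul
    (((k : ℝ) / n) ^ (p / 2))).div_const ((16 * m : ℝ) ^ n)
  rw [← integral_finsetSum _ hI5, ← integral_finsetSum _ hI6, ← integral_div,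
    ← integral_const_mul,
    ← integral_add ((integrable_finsetSum _ hI6).const_mul _) hI7, ← integral_const_mul]
  refine integral_mono ((integrable_finsetSum _ hI5).div_const _)
    ((((integrable_finsetSum _ hI6).const_mul _).add hI7).const_mul _) fun t => ?_
  exact sum_zmod_le hp k m n hk hkn hm fun x => f x t

end Reduction

end XpInequality

/-- **Theorem 1.3: `L_p` is an `X_p` metric space with sharp scaling parameter.**
For every `p ∈ [2,∞)` there is `C = C(p) > 0` such that for all `k, m, n ∈ ℕ` with `k ≤ n` and
`m ≥ √(n/k)`, every `f : ℤ_{8m}^n → L_p` satisfies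
`((1/binom(n,k)) Σ_{|S|=k} E[‖f(x + 4mε_S) - f(x)‖^p])^{1/p}
  ≤ C m ((k/n) Σ_j E[‖f(x+e_j) - f(x)‖^p] + (k/n)^{p/2} E[‖f(x+ε) - f(x)‖^p])^{1/p}`,
with expectations over uniform `(x, ε) ∈ ℤ_{8m}^n × {-1,1}^n`. -/
theorem Lp_is_Xp_metric_space_sharp_scaling (p : ℝ) (hp : 2 ≤ p) :
    ∃ C : ℝ, 0 < C ∧ ∀ (k m n : ℕ) [NeZero (8 * m)], 1 ≤ k → k ≤ n →
      Real.sqrt ((n : ℝ) / k) ≤ m →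
      ∀ f : (Fin n → ZMod (8 * m)) → LpSpace p,
      ((∑ S ∈ powersetCard k (univ : Finset (Fin n)),
          (∑ x : Fin n → ZMod (8 * m), ∑ ε : Fin n → Bool,
            ‖f (x + fun j => if j ∈ S then
                4 * (m : ZMod (8 * m)) * (if ε j then 1 else -1) else 0) - f x‖ ^ p) /
          (16 * m : ℝ) ^ n) / (n.choose k)) ^ (1 / p) ≤
      C * m * (((k : ℝ) / n) * ∑ j : Fin n,
            (∑ x : Fin n → ZMod (8 * m),
              ‖f (x + fun i => if i = j then (1 : ZMod (8 * m)) else 0) - f x‖ ^ p) /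
            (8 * m : ℝ) ^ n +
          ((k : ℝ) / n) ^ (p / 2) * (∑ x : Fin n → ZMod (8 * m), ∑ ε : Fin n → Bool,
              ‖f (x + fun j => if ε j then (1 : ZMod (8 * m)) else -1) - f x‖ ^ p) /
            (16 * m : ℝ) ^ n) ^ (1 / p) := by
  refine ⟨XpInequality.torusConst p ^ (1 / p), by
    have := XpInequality.torusConst_pos hp
    positivity, ?_⟩
  intro k m n _ hk hkn hm f
  have hK := XpInequality.torusConst_pos hp
  have hp0 : p ≠ 0 := by linarith
  have : Fact ((1 : ENNReal) ≤ ENNReal.ofReal p) :=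
    ⟨ENNReal.one_le_ofReal.2 (by linarith)⟩
  have h := XpInequality.sum_norm_zmod_le hp k m n hk hkn hm f
  refine (Real.rpow_le_rpow (by positivity) h (by positivity)).trans (le_of_eq ?_)
  rw [Real.mul_rpow (by positivity) (by positivity), Real.mul_rpow hK.le (by positivity),
    one_div, Real.rpow_rpow_inv (by positivity) hp0]
end
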